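/- Suppose 2 ≤ n < m − 3. Define o_{m,n} = Σ{ s_A : A ∈ F^m_{n+2} with min A ≥ 2 }, where for A = i_1 i_2 ⋯ i_{n+2} (increasing) s_A = Σ_{k=2}^{n} (k choose 2) + Σ_{ℓ=1}^{n} c_ℓ·(n+2−ℓ choose 2) with c_1 = i_1 − 1 and c_ℓ = i_ℓ − (i_{ℓ−1} + 1) for ℓ ≥ 2. Then VR(F_n^m ∪ F_{n+2}^m, 2) ≃ VR(F^{m−1}_{n−1} ∪ F^{m−1}_{n+1}, 2) ∨ ( ∨_{o_{m,n}} S³ ). Consequently, for 1 ≤ n < m−3, VR(F_n^m ∪ F_{n+2}^m, 2) is homotopy equivalent to a wedge sum of ( Σ_{k=2}^{n} o_{m+k−n, k} + (m+1−n choose 4) ) copies of S³. -/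

import Mathlib

open Finset

/-- An abstract simplicial complex on a vertex type `V`: a collection of nonempty
finite subsets of `V` (the faces), closed under taking nonempty subsets. -/
structure AbsSC (V : Type) where
  faces : Set (Finset V)
  not_empty_mem : ∅ ∉ faces
  down_closed : ∀ s ∈ faces, ∀ t : Finset V, t ⊆ s → t ≠ ∅ → t ∈ faces

namespace AbsSC

variable {V W : Type}

/-- The vertex set of a simplicial complex. -/
def vertices (K : AbsSC V) : Set V := {v | ({v} : Finset V) ∈ K.faces}

/-- The geometric realization of a simplicial complex: the space of convex weightings
supported on a face, topologized as a subspace of `V → ℝ`. -/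
def space (K : AbsSC V) : Type :=
  {f : V → ℝ // (∀ v, 0 ≤ f v) ∧ ∃ s ∈ K.faces, (∀ v, f v ≠ 0 → v ∈ s) ∧ ∑ v ∈ s, f v = 1}

instance (K : AbsSC V) : TopologicalSpace K.space := by unfold space; infer_instance

/-- `L` is a subcomplex of `K`. -/
def IsSubcomplex (L K : AbsSC V) : Prop := L.faces ⊆ K.faces

/-- Homotopy equivalence of simplicial complexes (of their geometric realizations). -/
def HEquiv (K : AbsSC V) (L : AbsSC W) : Prop :=
  Nonempty (ContinuousMap.HomotopyEquiv K.space L.space)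

/-- The realization of `K` is homotopy equivalent to the topological space `X`. -/
def HEquivTop (K : AbsSC V) (X : Type) [TopologicalSpace X] : Prop :=
  Nonempty (ContinuousMap.HomotopyEquiv K.space X)

/-- The inclusion of realizations induced by a subcomplex inclusion. -/
def incl {L K : AbsSC V} (h : L.faces ⊆ K.faces) : C(L.space, K.space) where
  toFun f := ⟨f.1, f.2.1, by obtain ⟨s, hs, h1, h2⟩ := f.2.2; exact ⟨s, h hs, h1, h2⟩⟩
  continuous_toFun := Continuous.subtype_mk continuous_subtype_val _

variable [DecidableEq V]

/-- The link of a vertex. -/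
def link (K : AbsSC V) (v : V) : AbsSC V where
  faces := {σ | σ ≠ ∅ ∧ v ∉ σ ∧ σ ∪ {v} ∈ K.faces}
  not_empty_mem h := h.1 rfl
  down_closed := by
    rintro s ⟨hne, hv, hs⟩ t hts htne
    exact ⟨htne, fun hvt => hv (hts hvt),
      K.down_closed _ hs _ (Finset.union_subset_union hts (Finset.Subset.refl _)) (by simp [Finset.union_eq_empty])⟩

lemma link_subset (K : AbsSC V) (v : V) : (K.link v).faces ⊆ K.faces := by
  rintro σ ⟨hne, hv, hσ⟩
  exact K.down_closed _ hσ _ Finset.subset_union_left hne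

/-- The complex induced on the vertices other than `v`. -/
def delete (K : AbsSC V) (v : V) : AbsSC V where
  faces := {σ | σ ∈ K.faces ∧ v ∉ σ}
  not_empty_mem h := K.not_empty_mem h.1
  down_closed := by
    rintro s ⟨hs, hv⟩ t hts htne
    exact ⟨K.down_closed _ hs _ hts htne, fun h => hv (hts h)⟩

/-- The star of a vertex: `st_K(v) = {σ : σ ∪ {v} ∈ K}`. -/
def star (K : AbsSC V) (v : V) : AbsSC V where
  faces := {σ | σ ≠ ∅ ∧ σ ∪ {v} ∈ K.faces}
  not_empty_mem h := h.1 rfl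
  down_closed := by
    rintro s ⟨hne, hs⟩ t hts htne
    exact ⟨htne,
      K.down_closed _ hs _ (Finset.union_subset_union hts (Finset.Subset.refl _)) (by simp [Finset.union_eq_empty])⟩

/-- The star cluster of a subcomplex `L` in `K`: the union of stars of vertices of `L`. -/
def starCluster (K L : AbsSC V) : AbsSC V where
  faces := {σ | σ ≠ ∅ ∧ ∃ v, ({v} : Finset V) ∈ L.faces ∧ σ ∪ {v} ∈ K.faces}
  not_empty_mem h := h.1 rfl
  down_closed := by
    rintro s ⟨hne, v, hvL, hs⟩ t hts htne
    exact ⟨htne, v, hvL,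
      K.down_closed _ hs _ (Finset.union_subset_union hts (Finset.Subset.refl _)) (by simp [Finset.union_eq_empty])⟩

/-- The union of two simplicial complexes. -/
def union (K₁ K₂ : AbsSC V) : AbsSC V where
  faces := K₁.faces ∪ K₂.faces
  not_empty_mem h := by
    rcases h with h | h
    exacts [K₁.not_empty_mem h, K₂.not_empty_mem h]
  down_closed := by
    rintro s (hs | hs) t hts htne
    exacts [Or.inl (K₁.down_closed _ hs _ hts htne), Or.inr (K₂.down_closed _ hs _ hts htne)]

/-- The union of a family of simplicial complexes. -/
def iUnionC {ι : Type} (F : ι → AbsSC V) : AbsSC V where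
  faces := ⋃ i, (F i).faces
  not_empty_mem h := by
    obtain ⟨i, hi⟩ := Set.mem_iUnion.mp h
    exact (F i).not_empty_mem hi
  down_closed := by
    intro s hs t hts htne
    obtain ⟨i, hi⟩ := Set.mem_iUnion.mp hs
    exact Set.mem_iUnion.mpr ⟨i, (F i).down_closed _ hi _ hts htne⟩

/-- The `n`-skeleton of a complex: all faces with at most `n+1` vertices. -/
def skeleton (K : AbsSC V) (n : ℕ) : AbsSC V where
  faces := {σ | σ ∈ K.faces ∧ σ.card ≤ n + 1}
  not_empty_mem h := K.not_empty_mem h.1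
  down_closed := by
    rintro s ⟨hs, hcard⟩ t hts htne
    exact ⟨K.down_closed _ hs _ hts htne, le_trans (Finset.card_le_card hts) hcard⟩

/-- The simplicial complex generated by a single simplex `s` (all its nonempty subsets). -/
def simplexCx (s : Finset V) : AbsSC V where
  faces := {t | t ≠ ∅ ∧ t ⊆ s}
  not_empty_mem h := h.1 rfl
  down_closed := by
    rintro a ⟨hne, has⟩ t hta htne
    exact ⟨htne, hta.trans has⟩

/-- A maximal simplex (facet) of `K`. -/
def IsFacet (K : AbsSC V) (σ : Finset V) : Prop :=
  σ ∈ K.faces ∧ ∀ τ ∈ K.faces, σ ⊆ τ → τ = σ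

/-- `K` is a clique complex: any nonempty set of vertices which pairwise span edges is a face. -/
def IsCliqueCx (K : AbsSC V) : Prop :=
  ∀ σ : Finset V, σ ≠ ∅ → (∀ v ∈ σ, ({v} : Finset V) ∈ K.faces) →
    (∀ v ∈ σ, ∀ w ∈ σ, v ≠ w → ({v, w} : Finset V) ∈ K.faces) → σ ∈ K.faces

/-- `L` is a full subcomplex of `K`. -/
def IsFull (L K : AbsSC V) : Prop :=
  ∀ σ ∈ K.faces, (∀ v ∈ σ, ({v} : Finset V) ∈ L.faces) → σ ∈ L.faces

end AbsSC

noncomputable section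

/-- The `n`-dimensional sphere. -/
abbrev Sph (n : ℕ) : Type := Metric.sphere (0 : EuclideanSpace ℝ (Fin (n + 1))) 1

/-- A base point on the sphere. -/
def sphBase (n : ℕ) : Sph n :=
  ⟨EuclideanSpace.single 0 1, by simp⟩

/-- Relation gluing the base points of `c` copies of a pointed space to an auxiliary point. -/
inductive wedgeRel (c : ℕ) (X : Type) (x₀ : X) : Unit ⊕ Fin c × X → Unit ⊕ Fin c × X → Prop
  | glue (i : Fin c) : wedgeRel c X x₀ (Sum.inl ()) (Sum.inr (i, x₀))

/-- The wedge sum of `c` copies of the pointed space `(X, x₀)`. -/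
def Wedge (c : ℕ) (X : Type) [TopologicalSpace X] (x₀ : X) : Type := Quot (wedgeRel c X x₀)

instance (c : ℕ) (X : Type) [TopologicalSpace X] (x₀ : X) : TopologicalSpace (Wedge c X x₀) := by
  unfold Wedge; infer_instance

/-- The base point of the wedge. -/
def wedgePt (c : ℕ) (X : Type) [TopologicalSpace X] (x₀ : X) : Wedge c X x₀ :=
  Quot.mk _ (Sum.inl ())

/-- The wedge sum of `c` copies of the `n`-sphere. -/
abbrev WedgeSph (n c : ℕ) : Type := Wedge c (Sph n) (sphBase n)

/-- The base point of a wedge of spheres. -/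
def wedgeSphPt (n c : ℕ) : WedgeSph n c := wedgePt c _ _

/-- Relation gluing the two base points in a binary wedge. -/
inductive wedge2Rel (X Y : Type) (x₀ : X) (y₀ : Y) : X ⊕ Y → X ⊕ Y → Prop
  | glue : wedge2Rel X Y x₀ y₀ (Sum.inl x₀) (Sum.inr y₀)

/-- The wedge sum `X ∨ Y` of two pointed spaces. -/
def Wedge2 (X Y : Type) [TopologicalSpace X] [TopologicalSpace Y] (x₀ : X) (y₀ : Y) : Type :=
  Quot (wedge2Rel X Y x₀ y₀)

instance (X Y : Type) [TopologicalSpace X] [TopologicalSpace Y] (x₀ : X) (y₀ : Y) :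
    TopologicalSpace (Wedge2 X Y x₀ y₀) := by unfold Wedge2; infer_instance

/-- Relation collapsing the top and bottom of the cylinder `X × [0,1]` to two cone points. -/
inductive suspRel (X : Type) : X × unitInterval ⊕ Bool → X × unitInterval ⊕ Bool → Prop
  | zero (x : X) : suspRel X (Sum.inl (x, 0)) (Sum.inr false)
  | one (x : X) : suspRel X (Sum.inl (x, 1)) (Sum.inr true)

/-- The (unreduced) suspension `Σ X`. -/
def Susp (X : Type) [TopologicalSpace X] : Type := Quot (suspRel X)

instance (X : Type) [TopologicalSpace X] : TopologicalSpace (Susp X) := by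
  unfold Susp; infer_instance

/-- The north cone point of the suspension. -/
def suspNorth (X : Type) [TopologicalSpace X] : Susp X := Quot.mk _ (Sum.inr true)

end

/-- The Vietoris–Rips complex at scale `r` of a collection `F` of finite subsets of `ℕ`,
with respect to the symmetric difference metric `d(A,B) = |A Δ B|`. -/
def VRc (F : Set (Finset ℕ)) (r : ℕ) : AbsSC (Finset ℕ) where
  faces := {σ | σ.Nonempty ∧ (∀ A ∈ σ, A ∈ F) ∧
    ∀ A ∈ σ, ∀ B ∈ σ, (symmDiff A B).card ≤ r}
  not_empty_mem h := by simpa using h.1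
  down_closed := by
    rintro s ⟨hne, hF, hd⟩ t hts htne
    exact ⟨Finset.nonempty_iff_ne_empty.mpr htne, fun A hA => hF A (hts hA),
      fun A hA B hB => hd A (hts hA) B (hts hB)⟩

/-- `F_n^m`: all `n`-element subsets of `[m] = {1, …, m}`. -/
def Fnm (m n : ℕ) : Set (Finset ℕ) := {A | A ⊆ Finset.Icc 1 m ∧ A.card = n}

/-- `F_{≤ n}^m`: all subsets of `[m]` of cardinality at most `n`. -/
def Fle (m n : ℕ) : Set (Finset ℕ) := {A | A ⊆ Finset.Icc 1 m ∧ A.card ≤ n}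

/-- The simplex `N[C] = {A : C ⊆ A, |A \ C| = 1}` inside `[m]`. -/
def NSimp (m : ℕ) (C : Finset ℕ) : Finset (Finset ℕ) :=
  (Finset.Icc 1 m \ C).image (fun x => insert x C)

/-- The simplex `L[S]`: all subsets of `S` obtained by removing one element. -/
def LSimp (S : Finset ℕ) : Finset (Finset ℕ) := S.image (fun x => S.erase x)

/-- The total order `≺`: first compare cardinalities, then compare the increasing
enumerations lexicographically. -/
def precLT (A B : Finset ℕ) : Prop :=
  A.card < B.card ∨
    (A.card = B.card ∧ List.Lex (· < ·) (A.sort (· ≤ ·)) (B.sort (· ≤ ·)))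

/-- `A ⪯ B`. -/
def precLE (A B : Finset ℕ) : Prop := precLT A B ∨ A = B

/-- `F^m_{≺ A}`: all subsets of `[m]` strictly preceding `A`. -/
def FprecLT (m : ℕ) (A : Finset ℕ) : Set (Finset ℕ) :=
  {B | B ⊆ Finset.Icc 1 m ∧ precLT B A}

/-- `F^m_{⪯ A}`: all subsets of `[m]` preceding (or equal to) `A`. -/
def FprecLE (m : ℕ) (A : Finset ℕ) : Set (Finset ℕ) :=
  {B | B ⊆ Finset.Icc 1 m ∧ precLE B A}

/-- The `j`-th value (0-indexed) of an enumeration `i : Fin n → ℕ`. -/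
def ith {n : ℕ} (i : Fin n → ℕ) (j : ℕ) : ℕ := if h : j < n then i ⟨j, h⟩ else 0

/-- The `ℓ`-th entry (1-indexed) of the enumeration, as an integer, with `i_0 = -1`. -/
def ivZ {n : ℕ} (i : Fin n → ℕ) (ℓ : ℕ) : ℤ := if ℓ = 0 then -1 else (ith i (ℓ - 1) : ℤ)

/-- For `B = i_1 i_2 ⋯ i_n` (increasing), with `d_1 = i_1` and
`d_ℓ = i_ℓ - (i_{ℓ-1} + 1)`, `r_B = Σ_{k=2}^{n-2} C(k,2) + Σ_{ℓ=1}^{n-2} d_ℓ·C(n-ℓ,2)`. -/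
def rA (B : Finset ℕ) : ℕ :=
  (∑ k ∈ Finset.Icc 2 (B.card - 2), Nat.choose k 2) +
    ∑ ℓ ∈ Finset.Icc 1 (B.card - 2),
      ((B.sort (· ≤ ·)).getD (ℓ - 1) 0 -
        (if ℓ = 1 then 0 else (B.sort (· ≤ ·)).getD (ℓ - 2) 0 + 1)) * Nat.choose (B.card - ℓ) 2

/-- For `B = i_1 i_2 ⋯ i_n` (increasing), with `c_1 = i_1 - 1` and
`c_ℓ = i_ℓ - (i_{ℓ-1} + 1)`, `s_B = Σ_{k=2}^{n-2} C(k,2) + Σ_{ℓ=1}^{n-2} c_ℓ·C(n-ℓ,2)`. -/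
def sA (B : Finset ℕ) : ℕ :=
  (∑ k ∈ Finset.Icc 2 (B.card - 2), Nat.choose k 2) +
    ∑ ℓ ∈ Finset.Icc 1 (B.card - 2),
      ((B.sort (· ≤ ·)).getD (ℓ - 1) 0 -
        (if ℓ = 1 then 1 else (B.sort (· ≤ ·)).getD (ℓ - 2) 0 + 1)) * Nat.choose (B.card - ℓ) 2

/-- `t_n = Σ_{A ⊆ [m], |A| = n} r_A`. -/
def tN (m n : ℕ) : ℕ :=
  ∑ A ∈ (Finset.Icc 1 m).powerset.filter (fun A => A.card = n), rA A

/-- `o_{m,n} = Σ { s_A : A ∈ F^m_{n+2}, min A ≥ 2 }`. -/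
def omn (m n : ℕ) : ℕ :=
  ∑ A ∈ (Finset.Icc 1 m).powerset.filter (fun A => A.card = n + 2 ∧ ∀ x ∈ A, 2 ≤ x), sA A

namespace AbsSC

section Realization

variable {V : Type}

theorem faces_injective {K L : AbsSC V} (h : K.faces = L.faces) : K = L := by
  cases K; cases L; cases h; rfl

/-- The barycentric coordinates of a point of the realization. -/
def wt {K : AbsSC V} (x : K.space) (v : V) : ℝ := x.1 v

/-- The point with given barycentric coordinates. -/
def ofWt (K : AbsSC V) (f : V → ℝ) (h0 : ∀ v, 0 ≤ f v)
    (h1 : ∃ s ∈ K.faces, (∀ v, f v ≠ 0 → v ∈ s) ∧ ∑ v ∈ s, f v = 1) : K.space := ⟨f, h0, h1⟩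

@[simp]
theorem wt_ofWt {K : AbsSC V} {f : V → ℝ} {h0 h1} (v : V) : wt (K.ofWt f h0 h1) v = f v := rfl

@[simp]
theorem wt_incl {K L : AbsSC V} (h : L.faces ⊆ K.faces) (x : L.space) (v : V) :
    wt (incl h x) v = wt x v := rfl

theorem wt_nonneg {K : AbsSC V} (x : K.space) (v : V) : 0 ≤ wt x v := x.2.1 v

theorem exists_face {K : AbsSC V} (x : K.space) :
    ∃ s ∈ K.faces, (∀ v, wt x v ≠ 0 → v ∈ s) ∧ ∑ v ∈ s, wt x v = 1 := x.2.2

@[fun_prop]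
theorem continuous_wt {K : AbsSC V} (v : V) : Continuous fun x : K.space => wt x v :=
  (continuous_apply v).comp continuous_subtype_val

theorem continuous_into {K : AbsSC V} {X : Type*} [TopologicalSpace X] {f : X → K.space}
    (h : ∀ v, Continuous fun x => wt (f x) v) : Continuous f :=
  Continuous.subtype_mk (continuous_pi h) _

theorem space_ext {K : AbsSC V} {x y : K.space} (h : ∀ v, wt x v = wt y v) : x = y :=
  Subtype.ext (funext h)

theorem sum_eq_one {K : AbsSC V} (x : K.space) {s : Finset V} (hs : ∀ v, wt x v ≠ 0 → v ∈ s) :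
    ∑ v ∈ s, wt x v = 1 := by
  classical
  obtain ⟨u, -, hu, h1⟩ := exists_face x
  rw [← h1, sum_subset (subset_union_left : s ⊆ s ∪ u), sum_subset (subset_union_right : u ⊆ s ∪ u)]
  · intro v _ hv
    by_contra h
    exact hv (hu v h)
  · intro v _ hv
    by_contra h
    exact hv (hs v h)

/-- The vertex `v`, as a point of the realization. -/
noncomputable def vtx (K : AbsSC V) (v : V) (h : {v} ∈ K.faces) : K.space :=
  K.ofWt (Set.indicator {v} 1) (Set.indicator_nonneg (by simp)) ⟨{v}, h, by simp, by simp⟩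

theorem wt_vtx [DecidableEq V] (K : AbsSC V) (v : V) (h : {v} ∈ K.faces) (w : V) :
    wt (K.vtx v h) w = if w = v then 1 else 0 := by
  simp [vtx, Pi.single_apply]

/-- Maps which send every point into a common simplex are homotopic, relative to the set on
which they agree. -/
theorem homotopicRel_of_contiguous {K : AbsSC V} {X : Type*} [TopologicalSpace X]
    (f g : C(X, K.space)) {S : Set X} (hS : ∀ x ∈ S, f x = g x)
    (h : ∀ x, ∃ s ∈ K.faces, (∀ v, wt (f x) v ≠ 0 → v ∈ s) ∧ ∀ v, wt (g x) v ≠ 0 → v ∈ s) :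
    f.HomotopicRel g S := by
  refine ⟨⟨⟨⟨fun p => K.ofWt (fun v => (1 - p.1.1) * wt (f p.2) v + p.1.1 * wt (g p.2) v) ?_ ?_, ?_⟩,
    ?_, ?_⟩, ?_⟩⟩
  · intro v
    have := p.1.2.1
    have := p.1.2.2
    have := wt_nonneg (f p.2) v
    have := wt_nonneg (g p.2) v
    have : 0 ≤ 1 - p.1.1 := by linarith
    positivity
  · obtain ⟨s, hs, hf, hg⟩ := h p.2
    refine ⟨s, hs, fun v hv => ?_, ?_⟩
    · by_contra hvs
      have h1 : wt (f p.2) v = 0 := by by_contra h; exact hvs (hf v h)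
      have h2 : wt (g p.2) v = 0 := by by_contra h; exact hvs (hg v h)
      exact hv (by simp [h1, h2])
    · rw [sum_add_distrib, ← mul_sum, ← mul_sum, sum_eq_one _ hf, sum_eq_one _ hg]
      ring
  · refine continuous_into fun v => ?_
    simp only [wt_ofWt]
    have h1 := (continuous_wt v).comp (f.continuous.comp (continuous_snd (X := unitInterval)))
    have h2 := (continuous_wt v).comp (g.continuous.comp (continuous_snd (X := unitInterval)))
    have h3 : Continuous fun p : unitInterval × X => p.1.1 := by fun_prop
    exact ((continuous_const.sub h3).mul h1).add (h3.mul h2)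
  · intro x
    exact space_ext fun v => by simp
  · intro x
    exact space_ext fun v => by simp
  · intro t x hx
    refine space_ext fun v => ?_
    change (1 - t.1) * wt (f x) v + t.1 * wt (g x) v = wt (f x) v
    rw [← hS x hx]
    ring

/-- The realization of `K` deformation retracts onto the vertex `v`, which stays fixed. -/
def ContractsTo (K : AbsSC V) (v : V) : Prop :=
  ∃ h : {v} ∈ K.faces,
    (ContinuousMap.id K.space).HomotopicRel (ContinuousMap.const _ (K.vtx v h)) {K.vtx v h}

/-- The subcomplex of the faces which contain no member of `S`. -/
def avoid (K : AbsSC V) (S : Set (Finset V)) : AbsSC V where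
  faces := {r | r ∈ K.faces ∧ ∀ s ∈ S, ¬ s ⊆ r}
  not_empty_mem h := K.not_empty_mem h.1
  down_closed r hr t ht hne :=
    ⟨K.down_closed r hr.1 t ht hne, fun s hs hst => hr.2 s hs (hst.trans ht)⟩

theorem avoid_subset (K : AbsSC V) (S : Set (Finset V)) : (K.avoid S).faces ⊆ K.faces :=
  fun _ h => h.1

theorem ContractsTo.of_retract {K L : AbsSC V} {v : V} (hLK : L.faces ⊆ K.faces)
    (r : C(K.space, L.space)) (hr : ∀ x, r (incl hLK x) = x)
    (hid : (ContinuousMap.id K.space).HomotopicRel ((incl hLK).comp r) (Set.range (incl hLK)))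
    (h : L.ContractsTo v) : K.ContractsTo v := by
  obtain ⟨hv, ⟨H⟩⟩ := h
  obtain ⟨G⟩ := hid
  have hvK : incl hLK (L.vtx v hv) = K.vtx v (hLK hv) := rfl
  refine ⟨hLK hv, ContinuousMap.HomotopicRel.trans (g := (incl hLK).comp r) ⟨⟨G.1, ?_⟩⟩ ?_⟩
  · rintro t x rfl
    exact G.2 t _ ⟨_, hvK⟩
  · refine ⟨⟨⟨⟨fun p => incl hLK (H (p.1, r p.2)), ?_⟩, ?_, ?_⟩, ?_⟩⟩
    · fun_prop
    · intro x
      simp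
    · intro x
      simp [hvK]
    · rintro t x rfl
      have h1 : H (t, L.vtx v hv) = L.vtx v hv := H.2 t _ rfl
      change incl hLK (H (t, r (incl hLK (L.vtx v hv)))) = incl hLK (r (incl hLK (L.vtx v hv)))
      rw [hr, h1]

theorem contractsTo_of_cone [DecidableEq V] {K : AbsSC V} {v : V} (hv : {v} ∈ K.faces)
    (h : ∀ s ∈ K.faces, insert v s ∈ K.faces) : K.ContractsTo v := by
  refine ⟨hv, homotopicRel_of_contiguous _ _ (by simp) fun x => ?_⟩
  obtain ⟨s, hs, hx, -⟩ := exists_face x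
  refine ⟨insert v s, h s hs, fun w hw => mem_insert_of_mem (hx w hw), fun w hw => ?_⟩
  have : w = v := by
    by_contra hne
    exact hw (by simp [wt_vtx, hne])
  simp [this]

theorem exists_support_face {K : AbsSC V} (x : K.space) :
    ∃ s ∈ K.faces, (∀ v, v ∈ s ↔ wt x v ≠ 0) := by
  classical
  obtain ⟨s, hs, hx, h1⟩ := exists_face x
  refine ⟨s.filter fun v => wt x v ≠ 0, K.down_closed s hs _ (filter_subset _ _) ?_, fun v => ?_⟩
  · intro h
    rw [← sum_filter_ne_zero, h, sum_empty] at h1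
    exact zero_ne_one h1
  · simpa using hx v

/-- If every face containing `s` can be extended by `v`, then removing all faces containing `s`
is a deformation retraction. -/
theorem contractsTo_of_avoid_singleton [DecidableEq V] {K : AbsSC V} {s : Finset V} {v w : V}
    (hne : s.Nonempty) (hv : v ∉ s) (h : ∀ r ∈ K.faces, s ⊆ r → insert v r ∈ K.faces)
    (hw : (K.avoid {s}).ContractsTo w) : K.ContractsTo w := by
  let m : K.space → ℝ := fun x => s.inf' hne fun u => wt x u
  have hm : Continuous m := Continuous.finset_inf'_apply hne fun u _ => continuous_wt u
  have hm0 : ∀ x, 0 ≤ m x := fun x => le_inf' _ _ fun u _ => wt_nonneg x u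
  have hmle : ∀ x, ∀ u ∈ s, m x ≤ wt x u := fun x u hu => inf'_le _ hu
  have hmatt : ∀ x, ∃ u ∈ s, m x = wt x u := fun x => by
    obtain ⟨u, hu, h⟩ := exists_mem_eq_inf' hne fun u => wt x u
    exact ⟨u, hu, h⟩
  let F : K.space → V → ℝ := fun x u =>
    wt x u - (if u ∈ s then m x else 0) + (if u = v then (s.card : ℝ) * m x else 0)
  have hF0 : ∀ x u, 0 ≤ F x u := fun x u => by
    have := wt_nonneg x u
    have := hm0 x
    have := hmle x u
    simp only [F]
    split_ifs with h1 h2 h2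
    · exact absurd (h2 ▸ h1) hv
    · linarith [this h1]
    · positivity
    · linarith
  have hsupp : ∀ x : K.space, ∃ r ∈ K.faces, (∀ u, wt x u ≠ 0 → u ∈ r) ∧ (∀ u, F x u ≠ 0 → u ∈ r) ∧
      ∑ u ∈ r, F x u = 1 := by
    intro x
    obtain ⟨r, hr, hx⟩ := exists_support_face x
    rcases (hm0 x).eq_or_lt with h0 | h0
    · have hFx : ∀ u, F x u = wt x u := fun u => by simp [F, ← h0]
      exact ⟨r, hr, fun u hu => (hx u).2 hu, fun u hu => (hx u).2 (hFx u ▸ hu), by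
        simp only [hFx]
        exact sum_eq_one x fun u hu => (hx u).2 hu⟩
    · have hsr : s ⊆ r := fun u hu => (hx u).2 (h0.trans_le (hmle x u hu)).ne'
      refine ⟨insert v r, h r hr hsr, fun u hu => mem_insert_of_mem ((hx u).2 hu), fun u hu => ?_, ?_⟩
      · by_contra hur
        rw [mem_insert, not_or] at hur
        have h1 : u ∉ s := fun hus => hur.2 (hsr hus)
        have h2 : wt x u = 0 := by by_contra h; exact hur.2 ((hx u).2 h)
        exact hu (by simp [F, h1, hur.1, h2])
      · simp only [F]
        rw [sum_add_distrib, sum_sub_distrib, sum_eq_one x fun u hu => mem_insert_of_mem ((hx u).2 hu),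
          sum_ite_mem, inter_eq_right.2 (hsr.trans (subset_insert _ _)), sum_ite_eq']
        simp
  have hF1 : ∀ x, ∃ r ∈ (K.avoid {s}).faces, (∀ u, F x u ≠ 0 → u ∈ r) ∧ ∑ u ∈ r, F x u = 1 := by
    intro x
    obtain ⟨r, hr, -, hx, h1⟩ := hsupp x
    refine ⟨r.filter fun u => F x u ≠ 0, ⟨K.down_closed r hr _ (filter_subset _ _) ?_, ?_⟩, ?_, ?_⟩
    · intro h
      rw [← sum_filter_ne_zero, h, sum_empty] at h1
      exact zero_ne_one h1
    · rintro _ rfl hsub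
      obtain ⟨u, hu, hum⟩ := hmatt x
      have huv : u ≠ v := fun h => hv (h ▸ hu)
      exact (mem_filter.1 (hsub hu)).2 (by simp [F, hu, huv, hum])
    · intro u hu
      exact mem_filter.2 ⟨hx u hu, hu⟩
    · rwa [sum_filter_ne_zero]
  let ρ : C(K.space, (K.avoid {s}).space) := ⟨fun x => ofWt _ (F x) (hF0 x) (hF1 x), by
    refine continuous_into fun u => ?_
    refine ((continuous_wt u).sub ?_).add ?_ <;> split_ifs <;> fun_prop⟩
  have hfix : ∀ x : (K.avoid {s}).space, ρ (incl (K.avoid_subset {s}) x) = x := by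
    intro x
    have h0 : m (incl (K.avoid_subset {s}) x) = 0 := by
      by_contra hne0
      obtain ⟨r, hr, hx⟩ := exists_support_face x
      refine hr.2 s rfl fun u hu => (hx u).2 ?_
      have := hmle (incl (K.avoid_subset {s}) x) u hu
      exact (((hm0 _).lt_of_ne' hne0).trans_le this).ne'
    refine space_ext fun u => ?_
    change F _ u = _
    simp [F, h0]
  refine ContractsTo.of_retract (K.avoid_subset _) ρ hfix (homotopicRel_of_contiguous _ _ ?_ ?_) hw
  · rintro _ ⟨x, rfl⟩
    simp [hfix]
  · intro x
    obtain ⟨r, hr, hx, hx', -⟩ := hsupp x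
    exact ⟨r, hr, hx, hx'⟩

/-- Simultaneous version of `contractsTo_of_avoid_singleton`. -/
theorem contractsTo_of_avoid [DecidableEq V] {K : AbsSC V} {S : Set (Finset V)} {w : V}
    (hfin : S.Finite) (apex : Finset V → V) (hne : ∀ s ∈ S, s.Nonempty) (hv : ∀ s ∈ S, apex s ∉ s)
    (h : ∀ s ∈ S, ∀ r ∈ K.faces, s ⊆ r →
      insert (apex s) r ∈ K.faces ∧ ∀ t ∈ S, t ⊆ insert (apex s) r → t ⊆ r)
    (hw : (K.avoid S).ContractsTo w) : K.ContractsTo w := by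
  induction S, hfin using Set.Finite.induction_on generalizing K with
  | empty =>
    have : K.avoid ∅ = K := faces_injective (by simp [avoid])
    rwa [this] at hw
  | @insert s S _ _ ih =>
    have hs : s ∈ insert s S := Set.mem_insert _ _
    refine contractsTo_of_avoid_singleton (hne s hs) (hv s hs)
      (fun r hr hsr => (h s hs r hr hsr).1) (ih (fun t ht => hne t (Or.inr ht))
      (fun t ht => hv t (Or.inr ht)) ?_ ?_)
    · intro t ht r hr htr
      obtain ⟨h1, h2⟩ := h t (Or.inr ht) r hr.1 htr
      refine ⟨⟨h1, ?_⟩, fun t' ht' => h2 t' (Or.inr ht')⟩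
      rintro _ rfl hsub
      exact hr.2 _ rfl (h2 _ hs hsub)
    · have : (K.avoid {s}).avoid S = K.avoid (insert s S) :=
        faces_injective (by ext r; simp [avoid, and_assoc])
      rwa [this]

end Realization

end AbsSC

/-- Homotopy equivalence of pointed spaces. -/
def PointedHEquiv {X Y : Type} [TopologicalSpace X] [TopologicalSpace Y] (x : X) (y : Y) : Prop :=
  ∃ (f : C(X, Y)) (g : C(Y, X)), f x = y ∧ g y = x ∧
    (ContinuousMap.id X).HomotopicRel (g.comp f) {x} ∧
    (ContinuousMap.id Y).HomotopicRel (f.comp g) {y}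

namespace PointedHEquiv

variable {X Y : Type} [TopologicalSpace X] [TopologicalSpace Y] {x : X} {y : Y}

theorem symm (h : PointedHEquiv x y) : PointedHEquiv y x := by
  obtain ⟨f, g, hf, hg, h1, h2⟩ := h
  exact ⟨g, f, hg, hf, h2, h1⟩

theorem nonempty_homotopyEquiv (h : PointedHEquiv x y) :
    Nonempty (ContinuousMap.HomotopyEquiv X Y) := by
  obtain ⟨f, g, -, -, h1, h2⟩ := h
  exact ⟨⟨f, g, h1.homotopic.symm, h2.homotopic.symm⟩⟩

/-- Collapsing a subspace which can be contracted to a point by a homotopy of the whole space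
does not change the pointed homotopy type. -/
theorem of_collapse {p : C(X, Y)} (hp : Topology.IsQuotientMap p) {L : Set X}
    (hfib : ∀ a b, p a = p b ↔ a = b ∨ (a ∈ L ∧ b ∈ L)) (Φ : C(unitInterval × X, X))
    (h0 : ∀ a, Φ (0, a) = a) (hL : ∀ s, ∀ a ∈ L, Φ (s, a) ∈ L) (h1 : ∀ a ∈ L, Φ (1, a) = x)
    (hx : ∀ s, Φ (s, x) = x) : PointedHEquiv x (p x) := by
  let Φ₁ : C(X, X) := Φ.comp ((ContinuousMap.const X 1).prodMk (ContinuousMap.id X))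
  have hΦ₁ : Function.FactorsThrough Φ₁ p := by
    intro a b hab
    rcases (hfib a b).1 hab with rfl | ⟨ha, hb⟩
    · rfl
    · exact (h1 a ha).trans (h1 b hb).symm
  let q : C(Y, X) := hp.lift Φ₁ hΦ₁
  have hq : ∀ a, q (p a) = Φ (1, a) := fun a =>
    DFunLike.congr_fun (hp.lift_comp Φ₁ hΦ₁) a
  let ψ : C(X, C(unitInterval, Y)) :=
    ((p.comp Φ).comp ContinuousMap.prodSwap).curry
  have hψ : Function.FactorsThrough ψ p := by
    intro a b hab
    rcases (hfib a b).1 hab with rfl | ⟨ha, hb⟩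
    · rfl
    · ext s
      exact (hfib _ _).2 (Or.inr ⟨hL s a ha, hL s b hb⟩)
  let Ψ : C(Y, C(unitInterval, Y)) := hp.lift ψ hψ
  have hΨ : ∀ a s, Ψ (p a) s = p (Φ (s, a)) := fun a s =>
    DFunLike.congr_fun (DFunLike.congr_fun (hp.lift_comp ψ hψ) a) s
  refine ⟨p, q, rfl, by rw [hq, hx], ⟨⟨⟨Φ, h0, fun a => (hq a).symm⟩, ?_⟩⟩,
    ⟨⟨⟨Ψ.uncurry.comp ContinuousMap.prodSwap, ?_, ?_⟩, ?_⟩⟩⟩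
  · rintro s _ rfl
    exact hx s
  · intro b
    obtain ⟨a, rfl⟩ := hp.surjective b
    exact (hΨ a 0).trans (by rw [h0]; rfl)
  · intro b
    obtain ⟨a, rfl⟩ := hp.surjective b
    exact (hΨ a 1).trans (congrArg p (hq a).symm)
  · rintro s _ rfl
    exact (hΨ x s).trans (by rw [hx]; rfl)

end PointedHEquiv

namespace AbsSC

section Cells

variable {V : Type}

/-- The least barycentric coordinate on the cell `e`. -/
noncomputable def minWt {K : AbsSC V} (e : Fin 4 ↪ V) (x : K.space) : ℝ :=
  univ.inf' univ_nonempty fun k => wt x (e k)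

@[fun_prop]
theorem continuous_minWt {K : AbsSC V} (e : Fin 4 ↪ V) :
    Continuous (minWt e : K.space → ℝ) :=
  Continuous.finset_inf'_apply _ fun _ _ => continuous_wt _

theorem minWt_nonneg {K : AbsSC V} (e : Fin 4 ↪ V) (x : K.space) : 0 ≤ minWt e x :=
  le_inf' _ _ fun _ _ => wt_nonneg x _

theorem minWt_le {K : AbsSC V} (e : Fin 4 ↪ V) (x : K.space) (k : Fin 4) :
    minWt e x ≤ wt x (e k) := inf'_le _ (mem_univ k)

theorem exists_minWt_eq {K : AbsSC V} (e : Fin 4 ↪ V) (x : K.space) :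
    ∃ k, minWt e x = wt x (e k) := by
  obtain ⟨k, -, h⟩ := exists_mem_eq_inf' univ_nonempty fun k => wt x (e k)
  exact ⟨k, h⟩

theorem minWt_pos_iff {K : AbsSC V} {e : Fin 4 ↪ V} {x : K.space} :
    0 < minWt e x ↔ ∀ k, wt x (e k) ≠ 0 := by
  refine ⟨fun h k => (h.trans_le (minWt_le e x k)).ne', fun h => ?_⟩
  obtain ⟨k, hk⟩ := exists_minWt_eq e x
  exact hk ▸ (wt_nonneg x _).lt_of_ne' (h k)

theorem wt_eq_zero_of_minWt_pos {K : AbsSC V} {e : Fin 4 ↪ V}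
    (he : K.IsFacet (univ.map e)) {x : K.space} (h : 0 < minWt e x) {v : V}
    (hv : v ∉ univ.map e) : wt x v = 0 := by
  obtain ⟨s, hs, hx⟩ := exists_support_face x
  have : s = univ.map e := he.2 s hs fun u hu => by
    obtain ⟨k, -, rfl⟩ := mem_map.1 hu
    exact (hx _).2 (minWt_pos_iff.1 h k)
  by_contra hne
  exact hv (this ▸ (hx v).2 hne)

theorem mem_range_incl_avoid {K : AbsSC V} {ι : Type*} {c : ι → Fin 4 ↪ V} {x : K.space} :
    x ∈ Set.range (incl (K.avoid_subset (Set.range fun i => univ.map (c i)))) ↔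
      ∀ i, minWt (c i) x = 0 := by
  constructor
  · rintro ⟨y, rfl⟩ i
    obtain ⟨s, hs, hy⟩ := exists_support_face y
    by_contra hne
    have h := minWt_pos_iff.1 ((minWt_nonneg (c i) _).lt_of_ne' hne)
    refine hs.2 _ ⟨i, rfl⟩ fun u hu => ?_
    obtain ⟨k, -, rfl⟩ := mem_map.1 hu
    exact (hy _).2 (h k)
  · intro h
    obtain ⟨s, hs, hx⟩ := exists_support_face x
    refine ⟨ofWt _ (wt x) (wt_nonneg x) ⟨s, ⟨hs, ?_⟩, fun v hv => (hx v).2 hv,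
      sum_eq_one x fun v hv => (hx v).2 hv⟩, rfl⟩
    rintro _ ⟨i, rfl⟩ hsub
    exact (minWt_pos_iff.2 fun k => (hx _).1 (hsub (mem_map_of_mem _ (mem_univ k)))).ne' (h i)

end Cells

end AbsSC

namespace AbsSC

section Cells

variable {V : Type}

/-- Distinct facets have disjoint interiors. -/
theorem minWt_eq_zero_or {K : AbsSC V} {ι : Type*} {c : ι → Fin 4 ↪ V}
    (hc : ∀ i, K.IsFacet (univ.map (c i))) (hinj : Function.Injective fun i => univ.map (c i))
    (x : K.space) :
    (∀ i, minWt (c i) x = 0) ∨ ∃ i, 0 < minWt (c i) x ∧ ∀ j ≠ i, minWt (c j) x = 0 := by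
  by_cases h : ∀ i, minWt (c i) x = 0
  · exact Or.inl h
  push Not at h
  obtain ⟨i, hi⟩ := h
  have hi := (minWt_nonneg (c i) x).lt_of_ne' hi
  refine Or.inr ⟨i, hi, fun j hj => ?_⟩
  by_contra hne
  have h := minWt_pos_iff.1 ((minWt_nonneg (c j) x).lt_of_ne' hne)
  refine hj (hinj ((hc j).2 _ (hc i).1 fun u hu => ?_).symm)
  obtain ⟨k, -, rfl⟩ := mem_map.1 hu
  by_contra hu'
  exact h k (wt_eq_zero_of_minWt_pos (hc i) hi hu')

/-- Homotopy extension: a contraction of the complement of a set of open facets extends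
to the whole complex. -/
theorem exists_homotopy_of_contractsTo {K : AbsSC V} {ι : Type*} [Fintype ι] {c : ι → Fin 4 ↪ V}
    (hc : ∀ i, K.IsFacet (univ.map (c i))) (hinj : Function.Injective fun i => univ.map (c i))
    {v : V} (h : (K.avoid (Set.range fun i => univ.map (c i))).ContractsTo v) :
    ∃ (hv : {v} ∈ K.faces) (Φ : C(unitInterval × K.space, K.space)), (∀ a, Φ (0, a) = a) ∧
      (∀ s a, (∀ i, minWt (c i) a = 0) → ∀ i, minWt (c i) (Φ (s, a)) = 0) ∧
      (∀ a, (∀ i, minWt (c i) a = 0) → Φ (1, a) = K.vtx v hv) ∧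
      (∀ s, Φ (s, K.vtx v hv) = K.vtx v hv) ∧ ∀ i, minWt (c i) (K.vtx v hv) = 0 := by
  classical
  obtain ⟨hv, ⟨H⟩⟩ := h
  let S : Set (Finset V) := Set.range fun i => univ.map (c i)
  let d : ι → unitInterval × K.space → ℝ := fun i p => min (minWt (c i) p.2) (p.1.1 / 8)
  have hdc : ∀ i, Continuous (d i) := fun i => by fun_prop
  have hd0 : ∀ i p, 0 ≤ d i p := fun i p =>
    le_min (minWt_nonneg _ _) (div_nonneg p.1.2.1 (by norm_num))
  have hd8 : ∀ i p, d i p ≤ p.1.1 / 8 := fun i p => min_le_right _ _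
  have hdz : ∀ i p, minWt (c i) p.2 = 0 → d i p = 0 := fun i p h =>
    le_antisymm (h ▸ min_le_left _ _) (hd0 i p)
  let D : unitInterval × K.space → ℝ := fun p => ∑ i, d i p
  have hDc : Continuous D := by fun_prop
  let F : unitInterval × K.space → V → ℝ := fun p u =>
    (wt p.2 u - ∑ i, if u ∈ univ.map (c i) then d i p else 0) / (1 - 4 * D p)
  have hcase : ∀ p, ((∀ i, minWt (c i) p.2 = 0) ∧ D p = 0 ∧ ∀ u, F p u = wt p.2 u) ∨
      ∃ i, 0 < minWt (c i) p.2 ∧ D p = d i p ∧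
        ∀ u, F p u = (wt p.2 u - if u ∈ univ.map (c i) then d i p else 0) / (1 - 4 * d i p) := by
    intro p
    rcases minWt_eq_zero_or hc hinj p.2 with h | ⟨i, hi, hj⟩
    · have hD : D p = 0 := sum_eq_zero fun i _ => hdz i p (h i)
      refine Or.inl ⟨h, hD, fun u => ?_⟩
      simp only [F, hD, hdz _ p (h _)]
      simp
    · have hD : D p = d i p := sum_eq_single i (fun j _ hji => hdz j p (hj j hji)) (by simp)
      refine Or.inr ⟨i, hi, hD, fun u => ?_⟩
      simp only [F, hD]
      rw [sum_eq_single i (fun j _ hji => by simp [hdz j p (hj j hji)]) (by simp)]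
  have hDle : ∀ p, D p ≤ p.1.1 / 8 := by
    intro p
    rcases hcase p with ⟨-, h, -⟩ | ⟨i, -, h, -⟩
    · rw [h]
      exact div_nonneg p.1.2.1 (by norm_num)
    · exact h ▸ hd8 i p
  have hDpos : ∀ p, 0 < 1 - 4 * D p := fun p => by linarith [hDle p, p.1.2.2]
  have hF0 : ∀ p u, 0 ≤ F p u := by
    intro p u
    rcases hcase p with ⟨-, -, h⟩ | ⟨i, -, hD, h⟩
    · exact h u ▸ wt_nonneg _ _
    · rw [h u, ← hD]
      refine div_nonneg ?_ (hDpos p).le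
      split_ifs with hu
      · obtain ⟨k, -, rfl⟩ := mem_map.1 hu
        have : d i p ≤ _ := min_le_left _ _
        linarith [minWt_le (c i) p.2 k]
      · simpa using wt_nonneg p.2 u
  have hF1 : ∀ p, ∃ s ∈ K.faces, (∀ u, F p u ≠ 0 → u ∈ s) ∧ ∑ u ∈ s, F p u = 1 := by
    intro p
    rcases hcase p with ⟨-, -, h⟩ | ⟨i, hi, hD, h⟩
    · simp only [h]
      exact exists_face p.2
    · have hs : ∀ u, wt p.2 u ≠ 0 → u ∈ univ.map (c i) := fun u hu => by
        by_contra hn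
        exact hu (wt_eq_zero_of_minWt_pos (hc i) hi hn)
      refine ⟨_, (hc i).1, fun u hu => ?_, ?_⟩
      · by_contra hn
        refine hu ?_
        rw [h u, if_neg hn, wt_eq_zero_of_minWt_pos (hc i) hi hn]
        simp
      · have h4 : (univ.map (c i)).card = 4 := by simp
        simp only [h]
        rw [← sum_div, sum_sub_distrib, sum_eq_one _ hs, sum_ite_mem, inter_self, sum_const, h4,
          nsmul_eq_mul, div_eq_one_iff_eq]
        · norm_num
        · rw [← hD]
          exact (hDpos p).ne'
  let R : C(unitInterval × K.space, K.space) := ⟨fun p => K.ofWt (F p) (hF0 p) (hF1 p), by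
    refine continuous_into fun u => ?_
    refine Continuous.div ?_ (by fun_prop) fun p => (hDpos p).ne'
    refine ((continuous_wt u).comp continuous_snd).sub (continuous_finsetSum _ fun i _ => ?_)
    split_ifs
    · exact hdc i
    · fun_prop⟩
  have hR : ∀ p u, wt (R p) u = F p u := fun p u => rfl
  have hRfix : ∀ p, (∀ i, minWt (c i) p.2 = 0) → R p = p.2 := by
    intro p hp
    rcases hcase p with ⟨-, -, h⟩ | ⟨i, hi, -⟩
    · exact space_ext h
    · exact absurd (hp i) hi.ne'
  let τ : C(unitInterval × K.space, unitInterval) :=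
    ⟨fun p => Set.projIcc 0 1 zero_le_one (p.1.1 - 8 * D p), by fun_prop⟩
  have hRL : ∀ p, (∀ i, minWt (c i) (R p) = 0) ∨ τ p = 0 := by
    intro p
    rcases hcase p with ⟨h, -, -⟩ | ⟨i, hi, hD, h⟩
    · exact Or.inl (by rwa [hRfix p h])
    · rcases le_total (minWt (c i) p.2) (p.1.1 / 8) with hle | hle
      · have hd : d i p = minWt (c i) p.2 := min_eq_left hle
        obtain ⟨k, hk⟩ := exists_minWt_eq (c i) p.2
        refine Or.inl fun j => ?_
        by_contra hne
        have hj := minWt_pos_iff.1 ((minWt_nonneg (c j) _).lt_of_ne' hne)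
        have hij : j = i := hinj ((hc j).2 _ (hc i).1 fun u hu => by
          obtain ⟨l, -, rfl⟩ := mem_map.1 hu
          by_contra hn
          refine hj l ?_
          rw [hR, h, if_neg hn, wt_eq_zero_of_minWt_pos (hc i) hi hn]
          simp).symm
        subst hij
        refine hj k ?_
        rw [hR, h, if_pos (mem_map_of_mem _ (mem_univ k)), hd, hk]
        simp
      · have hd : d i p = p.1.1 / 8 := min_eq_right hle
        refine Or.inr (Subtype.ext ?_)
        simp only [τ, ContinuousMap.coe_mk, hD, hd]
        simp [Set.coe_projIcc]
        ring_nf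
        simp
  let toL : {p // ∀ i, minWt (c i) (R p) = 0} → (K.avoid S).space := fun p =>
    (mem_range_incl_avoid.2 p.2).choose
  have htoL : ∀ p, incl (K.avoid_subset S) (toL p) = R p.1 := fun p =>
    (mem_range_incl_avoid.2 p.2).choose_spec
  have htoLc : Continuous toL := continuous_into fun u => by
    have : ∀ p, wt (toL p) u = wt (R p.1) u := fun p => by
      rw [← htoL]
      rfl
    simp only [this]
    fun_prop
  let Φ : unitInterval × K.space → K.space := fun p =>
    if hp : ∀ i, minWt (c i) (R p) = 0 then incl (K.avoid_subset S) (H (τ p, toL ⟨p, hp⟩)) else R p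
  have hΦτ : ∀ p, τ p = 0 → Φ p = R p := fun p hp => by
    simp only [Φ]
    split_ifs with h
    · rw [hp, ContinuousMap.HomotopyWith.apply_zero]
      exact htoL ⟨p, h⟩
    · rfl
  have hΦc : Continuous Φ := by
    let A : Bool → Set (unitInterval × K.space) := fun b =>
      bif b then {p | ∀ i, minWt (c i) (R p) = 0} else {p | τ p = 0}
    refine (locallyFinite_of_finite A).continuous ?_ ?_ ?_
    · refine Set.eq_univ_of_forall fun p => Set.mem_iUnion.2 ?_
      rcases hRL p with h | h
      exacts [⟨true, h⟩, ⟨false, h⟩]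
    · rintro (_ | _)
      · exact isClosed_eq τ.continuous continuous_const
      · change IsClosed {p | ∀ i, minWt (c i) (R p) = 0}
        rw [Set.ofPred_forall]
        exact isClosed_iInter fun i =>
          isClosed_eq ((continuous_minWt _).comp R.continuous) continuous_const
    · rintro (_ | _)
      · exact R.continuous.continuousOn.congr fun p hp => hΦτ p hp
      · rw [continuousOn_iff_continuous_domRestrict]
        have : (A true).domRestrict Φ =
            fun p => incl (K.avoid_subset S) (H (τ p.1, toL ⟨p.1, p.2⟩)) := by
          funext p
          exact dif_pos p.2
        rw [this]
        have : Continuous fun p : A true => toL ⟨p.1, p.2⟩ := htoLc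
        have : Continuous fun p : A true => τ p.1 := by fun_prop
        fun_prop
  have hΦL : ∀ s a (ha : ∀ i, minWt (c i) a = 0) (y : (K.avoid S).space),
      incl (K.avoid_subset S) y = a → Φ (s, a) = incl (K.avoid_subset S) (H (s, y)) := by
    intro s a ha y hy
    have hRa : R (s, a) = a := hRfix (s, a) ha
    have hτ : τ (s, a) = s := by
      rcases hcase (s, a) with ⟨-, h, -⟩ | ⟨i, hi, -⟩
      · refine Subtype.ext ?_
        simp [τ, h]
      · exact absurd (ha i) hi.ne'
    have hy' : toL ⟨(s, a), by rwa [hRa]⟩ = y := by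
      refine space_ext fun u => ?_
      rw [← wt_incl (K.avoid_subset S), ← wt_incl (K.avoid_subset S) y, htoL, hy, hRa]
    simp only [Φ]
    rw [dif_pos (by rwa [hRa]), hτ, hy']
  have hvL : ∀ i, minWt (c i) (K.vtx v (K.avoid_subset S hv)) = 0 :=
    mem_range_incl_avoid.1 ⟨(K.avoid S).vtx v hv, rfl⟩
  refine ⟨K.avoid_subset S hv, ⟨Φ, hΦc⟩, fun a => ?_, fun s a ha => ?_, fun a ha => ?_,
    fun s => ?_, hvL⟩
  · have hD : D (0, a) = 0 := le_antisymm (by simpa using hDle (0, a)) (sum_nonneg fun i _ => hd0 i _)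
    refine (hΦτ _ ?_).trans ?_
    · refine Subtype.ext ?_
      simp [τ, hD]
    · refine space_ext fun u => ?_
      have hd : ∀ i, d i (0, a) = 0 := fun i =>
        le_antisymm (by simpa using hd8 i (0, a)) (hd0 i _)
      rw [hR]
      simp [F, hD, hd]
  · obtain ⟨y, hy⟩ := (mem_range_incl_avoid (c := c)).2 ha
    refine mem_range_incl_avoid.1 ⟨H (s, y), ?_⟩
    exact (hΦL s a ha y hy).symm
  · obtain ⟨y, hy⟩ := (mem_range_incl_avoid (c := c)).2 ha
    refine (hΦL 1 a ha y hy).trans ?_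
    rw [ContinuousMap.HomotopyWith.apply_one]
    rfl
  · refine (hΦL s _ hvL ((K.avoid S).vtx v hv) rfl).trans ?_
    have : H (s, (K.avoid S).vtx v hv) = (K.avoid S).vtx v hv := H.2 s _ rfl
    rw [this]
    rfl

end Cells

end AbsSC

section Wedge

variable {c : ℕ} {X : Type} [TopologicalSpace X] {x₀ : X}

/-- The inclusion of a summand into the wedge. -/
def wedgeIn (x₀ : X) (i : Fin c) : C(X, Wedge c X x₀) :=
  ⟨fun z => Quot.mk _ (Sum.inr (i, z)), continuous_quot_mk.comp (by fun_prop)⟩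

theorem wedgeIn_base (i : Fin c) : wedgeIn x₀ i x₀ = wedgePt c X x₀ :=
  (Quot.sound (wedgeRel.glue i)).symm

theorem wedge_cases (y : Wedge c X x₀) : y = wedgePt c X x₀ ∨ ∃ i z, y = wedgeIn x₀ i z := by
  rcases y with ⟨⟨⟩ | ⟨i, z⟩⟩
  exacts [Or.inl rfl, Or.inr ⟨i, z, rfl⟩]

/-- The map out of the wedge given by pointed maps on the summands. -/
def wedgeElim {Y : Type} [TopologicalSpace Y] (y₀ : Y) (f : Fin c → C(X, Y))
    (h : ∀ i, f i x₀ = y₀) : C(Wedge c X x₀, Y) :=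
  ⟨Quot.lift (Sum.elim (fun _ => y₀) fun p => f p.1 p.2) (by rintro _ _ ⟨i⟩; exact (h i).symm), by
    refine continuous_quot_lift _ (continuous_sumElim.2 ⟨continuous_const, ?_⟩)
    exact continuous_prod_of_discrete_left.2 fun i => (f i).continuous⟩

theorem wedgeElim_in {Y : Type} [TopologicalSpace Y] {y₀ : Y} {f : Fin c → C(X, Y)}
    {h : ∀ i, f i x₀ = y₀} (i : Fin c) (z : X) : wedgeElim y₀ f h (wedgeIn x₀ i z) = f i z := rfl

theorem wedgeIn_eq_iff {i j : Fin c} {z w : X} :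
    wedgeIn x₀ i z = wedgeIn x₀ j w ↔ (i = j ∧ z = w) ∨ (z = x₀ ∧ w = x₀) := by
  constructor
  · intro h
    let f (i : Fin c) : C(Wedge c X x₀, X) := wedgeElim x₀
      (fun j => if j = i then ContinuousMap.id X else ContinuousMap.const X x₀)
      (fun j => by split_ifs <;> rfl)
    have h1 := congrArg (f i) h
    have h2 := congrArg (f j) h
    simp only [f, wedgeElim_in] at h1 h2
    by_cases hij : i = j
    · subst hij
      exact Or.inl ⟨rfl, by simpa using h1⟩
    · rw [if_pos trivial, if_neg (Ne.symm hij)] at h1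
      rw [if_pos trivial, if_neg hij] at h2
      exact Or.inr ⟨h1, h2.symm⟩
  · rintro (⟨rfl, rfl⟩ | ⟨rfl, rfl⟩)
    · rfl
    · rw [wedgeIn_base, wedgeIn_base]

theorem isOpen_wedge_iff {U : Set (Wedge c X x₀)} :
    IsOpen U ↔ ∀ i, IsOpen (wedgeIn x₀ i ⁻¹' U) := by
  refine ⟨fun h i => h.preimage (wedgeIn x₀ i).continuous, fun h => ?_⟩
  refine isQuotientMap_quot_mk.isOpen_preimage.1 (isOpen_sum_iff.2 ⟨isOpen_discrete _, ?_⟩)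
  exact continuous_Prop.1 (continuous_prod_of_discrete_left.2 fun i => continuous_Prop.2 (h i))

end Wedge

namespace AbsSC

section Sphere

variable {V : Type} {K : AbsSC V}

/-- The deviation from constancy of the weights on a cell. -/
noncomputable def devWt (e : Fin 4 ↪ V) (k : Fin 4) (x : K.space) : ℝ := wt x (e k) - wt x (e 0)

/-- The weight outside a cell. -/
noncomputable def coWt (e : Fin 4 ↪ V) (x : K.space) : ℝ := 1 - ∑ k, wt x (e k)

theorem coWt_eq_zero {e : Fin 4 ↪ V} (he : K.IsFacet (univ.map e)) {x : K.space}
    (h : 0 < minWt e x) : coWt e x = 0 := by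
  have := sum_eq_one x (s := univ.map e) fun u hu => by
    by_contra hn
    exact hu (wt_eq_zero_of_minWt_pos he h hn)
  rw [sum_map] at this
  simp [coWt, this]

/-- The squared deviation on a cell. -/
noncomputable def devSq (e : Fin 4 ↪ V) (x : K.space) : ℝ :=
  devWt e 1 x ^ 2 + devWt e 2 x ^ 2 + devWt e 3 x ^ 2 + coWt e x ^ 2

@[fun_prop]
theorem continuous_devWt (e : Fin 4 ↪ V) (k : Fin 4) :
    Continuous (devWt e k : K.space → ℝ) := by
  unfold devWt
  fun_prop

@[fun_prop]
theorem continuous_devSq (e : Fin 4 ↪ V) : Continuous (devSq e : K.space → ℝ) := by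
  unfold devSq coWt
  fun_prop

theorem devSq_nonneg (e : Fin 4 ↪ V) (x : K.space) : 0 ≤ devSq e x := by
  unfold devSq
  positivity

theorem devSq_add_pos (e : Fin 4 ↪ V) (x : K.space) : 0 < devSq e x + minWt e x ^ 2 := by
  refine (add_nonneg (devSq_nonneg e x) (sq_nonneg _)).lt_of_ne' fun h => ?_
  have ht : minWt e x = 0 := by nlinarith [devSq_nonneg e x, sq_nonneg (minWt e x)]
  have hs : devSq e x = 0 := by nlinarith [devSq_nonneg e x, sq_nonneg (minWt e x)]
  unfold devSq at hs
  have h1 : devWt e 1 x = 0 := by nlinarith [sq_nonneg (devWt e 1 x), sq_nonneg (devWt e 2 x), sq_nonneg (devWt e 3 x), sq_nonneg (coWt e x)]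
  have h2 : devWt e 2 x = 0 := by nlinarith [sq_nonneg (devWt e 1 x), sq_nonneg (devWt e 2 x), sq_nonneg (devWt e 3 x), sq_nonneg (coWt e x)]
  have h3 : devWt e 3 x = 0 := by nlinarith [sq_nonneg (devWt e 1 x), sq_nonneg (devWt e 2 x), sq_nonneg (devWt e 3 x), sq_nonneg (coWt e x)]
  have h4 : coWt e x = 0 := by nlinarith [sq_nonneg (devWt e 1 x), sq_nonneg (devWt e 2 x), sq_nonneg (devWt e 3 x), sq_nonneg (coWt e x)]
  obtain ⟨k, hk⟩ := exists_minWt_eq e x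
  rw [coWt, Fin.sum_univ_four] at h4
  unfold devWt at h1 h2 h3
  have : ∀ k, wt x (e k) = wt x (e 0) := by
    intro k
    fin_cases k <;> simp <;> linarith
  have h0 := this k
  linarith

/-- The collapse of the complement of an open facet, by inverse stereographic projection of the
deviation rescaled by the least weight. -/
noncomputable def sphMap (e : Fin 4 ↪ V) (he : K.IsFacet (univ.map e)) : C(K.space, Sph 3) where
  toFun x := ⟨!₂[(devSq e x - minWt e x ^ 2) / (devSq e x + minWt e x ^ 2),
    2 * minWt e x * devWt e 1 x / (devSq e x + minWt e x ^ 2),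
    2 * minWt e x * devWt e 2 x / (devSq e x + minWt e x ^ 2),
    2 * minWt e x * devWt e 3 x / (devSq e x + minWt e x ^ 2)], by
    have hD := (devSq_add_pos e x).ne'
    have h0 : minWt e x * coWt e x = 0 := by
      rcases (minWt_nonneg e x).eq_or_lt with h | h
      · simp [← h]
      · simp [coWt_eq_zero he h]
    rw [mem_sphere_zero_iff_norm, EuclideanSpace.norm_eq, Real.sqrt_eq_one]
    simp only [Fin.sum_univ_four, Real.norm_eq_abs, sq_abs]
    simp
    field_simp
    have : devSq e x = devWt e 1 x ^ 2 + devWt e 2 x ^ 2 + devWt e 3 x ^ 2 + coWt e x ^ 2 := rfl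
    have h2 : (minWt e x)^2 * (coWt e x)^2 = 0 := by rw [← mul_pow, h0]; simp
    generalize devSq e x = s at *
    linear_combination (-4 * minWt e x ^ 2) * this - 4 * h2⟩
  continuous_toFun := by
    have h := fun x => (devSq_add_pos e x (K := K)).ne'
    refine Continuous.subtype_mk ((PiLp.continuous_toLp 2 _).comp (continuous_pi fun k => ?_)) _
    fin_cases k <;> simp <;> fun_prop (disch := exact h)

theorem sphMap_zero (e : Fin 4 ↪ V) (he : K.IsFacet (univ.map e)) (x : K.space) :
    (sphMap e he x).1 0 = (devSq e x - minWt e x ^ 2) / (devSq e x + minWt e x ^ 2) := rfl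

theorem sphMap_of_ne_zero (e : Fin 4 ↪ V) (he : K.IsFacet (univ.map e)) (x : K.space) {k : Fin 4}
    (hk : k ≠ 0) :
    (sphMap e he x).1 k = 2 * minWt e x * devWt e k x / (devSq e x + minWt e x ^ 2) := by
  fin_cases k
  exacts [absurd rfl hk, rfl, rfl, rfl]

theorem sphMap_eq_base_iff {e : Fin 4 ↪ V} {he : K.IsFacet (univ.map e)} {x : K.space} :
    sphMap e he x = sphBase 3 ↔ minWt e x = 0 := by
  have hD := (devSq_add_pos e x).ne'
  constructor
  · intro h
    have h0 := sphMap_zero e he x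
    rw [h, sphBase, eq_div_iff hD] at h0
    simp at h0
    nlinarith [sq_nonneg (minWt e x)]
  · intro h
    have hs : devSq e x ≠ 0 := by simpa [h] using hD
    refine Subtype.ext ?_
    ext k
    by_cases hk : k = 0
    · subst hk
      rw [sphMap_zero, h]
      simp [sphBase, hs]
    · rw [sphMap_of_ne_zero _ _ _ hk, h]
      simp [sphBase, hk]

theorem wt_eq_of_sphMap_eq {e : Fin 4 ↪ V} {he : K.IsFacet (univ.map e)} {x y : K.space}
    (h : sphMap e he x = sphMap e he y) (hx : 0 < minWt e x) : x = y := by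
  have hy : 0 < minWt e y := by
    refine (minWt_nonneg e y).lt_of_ne' fun h0 => hx.ne' ?_
    rw [← sphMap_eq_base_iff (he := he)] at h0 ⊢
    rw [h, h0]
  have hcomp : ∀ k, (sphMap e he x).1 k = (sphMap e he y).1 k := fun k => by rw [h]
  have hDx := devSq_add_pos e x
  have hDy := devSq_add_pos e y
  have hratio : minWt e x ^ 2 * (devSq e y + minWt e y ^ 2) =
      minWt e y ^ 2 * (devSq e x + minWt e x ^ 2) := by
    have := hcomp 0
    rw [sphMap_zero, sphMap_zero, div_eq_div_iff hDx.ne' hDy.ne'] at this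
    linear_combination -this / 2
  have hdev : ∀ k, devWt e k x * minWt e y = devWt e k y * minWt e x := by
    intro k
    by_cases hk : k = 0
    · subst hk
      simp [devWt]
    · have := hcomp k
      rw [sphMap_of_ne_zero _ _ _ hk, sphMap_of_ne_zero _ _ _ hk,
        div_eq_div_iff hDx.ne' hDy.ne'] at this
      have h2 : (devWt e k x * minWt e y) * (minWt e y * (devSq e x + minWt e x ^ 2)) =
          (devWt e k y * minWt e x) * (minWt e y * (devSq e x + minWt e x ^ 2)) := by
        have h3 : minWt e x * ((devWt e k x * minWt e y) * (minWt e y * (devSq e x + minWt e x ^ 2))) =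
          minWt e x * ((devWt e k y * minWt e x) * (minWt e y * (devSq e x + minWt e x ^ 2))) := by
          linear_combination (-(minWt e x * devWt e k x)) * hratio + (minWt e x ^ 2 / 2) * this
        exact mul_left_cancel₀ hx.ne' h3
      exact mul_right_cancel₀ (mul_pos hy hDx).ne' h2
  have hconst : ∀ k, wt x (e k) * minWt e y - wt y (e k) * minWt e x =
      wt x (e 0) * minWt e y - wt y (e 0) * minWt e x := fun k => by
    have := hdev k
    unfold devWt at this
    linarith
  obtain ⟨k, hk⟩ := exists_minWt_eq e x
  obtain ⟨l, hl⟩ := exists_minWt_eq e y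
  have hzero : wt x (e 0) * minWt e y - wt y (e 0) * minWt e x = 0 := by
    refine le_antisymm ?_ ?_
    · rw [← hconst k, ← hk]
      nlinarith [minWt_le e y k]
    · rw [← hconst l, ← hl]
      nlinarith [minWt_le e x l]
  have hprop : ∀ k, wt x (e k) * minWt e y = wt y (e k) * minWt e x := fun k => by
    linarith [hconst k]
  have hsum : ∀ z : K.space, 0 < minWt e z → ∑ k, wt z (e k) = 1 := fun z hz => by
    have := coWt_eq_zero he hz
    unfold coWt at this
    linarith
  have hxy : minWt e y = minWt e x := by
    have := sum_congr (s₁ := univ) rfl fun k _ => hprop k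
    rw [← sum_mul, ← sum_mul, hsum x hx, hsum y hy] at this
    linarith
  refine space_ext fun v => ?_
  by_cases hv : v ∈ univ.map e
  · obtain ⟨k, -, rfl⟩ := mem_map.1 hv
    have := hprop k
    rw [hxy] at this
    exact mul_right_cancel₀ hx.ne' this
  · rw [wt_eq_zero_of_minWt_pos he hx hv, wt_eq_zero_of_minWt_pos he hy hv]

/-- The parametrization of a face with four vertices by the standard simplex. -/
noncomputable def simplexMap (e : Fin 4 ↪ V) (he : univ.map e ∈ K.faces) :
    C(stdSimplex ℝ (Fin 4), K.space) where
  toFun a := K.ofWt (Function.extend e a.1 0)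
    (fun v => by
      by_cases hv : ∃ k, e k = v
      · obtain ⟨k, rfl⟩ := hv
        rw [e.injective.extend_apply]
        exact a.2.1 k
      · rw [Function.extend_apply' _ _ _ hv, Pi.zero_apply])
    ⟨_, he, fun v hv => by
      by_contra hn
      refine hv (Function.extend_apply' _ _ _ ?_)
      simpa using hn, by
      rw [sum_map]
      simp only [e.injective.extend_apply]
      exact a.2.2⟩
  continuous_toFun := continuous_into fun v => by
    simp only [wt_ofWt]
    by_cases hv : ∃ k, e k = v
    · obtain ⟨k, rfl⟩ := hv
      simp only [e.injective.extend_apply]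
      exact (continuous_apply k).comp continuous_subtype_val
    · simp only [Function.extend_apply' _ _ _ hv]
      exact continuous_const

theorem wt_simplexMap (e : Fin 4 ↪ V) (he : univ.map e ∈ K.faces) (a : stdSimplex ℝ (Fin 4))
    (k : Fin 4) : wt (simplexMap e he a) (e k) = a.1 k := e.injective.extend_apply _ _ _

theorem sphMap_simplexMap_surjective (e : Fin 4 ↪ V) (he : K.IsFacet (univ.map e)) :
    Function.Surjective (sphMap e he ∘ simplexMap e he.1) := by
  intro z
  by_cases hz : z = sphBase 3
  · subst hz
    refine ⟨⟨Pi.single 0 1, single_mem_stdSimplex ℝ 0⟩, sphMap_eq_base_iff.2 ?_⟩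
    refine le_antisymm ((minWt_le e _ 1).trans ?_) (minWt_nonneg e _)
    rw [wt_simplexMap]
    simp
  have hnorm : z.1 0 ^ 2 + z.1 1 ^ 2 + z.1 2 ^ 2 + z.1 3 ^ 2 = 1 := by
    have := z.2
    rw [mem_sphere_zero_iff_norm, EuclideanSpace.norm_eq, Real.sqrt_eq_one] at this
    simpa [Fin.sum_univ_four] using this
  have hz1 : 0 < 1 - z.1 0 := by
    have h1 : z.1 0 ≤ 1 := by nlinarith [sq_nonneg (z.1 1), sq_nonneg (z.1 2), sq_nonneg (z.1 3)]
    refine (sub_nonneg.2 h1).lt_of_ne' fun h => hz ?_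
    have h0 : z.1 0 = 1 := by linarith
    rw [h0] at hnorm
    have e1 : z.1 1 = 0 := by nlinarith [sq_nonneg (z.1 1), sq_nonneg (z.1 2), sq_nonneg (z.1 3)]
    have e2 : z.1 2 = 0 := by nlinarith [sq_nonneg (z.1 1), sq_nonneg (z.1 2), sq_nonneg (z.1 3)]
    have e3 : z.1 3 = 0 := by nlinarith [sq_nonneg (z.1 1), sq_nonneg (z.1 2), sq_nonneg (z.1 3)]
    refine Subtype.ext ?_
    ext k
    fin_cases k <;> simp [sphBase, h0, e1, e2, e3]
  let η : Fin 4 → ℝ := fun k => if k = 0 then 0 else z.1 k / (1 - z.1 0)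
  let μ : ℝ := univ.inf' univ_nonempty η
  have hμ : ∀ k, μ ≤ η k := fun k => inf'_le _ (mem_univ k)
  obtain ⟨l, -, hl⟩ := exists_mem_eq_inf' univ_nonempty η
  let T : ℝ := ∑ k, (1 - μ + η k)
  have hT : 0 < T := sum_pos (fun k _ => by linarith [hμ k]) univ_nonempty
  have hη : ∑ k, η k ^ 2 = (1 + z.1 0) / (1 - z.1 0) := by
    simp [η, Fin.sum_univ_four]
    field_simp
    linarith
  refine ⟨⟨fun k => (1 - μ + η k) / T, fun k => div_nonneg (by linarith [hμ k]) hT.le, ?_⟩, ?_⟩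
  · rw [← sum_div]
    exact div_self hT.ne'
  rw [Function.comp_apply]
  generalize hx : simplexMap e he.1 _ = x
  have hw : ∀ k, wt x (e k) = (1 - μ + η k) / T := fun k => by rw [← hx, wt_simplexMap]
  have hmin : minWt e x = 1 / T := by
    refine le_antisymm ((minWt_le e x l).trans_eq ?_) (le_inf' _ _ fun k _ => ?_)
    · rw [hw, ← hl]
      congr 1
      ring
    · rw [hw]
      exact div_le_div_of_nonneg_right (by linarith [hμ k]) hT.le
  have hdev : ∀ k, devWt e k x = η k / T := by
    intro k
    rw [devWt, hw, hw]
    simp [η]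
    ring
  have hco : coWt e x = 0 := coWt_eq_zero he (by rw [hmin]; positivity)
  have hsq : devSq e x = (1 + z.1 0) / (1 - z.1 0) / T ^ 2 := by
    rw [← hη, devSq, hdev, hdev, hdev, hco, Fin.sum_univ_four]
    simp [η]
    ring
  have hden : devSq e x + minWt e x ^ 2 = 2 / (1 - z.1 0) / T ^ 2 := by
    rw [hsq, hmin]
    field_simp
    ring
  refine Subtype.ext ?_
  ext k
  by_cases hk : k = 0
  · subst hk
    rw [sphMap_zero, hden, hsq, hmin]
    field_simp
    ring
  · rw [sphMap_of_ne_zero _ _ _ hk, hden, hmin, hdev]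
    simp only [η, if_neg hk]
    field_simp

theorem isQuotientMap_sphMap_simplexMap (e : Fin 4 ↪ V) (he : K.IsFacet (univ.map e)) :
    Topology.IsQuotientMap (sphMap e he ∘ simplexMap e he.1) := by
  have hc : Continuous (sphMap e he ∘ simplexMap e he.1) := by fun_prop
  exact hc.isClosedMap.isQuotientMap hc (sphMap_simplexMap_surjective e he)

/-- Collapsing the complement of `N` open facets with four vertices gives a wedge of
`N` copies of the three-sphere. -/
theorem exists_wedge_collapse {N : ℕ} {c : Fin N → Fin 4 ↪ V}
    (hc : ∀ i, K.IsFacet (univ.map (c i))) (hinj : Function.Injective fun i => univ.map (c i))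
    {a : K.space} (ha : ∀ i, minWt (c i) a = 0) :
    ∃ p : C(K.space, WedgeSph 3 N), Topology.IsQuotientMap p ∧ p a = wedgeSphPt 3 N ∧
      ∀ x y, p x = p y ↔ x = y ∨ (∀ i, minWt (c i) x = 0) ∧ ∀ i, minWt (c i) y = 0 := by
  classical
  let p : K.space → WedgeSph 3 N := fun x =>
    if h : ∃ i, 0 < minWt (c i) x then wedgeIn _ h.choose (sphMap _ (hc h.choose) x)
    else wedgePt _ _ _
  have hp0 : ∀ x, (∀ i, minWt (c i) x = 0) → p x = wedgePt _ _ _ := fun x hx =>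
    dif_neg (by simp [hx])
  have hpi : ∀ x i, (∀ j ≠ i, minWt (c j) x = 0) → p x = wedgeIn _ i (sphMap _ (hc i) x) := by
    intro x i hx
    by_cases h : 0 < minWt (c i) x
    · have hex : ∃ i, 0 < minWt (c i) x := ⟨i, h⟩
      have : hex.choose = i := by
        by_contra hne
        exact hex.choose_spec.ne' (hx _ hne)
      change dite _ _ _ = _
      rw [dif_pos hex, this]
    · have h0 : minWt (c i) x = 0 := le_antisymm (not_lt.1 h) (minWt_nonneg _ _)
      rw [hp0 x fun j => ?_, sphMap_eq_base_iff.2 h0, wedgeIn_base]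
      by_cases hj : j = i
      exacts [hj ▸ h0, hx j hj]
  have hcont : Continuous p := by
    let A : Option (Fin N) → Set K.space := fun o =>
      o.elim {x | ∀ j, minWt (c j) x = 0} fun i => {x | ∀ j ≠ i, minWt (c j) x = 0}
    refine (locallyFinite_of_finite A).continuous ?_ ?_ ?_
    · refine Set.eq_univ_of_forall fun x => Set.mem_iUnion.2 ?_
      rcases minWt_eq_zero_or hc hinj x with h | ⟨i, -, h⟩
      exacts [⟨none, h⟩, ⟨some i, h⟩]
    · rintro (_ | i)
      · change IsClosed {x : K.space | ∀ j, minWt (c j) x = 0}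
        simp only [Set.ofPred_forall]
        exact isClosed_iInter fun j => isClosed_eq (continuous_minWt _) continuous_const
      · change IsClosed {x : K.space | ∀ j ≠ i, minWt (c j) x = 0}
        simp only [Set.ofPred_forall]
        exact isClosed_iInter fun j => isClosed_iInter fun _ =>
          isClosed_eq (continuous_minWt _) continuous_const
    · rintro (_ | i)
      · exact continuousOn_const.congr fun x hx => hp0 x hx
      · refine Continuous.continuousOn ?_ |>.congr fun x hx => hpi x i hx
        fun_prop
  have hsimp : ∀ i b j, j ≠ i → minWt (c j) (simplexMap (c i) (hc i).1 b) = 0 := by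
    intro i b j hj
    by_contra hne
    have h := minWt_pos_iff.1 ((minWt_nonneg (c j) _).lt_of_ne' hne)
    refine hj (hinj ((hc j).2 _ (hc i).1 fun u hu => ?_).symm)
    obtain ⟨k, -, rfl⟩ := mem_map.1 hu
    by_contra hn
    exact h k (Function.extend_apply' _ _ _ (by simpa using hn))
  have hps : ∀ i b, p (simplexMap (c i) (hc i).1 b) =
      wedgeIn _ i (sphMap _ (hc i) (simplexMap (c i) (hc i).1 b)) := fun i b =>
    hpi _ i fun j hj => hsimp i b j hj
  refine ⟨⟨p, hcont⟩, (Topology.isQuotientMap_iff _).2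
    ⟨Topology.isCoinducing_iff.2 fun U => ?_, fun y => ?_⟩, hp0 a ha,
    fun x y => ?_⟩
  · refine ⟨fun h => isOpen_wedge_iff.2 fun i => ?_, fun h => h.preimage hcont⟩
    rw [← (isQuotientMap_sphMap_simplexMap (c i) (hc i)).isOpen_preimage]
    convert h.preimage (simplexMap (c i) (hc i).1).continuous using 1
    ext b
    change wedgeIn _ i (sphMap _ (hc i) (simplexMap (c i) (hc i).1 b)) ∈ U ↔ p _ ∈ U
    rw [hps]
  · rcases wedge_cases y with rfl | ⟨i, z, rfl⟩
    · exact ⟨a, hp0 a ha⟩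
    · obtain ⟨b, rfl⟩ := sphMap_simplexMap_surjective (c i) (hc i) z
      exact ⟨_, hps i b⟩
  · change p x = p y ↔ _
    constructor
    · intro h
      rcases minWt_eq_zero_or hc hinj x with hx | ⟨i, hxi, hx⟩ <;>
        rcases minWt_eq_zero_or hc hinj y with hy | ⟨j, hyj, hy⟩
      · exact Or.inr ⟨hx, hy⟩
      · rw [hp0 x hx, hpi y j hy, ← wedgeIn_base j, wedgeIn_eq_iff] at h
        rcases h with ⟨-, h⟩ | ⟨-, h⟩
        · exact absurd (sphMap_eq_base_iff.1 h.symm) hyj.ne'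
        · exact absurd (sphMap_eq_base_iff.1 h) hyj.ne'
      · rw [hp0 y hy, hpi x i hx, ← wedgeIn_base i, wedgeIn_eq_iff] at h
        rcases h with ⟨-, h⟩ | ⟨h, -⟩
        · exact absurd (sphMap_eq_base_iff.1 h) hxi.ne'
        · exact absurd (sphMap_eq_base_iff.1 h) hxi.ne'
      · rw [hpi x i hx, hpi y j hy, wedgeIn_eq_iff] at h
        rcases h with ⟨rfl, h⟩ | ⟨h, -⟩
        · exact Or.inl (wt_eq_of_sphMap_eq h hxi)
        · exact absurd (sphMap_eq_base_iff.1 h) hxi.ne'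
    · rintro (rfl | ⟨hx, hy⟩)
      · rfl
      · rw [hp0 x hx, hp0 y hy]

/-- If the complement of a set of `N` open facets with four vertices is contractible, then the
complex is a wedge of `N` copies of the three-sphere. -/
theorem pointedHEquiv_wedgeSph {N : ℕ} {C : Set (Finset V)} (hC : C.ncard = N) (hfin : C.Finite)
    (h4 : ∀ s ∈ C, s.card = 4) (hfac : ∀ s ∈ C, K.IsFacet s) {v : V}
    (h : (K.avoid C).ContractsTo v) :
    ∃ a : K.space, PointedHEquiv a (wedgeSphPt 3 N) := by
  classical
  have := hfin.to_subtype
  have hcard : Nat.card C = N := hC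
  let e : Fin N ≃ C := (Finite.equivFinOfCardEq hcard).symm
  have hex : ∀ i, ∃ f : Fin 4 ↪ V, univ.map f = (e i).1 := fun i => by
    let g := (Finset.equivFinOfCardEq (h4 _ (e i).2)).symm
    refine ⟨g.toEmbedding.trans (Function.Embedding.subtype _), ?_⟩
    ext u
    simp only [mem_map, mem_univ, true_and, Function.Embedding.trans_apply]
    constructor
    · rintro ⟨k, rfl⟩
      exact (g k).2
    · intro hu
      exact ⟨g.symm ⟨u, hu⟩, by simp⟩
  choose c hce using hex
  have hrange : (Set.range fun i => univ.map (c i)) = C := by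
    simp only [hce]
    ext s
    exact ⟨by rintro ⟨i, rfl⟩; exact (e i).2, fun hs => ⟨e.symm ⟨s, hs⟩, by simp⟩⟩
  have hc : ∀ i, K.IsFacet (univ.map (c i)) := fun i => hce i ▸ hfac _ (e i).2
  have hinj : Function.Injective fun i => univ.map (c i) := by
    simp only [hce]
    exact Subtype.val_injective.comp e.injective
  rw [← hrange] at h
  obtain ⟨hv, Φ, h0, hL, h1, hx, hvL⟩ := exists_homotopy_of_contractsTo hc hinj h
  obtain ⟨p, hp, hpa, hfib⟩ := exists_wedge_collapse hc hinj hvL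
  refine ⟨K.vtx v hv, hpa ▸ ?_⟩
  exact PointedHEquiv.of_collapse hp (L := {x | ∀ i, minWt (c i) x = 0}) hfib Φ h0 hL h1 hx

end Sphere

end AbsSC

section Wedge2

variable {X Y Z : Type} [TopologicalSpace X] [TopologicalSpace Y] [TopologicalSpace Z] {x : X}
  {y : Y}

/-- The left inclusion into the binary wedge. -/
def wedge2Inl (x : X) (y : Y) : C(X, Wedge2 X Y x y) :=
  ⟨fun a => Quot.mk _ (Sum.inl a), continuous_quot_mk.comp continuous_inl⟩

/-- The right inclusion into the binary wedge. -/
def wedge2Inr (x : X) (y : Y) : C(Y, Wedge2 X Y x y) :=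
  ⟨fun a => Quot.mk _ (Sum.inr a), continuous_quot_mk.comp continuous_inr⟩

theorem wedge2_glue (x : X) (y : Y) : wedge2Inl x y x = wedge2Inr x y y :=
  Quot.sound wedge2Rel.glue

theorem wedge2_cases (z : Wedge2 X Y x y) : (∃ a, z = wedge2Inl x y a) ∨ ∃ b, z = wedge2Inr x y b := by
  rcases z with ⟨a | b⟩
  exacts [Or.inl ⟨a, rfl⟩, Or.inr ⟨b, rfl⟩]

/-- The map out of a binary wedge given by maps which agree at the base points. -/
def wedge2Elim (f : C(X, Z)) (g : C(Y, Z)) (h : f x = g y) : C(Wedge2 X Y x y, Z) :=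
  ⟨Quot.lift (Sum.elim f g) (by rintro _ _ ⟨⟩; exact h),
    continuous_quot_lift _ (continuous_sumElim.2 ⟨f.continuous, g.continuous⟩)⟩

theorem homotopic_wedge2_of_homotopicRel {k : C(X, X)}
    (hk : (ContinuousMap.id X).HomotopicRel k {x}) {m : C(Wedge2 X Y x y, Wedge2 X Y x y)}
    (hl : ∀ a, m (wedge2Inl x y a) = wedge2Inl x y (k a))
    (hr : ∀ b, m (wedge2Inr x y b) = wedge2Inr x y b) :
    m.Homotopic (ContinuousMap.id _) := by
  obtain ⟨H⟩ := hk
  let Hl : C(X, C(unitInterval, Wedge2 X Y x y)) :=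
    ((wedge2Inl x y).comp (H.toHomotopy.toContinuousMap.comp ContinuousMap.prodSwap)).curry
  let Hr : C(Y, C(unitInterval, Wedge2 X Y x y)) :=
    ((wedge2Inr x y).comp ContinuousMap.fst).curry
  have h : Hl x = Hr y := by
    ext t
    change wedge2Inl x y (H (t, x)) = wedge2Inr x y y
    have : H (t, x) = x := H.2 t x rfl
    rw [this, wedge2_glue]
  refine ContinuousMap.Homotopic.symm
    ⟨⟨(wedge2Elim Hl Hr h).uncurry.comp ContinuousMap.prodSwap, fun z => ?_, fun z => ?_⟩⟩
  · rcases wedge2_cases z with ⟨a, rfl⟩ | ⟨b, rfl⟩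
    · exact congrArg (wedge2Inl x y) (H.apply_zero a)
    · rfl
  · rcases wedge2_cases z with ⟨a, rfl⟩ | ⟨b, rfl⟩
    · exact (congrArg (wedge2Inl x y) (H.apply_one a)).trans (hl a).symm
    · exact (hr b).symm

/-- The binary wedge respects pointed homotopy equivalence. -/
theorem PointedHEquiv.wedge2_left {W : Type} [TopologicalSpace W] (h : PointedHEquiv x y) (w : W) :
    Nonempty (ContinuousMap.HomotopyEquiv (Wedge2 X W x w) (Wedge2 Y W y w)) := by
  obtain ⟨f, g, hf, hg, h1, h2⟩ := h
  refine ⟨⟨wedge2Elim ((wedge2Inl y w).comp f) (wedge2Inr y w) ?_,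
    wedge2Elim ((wedge2Inl x w).comp g) (wedge2Inr x w) ?_,
    homotopic_wedge2_of_homotopicRel h1 ?_ ?_, homotopic_wedge2_of_homotopicRel h2 ?_ ?_⟩⟩
  · rw [ContinuousMap.comp_apply, hf, wedge2_glue]
  · rw [ContinuousMap.comp_apply, hg, wedge2_glue]
  all_goals exact fun _ => rfl

/-- A wedge indexed by `a + b` is the binary wedge of wedges indexed by `a` and by `b`. -/
theorem nonempty_wedge_add_homeomorph (a b : ℕ) :
    Nonempty (Wedge (a + b) X x ≃ₜ
      Wedge2 (Wedge a X x) (Wedge b X x) (wedgePt a X x) (wedgePt b X x)) := by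
  let f : Fin (a + b) → C(X, Wedge2 (Wedge a X x) (Wedge b X x) (wedgePt a X x) (wedgePt b X x)) :=
    Fin.addCases (fun i => (wedge2Inl _ _).comp (wedgeIn x i))
      (fun i => (wedge2Inr _ _).comp (wedgeIn x i))
  have hf : ∀ i, f i x = wedge2Inl (wedgePt a X x) (wedgePt b X x) (wedgePt a X x) := by
    refine Fin.addCases (fun i => ?_) fun i => ?_
    · simp only [f, Fin.addCases_left, ContinuousMap.comp_apply, wedgeIn_base]
    · simp only [f, Fin.addCases_right, ContinuousMap.comp_apply, wedgeIn_base]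
      exact (wedge2_glue _ _).symm
  let F := wedgeElim _ f hf
  let G : C(Wedge2 (Wedge a X x) (Wedge b X x) (wedgePt a X x) (wedgePt b X x),
      Wedge (a + b) X x) :=
    wedge2Elim (wedgeElim _ (fun i => wedgeIn x (Fin.castAdd b i)) fun i => wedgeIn_base _)
      (wedgeElim _ (fun i => wedgeIn x (Fin.natAdd a i)) fun i => wedgeIn_base _) rfl
  have hl : ∀ i z, F (wedgeIn x (Fin.castAdd b i) z) = wedge2Inl _ _ (wedgeIn x i z) :=
    fun i z => by
      change f _ z = _
      simp only [f, Fin.addCases_left, ContinuousMap.comp_apply]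
  have hr : ∀ i z, F (wedgeIn x (Fin.natAdd a i) z) = wedge2Inr _ _ (wedgeIn x i z) :=
    fun i z => by
      change f _ z = _
      simp only [f, Fin.addCases_right, ContinuousMap.comp_apply]
  refine ⟨⟨⟨F, G, fun z => ?_, fun z => ?_⟩, F.continuous, G.continuous⟩⟩
  · rcases wedge_cases z with rfl | ⟨i, z, rfl⟩
    · rfl
    · refine Fin.addCases (fun i => ?_) (fun i => ?_) i
      · rw [hl]
        rfl
      · rw [hr]
        rfl
  · rcases wedge2_cases z with ⟨z, rfl⟩ | ⟨z, rfl⟩ <;> rcases wedge_cases z with rfl | ⟨i, z, rfl⟩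
    · rfl
    · exact hl i z
    · exact wedge2_glue _ _
    · exact hr i z

end Wedge2

section SetFacts

theorem exists_eq_erase_of_subset {A S : Finset ℕ} {n : ℕ} (h : A ⊆ S) (hA : A.card = n)
    (hS : S.card = n + 1) : ∃ a ∈ S, A = S.erase a := by
  have h1 : (S \ A).card = 1 := by rw [card_sdiff_of_subset h]; omega
  obtain ⟨a, ha⟩ := card_eq_one.1 h1
  have haS : a ∈ S \ A := ha ▸ mem_singleton_self a
  refine ⟨a, (mem_sdiff.1 haS).1, ?_⟩
  rw [← sdiff_singleton_eq_erase, ← ha, Finset.sdiff_sdiff_eq_self h]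

theorem exists_eq_insert_of_subset {B S : Finset ℕ} {n : ℕ} (h : S ⊆ B) (hB : B.card = n + 2)
    (hS : S.card = n + 1) : ∃ b, b ∉ S ∧ B = insert b S := by
  obtain ⟨b, hb, rfl⟩ := exists_eq_erase_of_subset h hS hB
  exact ⟨b, notMem_erase b B, (insert_erase hb).symm⟩

theorem card_symmDiff (X Y : Finset ℕ) :
    (symmDiff X Y).card = (X \ Y).card + (Y \ X).card := by
  rw [symmDiff_def, sup_eq_union, card_union_of_disjoint disjoint_sdiff_sdiff]

/-- Two `n`-sets at distance at most two have a union of size at most `n + 1`. -/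
theorem card_union_le_of_symmDiff {X Y : Finset ℕ} {n : ℕ} (hX : X.card = n) (hY : Y.card = n)
    (h : (symmDiff X Y).card ≤ 2) : (X ∪ Y).card ≤ n + 1 := by
  rw [card_symmDiff] at h
  have h1 := card_sdiff_add_card_inter X Y
  have h2 := card_sdiff_add_card_inter Y X
  have h3 := card_union_add_card_inter X Y
  rw [inter_comm] at h2
  omega

theorem card_inter_ge_of_symmDiff {X Y : Finset ℕ} {n : ℕ} (hX : X.card = n + 2)
    (hY : Y.card = n + 2) (h : (symmDiff X Y).card ≤ 2) : n + 1 ≤ (X ∩ Y).card := by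
  rw [card_symmDiff] at h
  have h1 := card_sdiff_add_card_inter X Y
  have h2 := card_sdiff_add_card_inter Y X
  rw [inter_comm] at h2
  omega

theorem subset_of_symmDiff {X Y : Finset ℕ} {n : ℕ} (hX : X.card = n)
    (hY : Y.card = n + 2) (h : (symmDiff X Y).card ≤ 2) : X ⊆ Y := by
  rw [card_symmDiff] at h
  have h1 := card_sdiff_add_card_inter X Y
  have h2 := card_sdiff_add_card_inter Y X
  rw [inter_comm] at h2
  rw [← sdiff_eq_empty_iff_subset, ← card_eq_zero]
  omega

/-- Comparability under inclusion. -/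
def Compat (S X : Finset ℕ) : Prop := X ⊆ S ∨ S ⊆ X

theorem Compat.subset {S X : Finset ℕ} {n : ℕ} (h : Compat S X) (hS : S.card = n + 1)
    (hX : X.card = n) : X ⊆ S := by
  rcases h with h | h
  · exact h
  · have := card_le_card h
    omega

theorem Compat.superset {S X : Finset ℕ} {n : ℕ} (h : Compat S X) (hS : S.card = n + 1)
    (hX : X.card = n + 2) : S ⊆ X := by
  rcases h with h | h
  · have := card_le_card h
    omega
  · exact h

theorem compat_erase (S : Finset ℕ) (a : ℕ) : Compat S (S.erase a) := Or.inl (erase_subset _ _)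

theorem compat_insert (S : Finset ℕ) (b : ℕ) : Compat S (insert b S) := Or.inr (subset_insert _ _)

theorem symmDiff_le_of_compat {S X Y : Finset ℕ} {n : ℕ} (hS : S.card = n + 1)
    (hX : X.card = n ∨ X.card = n + 2) (hY : Y.card = n ∨ Y.card = n + 2)
    (hSX : Compat S X) (hSY : Compat S Y) : (symmDiff X Y).card ≤ 2 := by
  have key : ∀ Z, (Z.card = n ∨ Z.card = n + 2) → Compat S Z → (symmDiff Z S).card ≤ 1 := by
    intro Z hZ hSZ
    rw [card_symmDiff]
    rcases hZ with hZ | hZ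
    · have h := hSZ.subset hS hZ
      rw [sdiff_eq_empty_iff_subset.2 h, card_empty, card_sdiff_of_subset h]
      omega
    · have h := hSZ.superset hS hZ
      rw [sdiff_eq_empty_iff_subset.2 h, card_empty, card_sdiff_of_subset h]
      omega
  have h1 := key X hX hSX
  have h2 := key Y hY hSY
  rw [symmDiff_comm] at h2
  calc (symmDiff X Y).card ≤ (symmDiff X S ∪ symmDiff S Y).card :=
        card_le_card (by
          intro u
          simp only [mem_union, mem_symmDiff]
          tauto)
    _ ≤ _ := (card_union_le _ _).trans (by omega)

/-- A set adjacent to two facets of `S` lies in `S` or contains their intersection. -/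
theorem subset_or_eq_insert {S A : Finset ℕ} {n y z : ℕ} (hS : S.card = n + 1) (hA : A.card = n)
    (hy : y ∈ S) (hz : z ∈ S) (hyz : y ≠ z) (h1 : (symmDiff A (S.erase y)).card ≤ 2)
    (h2 : (symmDiff A (S.erase z)).card ≤ 2) :
    A ⊆ S ∨ ∃ q, q ∉ S ∧ A = insert q ((S.erase y).erase z) := by
  by_cases h : A ⊆ S
  · exact Or.inl h
  obtain ⟨q, hqA, hqS⟩ := not_subset.1 h
  have key : ∀ x ∈ S, (symmDiff A (S.erase x)).card ≤ 2 → A ⊆ insert q (S.erase x) := by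
    intro x hx hd
    have hc : (S.erase x).card = n := by rw [card_erase_of_mem hx, hS]; rfl
    have hle := card_union_le_of_symmDiff hA hc hd
    have hsub : insert q (S.erase x) ⊆ A ∪ S.erase x :=
      insert_subset (mem_union_left _ hqA) subset_union_right
    have hci : (insert q (S.erase x)).card = n + 1 := by
      rw [card_insert_of_notMem (fun h => hqS (mem_of_mem_erase h)), hc]
    rw [eq_of_subset_of_card_le hsub (by omega)]
    exact subset_union_left
  refine Or.inr ⟨q, hqS, eq_of_subset_of_card_le (fun u hu => ?_) ?_⟩
  · have hu1 := key y hy h1 hu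
    have hu2 := key z hz h2 hu
    simp only [mem_insert, mem_erase] at hu1 hu2 ⊢
    tauto
  · have h2 : 1 < S.card := one_lt_card.2 ⟨y, hy, z, hz, hyz⟩
    rw [card_insert_of_notMem (by simp [hqS]), card_erase_of_mem (by simp [hz, hyz.symm]),
      card_erase_of_mem hy, hA, hS]
    omega

/-- The weight by which the sets of size `n + 1` are ordered. -/
def binWt (S : Finset ℕ) : ℕ := ∑ i ∈ S, 2 ^ i

theorem binWt_injective : Function.Injective binWt := Finset.geomSum_injective le_rfl

theorem binWt_insert {S : Finset ℕ} {b : ℕ} (h : b ∉ S) : binWt (insert b S) = 2 ^ b + binWt S :=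
  sum_insert h

theorem binWt_erase {S : Finset ℕ} {a : ℕ} (h : a ∈ S) : 2 ^ a + binWt (S.erase a) = binWt S :=
  add_sum_erase S _ h

theorem binWt_swap_lt {S : Finset ℕ} {a b : ℕ} (ha : a ∈ S) (hb : b ∉ S) (hba : b < a) :
    binWt (insert b (S.erase a)) < binWt S := by
  rw [binWt_insert (fun h => hb (mem_of_mem_erase h)), ← binWt_erase ha]
  have := Nat.pow_lt_pow_right (a := 2) (by norm_num) hba
  omega

theorem le_of_binWt_swap_le {S : Finset ℕ} {a b : ℕ} (ha : a ∈ S) (hb : b ∉ S)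
    (h : binWt (insert b (S.erase a)) ≤ binWt S) : b < a := by
  rw [binWt_insert (fun h => hb (mem_of_mem_erase h)), ← binWt_erase ha] at h
  have h' : 2 ^ b ≤ 2 ^ a := by omega
  refine lt_of_le_of_ne ((Nat.pow_le_pow_iff_right (by norm_num)).1 h') ?_
  rintro rfl
  exact hb ha

/-- A set all of whose missing elements exceed all its elements has the least weight. -/
theorem binWt_le_of_initial {S T : Finset ℕ} {m : ℕ} (hT : T ⊆ Icc 1 m) (hc : S.card = T.card)
    (h : ∀ b ∈ Icc 1 m, b ∉ S → ∀ a ∈ S, a < b) : binWt S ≤ binWt T := by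
  refine (Finset.geomSum_le_geomSum_iff_toColex_le_toColex le_rfl).2
    (Colex.toColex_le_toColex.2 fun a ha haT => ?_)
  have : ¬ T ⊆ S := fun hTS => haT (eq_of_subset_of_card_le hTS hc.le ▸ ha)
  obtain ⟨b, hbT, hbS⟩ := not_subset.1 this
  exact ⟨b, hbT, hbS, (h b (hT hbT) hbS a ha).le⟩

end SetFacts

theorem AbsSC.contractsTo_of_avoid' {V : Type} [DecidableEq V] {K : AbsSC V} {S : Set (Finset V)}
    {w : V} (hfin : S.Finite) (hne : ∀ s ∈ S, s.Nonempty)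
    (h : ∀ s ∈ S, ∃ v ∉ s, ∀ r ∈ K.faces, s ⊆ r →
      insert v r ∈ K.faces ∧ ∀ t ∈ S, t ⊆ insert v r → t ⊆ r)
    (hw : (K.avoid S).ContractsTo w) : K.ContractsTo w := by
  classical
  have : ∀ s, ∃ v, s ∈ S → v ∉ s ∧ ∀ r ∈ K.faces, s ⊆ r →
      insert v r ∈ K.faces ∧ ∀ t ∈ S, t ⊆ insert v r → t ⊆ r := fun s => by
    by_cases hs : s ∈ S
    · obtain ⟨v, h1, h2⟩ := h s hs
      exact ⟨v, fun _ => ⟨h1, h2⟩⟩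
    · exact ⟨w, fun hs' => absurd hs' hs⟩
  choose apex ha using this
  exact contractsTo_of_avoid hfin apex hne (fun s hs => (ha s hs).1) (fun s hs => (ha s hs).2) hw

section Cells

/-- The facet spanned by `B` and the sets `C ∪ {x}` for `x ∈ B \ C`. -/
def Qcell (C B : Finset ℕ) : Finset (Finset ℕ) := insert B ((B \ C).image fun x => insert x C)

/-- The facet spanned by `A` and the sets `T \ {x}` for `x ∈ T \ A`. -/
def Rcell (A T : Finset ℕ) : Finset (Finset ℕ) := insert A ((T \ A).image T.erase)

/-- The pairs `C ⊆ B` indexing the critical facets with one vertex of size `n + 2`. -/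
structure IsCritQ (m n : ℕ) (C B : Finset ℕ) : Prop where
  subset : C ⊆ B
  subset_Icc : B ⊆ Icc 1 m
  card : B.card = n + 2
  card' : C.card + 1 = n
  max : ∃ c ∈ C, ∀ x ∈ B, x ≤ c
  gap : ∃ y ∈ Icc 1 m, y ∉ B ∧ ∀ x ∈ B, x ∉ C → y < x

/-- The pairs `A ⊆ T` indexing the critical facets with one vertex of size `n`. -/
structure IsCritR (m n : ℕ) (A T : Finset ℕ) : Prop where
  subset : A ⊆ T
  subset_Icc : T ⊆ Icc 1 m
  card : A.card = n
  card' : T.card = n + 3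
  max : ∃ c ∈ A, ∀ x ∈ T, x ≤ c

theorem mem_Qcell {C B X : Finset ℕ} :
    X ∈ Qcell C B ↔ X = B ∨ ∃ x ∈ B, x ∉ C ∧ insert x C = X := by
  simp [Qcell, and_assoc]

theorem mem_Rcell {A T X : Finset ℕ} :
    X ∈ Rcell A T ↔ X = A ∨ ∃ x ∈ T, x ∉ A ∧ T.erase x = X := by
  simp [Rcell, and_assoc]

theorem insert_erase_erase {S : Finset ℕ} {y z : ℕ} (hz : z ∈ S) (hyz : y ≠ z) :
    insert z ((S.erase y).erase z) = S.erase y := insert_erase (by simp [hz, hyz.symm])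

theorem card_erase_erase {S : Finset ℕ} {n y z : ℕ} (hS : S.card = n + 1) (hy : y ∈ S) (hz : z ∈ S)
    (hyz : y ≠ z) : ((S.erase y).erase z).card + 1 = n := by
  have h1 := card_erase_of_mem hy
  have h2 := card_erase_of_mem (s := S.erase y) (a := z) (by simp [hz, hyz.symm])
  have h3 : 1 < S.card := one_lt_card.2 ⟨y, hy, z, hz, hyz⟩
  omega

/-- The cell on `S \ {y, z} ⊆ S ∪ {b}`. -/
theorem mem_Qcell_erase {S X : Finset ℕ} {y z b : ℕ} (hy : y ∈ S) (hz : z ∈ S)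
    (hyz : y ≠ z) (hb : b ∉ S) : X ∈ Qcell ((S.erase y).erase z) (insert b S) ↔
      X = insert b S ∨ X = S.erase y ∨ X = S.erase z ∨ X = insert b ((S.erase y).erase z) := by
  have e1 : insert z ((S.erase y).erase z) = S.erase y := insert_erase_erase hz hyz
  have e2 : insert y ((S.erase y).erase z) = S.erase z := by
    rw [erase_right_comm]; exact insert_erase_erase hy hyz.symm
  rw [mem_Qcell]
  constructor
  · rintro (rfl | ⟨x, hx, hx', rfl⟩)
    · exact Or.inl rfl
    · rcases mem_insert.1 hx with rfl | hxS
      · tauto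
      · by_cases hxz : x = z
        · subst hxz; rw [e1]; tauto
        · by_cases hxy : x = y
          · subst hxy; rw [e2]; tauto
          · exact absurd (by simp [hxS, hxy, hxz]) hx'
  · rintro (rfl | rfl | rfl | rfl)
    · exact Or.inl rfl
    · exact Or.inr ⟨z, by simp [hz], by simp, e1⟩
    · exact Or.inr ⟨y, by simp [hy], by simp, e2⟩
    · exact Or.inr ⟨b, by simp, by simp [hb], rfl⟩

theorem Qcell_subset_inj {C C' B B' : Finset ℕ} {n : ℕ} (h : C ⊆ B) (hB : B.card = n + 2)
    (hC : C.card + 1 = n) (h' : C' ⊆ B') (hB' : B'.card = n + 2) (hC' : C'.card + 1 = n)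
    (hsub : Qcell C' B' ⊆ Qcell C B) : C' = C ∧ B' = B := by
  have hBB : B' = B := by
    rcases mem_Qcell.1 (hsub (mem_insert_self _ _)) with h | ⟨x, -, hx, he⟩
    · exact h
    · have := card_insert_of_notMem hx
      rw [he] at this
      omega
  subst hBB
  refine ⟨?_, rfl⟩
  have hinj : ∀ D : Finset ℕ, Set.InjOn (fun x => insert x D) (B' \ D : Finset ℕ) := by
    intro D x hx y hy hxy
    have hxD := (mem_sdiff.1 (mem_coe.1 hx)).2
    have : x ∈ insert y D := by
      have h1 : x ∈ insert x D := mem_insert_self _ _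
      simp only at hxy
      rwa [hxy] at h1
    exact (mem_insert.1 this).resolve_right hxD
  have hcard : ∀ D : Finset ℕ, D ⊆ B' → D.card + 1 = n →
      ((B' \ D).image fun x => insert x D).card = 3 := by
    intro D hD hDn
    rw [card_image_of_injOn (hinj D), card_sdiff_of_subset hD]
    omega
  have hss : ((B' \ C').image fun x => insert x C') ⊆ (B' \ C).image fun x => insert x C := by
    intro X hX
    have h1 : X ∈ Qcell C B' := hsub (mem_insert_of_mem hX)
    refine (mem_insert.1 h1).resolve_left ?_
    rintro rfl
    obtain ⟨x, hx, he⟩ := mem_image.1 hX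
    have := card_insert_of_notMem (mem_sdiff.1 hx).2
    rw [he] at this
    omega
  have heq := eq_of_subset_of_card_le hss (by rw [hcard C h hC, hcard C' h' hC'])
  refine eq_of_subset_of_card_le (fun u hu => ?_) (by omega)
  have h3 : 1 < (B' \ C).card := by rw [card_sdiff_of_subset h]; omega
  obtain ⟨x, hx, hxu⟩ := exists_mem_ne h3 u
  have : insert x C ∈ (B' \ C').image fun x => insert x C' :=
    heq ▸ mem_image_of_mem (fun x => insert x C) hx
  obtain ⟨x', -, he⟩ := mem_image.1 this
  have : u ∈ insert x C := he ▸ mem_insert_of_mem hu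
  exact (mem_insert.1 this).resolve_left hxu.symm

end Cells

section Stage

/-- The faces of the complex filtered by the weight of the sets of size `n + 1`. -/
structure IsStageFace (m n k : ℕ) (ρ : Finset (Finset ℕ)) : Prop where
  nonempty : ρ.Nonempty
  subset_Icc : ∀ X ∈ ρ, X ⊆ Icc 1 m
  card : ∀ X ∈ ρ, X.card = n ∨ X.card = n + 2
  triple : ∀ B ∈ ρ, ∀ B' ∈ ρ, ∀ B'' ∈ ρ, B.card = n + 2 → B'.card = n + 2 → B''.card = n + 2 →
    B ≠ B' → B ∩ B' ⊆ B''
  notCrit : ∀ C B, IsCritQ m n C B → ¬ Qcell C B ⊆ ρ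
  pair : ∀ X ∈ ρ, ∀ Y ∈ ρ, ∃ S ⊆ Icc 1 m, S.card = n + 1 ∧ binWt S < k ∧ Compat S X ∧ Compat S Y

variable {m n k : ℕ} {S : Finset ℕ}

theorem IsStageFace.subset {ρ τ : Finset (Finset ℕ)} (h : IsStageFace m n k ρ) (hτ : τ ⊆ ρ)
    (hne : τ.Nonempty) : IsStageFace m n k τ where
  nonempty := hne
  subset_Icc X hX := h.subset_Icc X (hτ hX)
  card X hX := h.card X (hτ hX)
  triple B hB B' hB' B'' hB'' := h.triple B (hτ hB) B' (hτ hB') B'' (hτ hB'')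
  notCrit C B hC hs := h.notCrit C B hC (hs.trans hτ)
  pair X hX Y hY := h.pair X (hτ hX) Y (hτ hY)

theorem IsStageFace.mono {ρ : Finset (Finset ℕ)} {k' : ℕ} (h : IsStageFace m n k ρ)
    (hk : k ≤ k') : IsStageFace m n k' ρ where
  __ := h
  pair X hX Y hY := by
    obtain ⟨S, h1, h2, h3, h4⟩ := h.pair X hX Y hY
    exact ⟨S, h1, h2, h3.trans_le hk, h4⟩

theorem IsStageFace.adj {ρ : Finset (Finset ℕ)} (h : IsStageFace m n k ρ) {X Y : Finset ℕ}
    (hX : X ∈ ρ) (hY : Y ∈ ρ) : (symmDiff X Y).card ≤ 2 := by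
  obtain ⟨S, -, hS, -, h1, h2⟩ := h.pair X hX Y hY
  exact symmDiff_le_of_compat hS (h.card X hX) (h.card Y hY) h1 h2

/-- The subcomplex of weight less than `k`. -/
def stageCx (m n k : ℕ) : AbsSC (Finset ℕ) where
  faces := {ρ | IsStageFace m n k ρ}
  not_empty_mem h := by simpa using h.nonempty
  down_closed _ hs _ hts htne := hs.subset hts (nonempty_iff_ne_empty.2 htne)

theorem isStageFace_of_compat {ρ : Finset (Finset ℕ)} (hS : S ⊆ Icc 1 m) (hc : S.card = n + 1)
    (hk : binWt S < k) (hne : ρ.Nonempty) (hI : ∀ X ∈ ρ, X ⊆ Icc 1 m)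
    (hcard : ∀ X ∈ ρ, X.card = n ∨ X.card = n + 2) (h : ∀ X ∈ ρ, Compat S X) :
    IsStageFace m n k ρ where
  nonempty := hne
  subset_Icc := hI
  card := hcard
  triple B hB B' hB' B'' hB'' hn hn' hn'' hne := by
    obtain ⟨b, hb, rfl⟩ := exists_eq_insert_of_subset ((h B hB).superset hc hn) hn hc
    obtain ⟨b', hb', rfl⟩ := exists_eq_insert_of_subset ((h B' hB').superset hc hn') hn' hc
    refine Subset.trans (fun u hu => ?_) ((h B'' hB'').superset hc hn'')
    simp only [mem_inter, mem_insert] at hu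
    rcases hu with ⟨rfl | hu, hu'⟩
    · rcases hu' with rfl | hu'
      · exact absurd rfl hne
      · exact hu'
    · exact hu
  notCrit C B hCB hsub := by
    have hBS : B ⊆ S := by
      have hs : ∀ x ∈ B, x ∉ C → insert x C ⊆ S := fun x hx hxC =>
        (h _ (hsub (mem_Qcell.2 (Or.inr ⟨x, hx, hxC, rfl⟩)))).subset hc (by
          rw [card_insert_of_notMem hxC, hCB.card'])
      have h1 := card_sdiff_of_subset hCB.subset
      obtain ⟨x, hx⟩ : (B \ C).Nonempty := card_pos.1 (by
        have := hCB.card; have := hCB.card'; omega)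
      rw [mem_sdiff] at hx
      intro u hu
      by_cases huC : u ∈ C
      · exact hs x hx.1 hx.2 (mem_insert_of_mem huC)
      · exact hs u hu huC (mem_insert_self _ _)
    have := card_le_card hBS
    have := hCB.card
    omega
  pair X hX Y hY := ⟨S, hS, hc, hk, h X hX, h Y hY⟩

/-- Faces comparable with a single set of larger weight have another witness. -/
theorem IsStageFace.exists_compat {ρ : Finset (Finset ℕ)} (h : IsStageFace m n k ρ)
    (hc : S.card = n + 1) (hS : ∀ X ∈ ρ, Compat S X) (hk : k ≤ binWt S) :
    ∃ T ⊆ Icc 1 m, T.card = n + 1 ∧ binWt T < k ∧ ∀ X ∈ ρ, Compat T X := by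
  have key : ∀ T X Y : Finset ℕ, T.card = n + 1 → binWt T < k → Compat T X → Compat T Y → X ∈ ρ →
      Y ∈ ρ → X.card = Y.card → X = Y := by
    intro T X Y hT hw h1 h2 hX hY hXY
    by_contra hne
    refine (hw.trans_le hk).ne (congrArg binWt ?_)
    rcases h.card X hX with hn | hn
    · have hn' := hXY ▸ hn
      have a1 := h1.subset hT hn
      have a2 := h2.subset hT hn'
      have b1 := (hS X hX).subset hc hn
      have b2 := (hS Y hY).subset hc hn'
      have hlt : n < (X ∪ Y).card := by
        rw [← hn]
        refine card_lt_card (Finset.ssubset_iff_subset_ne.2 ⟨subset_union_left, fun he => hne ?_⟩)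
        exact (eq_of_subset_of_card_le (he ▸ subset_union_right : Y ⊆ X) (by omega)).symm
      rw [← eq_of_subset_of_card_le (union_subset a1 a2) (by omega),
        ← eq_of_subset_of_card_le (union_subset b1 b2) (by omega)]
    · have hn' := hXY ▸ hn
      have a1 := h1.superset hT hn
      have a2 := h2.superset hT hn'
      have b1 := (hS X hX).superset hc hn
      have b2 := (hS Y hY).superset hc hn'
      have hlt : (X ∩ Y).card < n + 2 := by
        rw [← hn]
        refine card_lt_card (Finset.ssubset_iff_subset_ne.2 ⟨inter_subset_left, fun he => hne ?_⟩)
        exact eq_of_subset_of_card_le (inter_eq_left.1 he) (by omega)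
      rw [eq_of_subset_of_card_le (subset_inter a1 a2) (by omega),
        eq_of_subset_of_card_le (subset_inter b1 b2) (by omega)]
  have hcardeq : ∀ X ∈ ρ, ∀ Y ∈ ρ, X.card = Y.card → X = Y := fun X hX Y hY => by
    obtain ⟨T, -, hT, hw, h1, h2⟩ := h.pair X hX Y hY
    exact key T X Y hT hw h1 h2 hX hY
  obtain ⟨X, hX⟩ := h.nonempty
  by_cases hY : ∃ Y ∈ ρ, Y.card ≠ X.card
  · obtain ⟨Y, hY, hYX⟩ := hY
    obtain ⟨T, hTI, hT, hw, h1, h2⟩ := h.pair X hX Y hY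
    refine ⟨T, hTI, hT, hw, fun Z hZ => ?_⟩
    by_cases hZX : Z.card = X.card
    · rwa [hcardeq Z hZ X hX hZX]
    · have : Z.card = Y.card := by
        have := h.card X hX
        have := h.card Y hY
        have := h.card Z hZ
        omega
      rwa [hcardeq Z hZ Y hY this]
  · push Not at hY
    obtain ⟨T, hTI, hT, hw, h1, h2⟩ := h.pair X hX X hX
    exact ⟨T, hTI, hT, hw, fun Z hZ => hcardeq Z hZ X hX (hY Z hZ) ▸ h1⟩

end Stage

section Step

/-- A set of size `n + 1` which is not of least weight, with its greatest element `a` and the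
least missing element `b`. -/
structure StageData (m n : ℕ) (S : Finset ℕ) (a b : ℕ) : Prop where
  sub : S ⊆ Icc 1 m
  card : S.card = n + 1
  a_mem : a ∈ S
  a_max : ∀ x ∈ S, x ≤ a
  b_mem : b ∈ Icc 1 m
  b_notMem : b ∉ S
  b_min : ∀ x ∈ Icc 1 m, x ∉ S → b ≤ x
  lt : b < a

variable {m n a b : ℕ} {S : Finset ℕ}

/-- The faces all of whose extensions are comparable with `S`. -/
def freeFaces (m n : ℕ) (S : Finset ℕ) (a : ℕ) : Set (Finset (Finset ℕ)) :=
  {σ | IsStageFace m n (binWt S + 1) σ ∧ S.erase a ∉ σ ∧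
    ∀ ρ, IsStageFace m n (binWt S + 1) ρ → σ ⊆ ρ → ∀ X ∈ ρ, Compat S X}

/-- Triples of facets of `S`, including the distinguished one. -/
def facetTriples (S : Finset ℕ) (a : ℕ) : Set (Finset (Finset ℕ)) :=
  {σ | ∃ y ∈ S, ∃ z ∈ S, y ≠ z ∧ y ≠ a ∧ z ≠ a ∧ σ = {S.erase y, S.erase z, S.erase a}}

/-- Pairs of facets of `S` together with a coface. -/
def facetPairsInsert (m : ℕ) (S : Finset ℕ) : Set (Finset (Finset ℕ)) :=
  {σ | ∃ y ∈ S, ∃ z ∈ S, ∃ c ∈ Icc 1 m, y ≠ z ∧ c ∉ S ∧ c < y ∧ c < z ∧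
    σ = {S.erase y, S.erase z, insert c S}}

/-- Pairs of facets of `S`. -/
def facetPairs (S : Finset ℕ) : Set (Finset (Finset ℕ)) :=
  {σ | ∃ y ∈ S, ∃ z ∈ S, y ≠ z ∧ σ = {S.erase y, S.erase z}}


theorem erase_ne_erase {y z : ℕ} (hy : y ∈ S) (hyz : y ≠ z) : S.erase y ≠ S.erase z :=
  fun h => notMem_erase y S (h ▸ mem_erase.2 ⟨hyz, hy⟩)

theorem IsStageFace.superset_of_two {k y z : ℕ} {ρ : Finset (Finset ℕ)} {Z : Finset ℕ}
    (h : IsStageFace m n k ρ) (hS : S.card = n + 1) (hy : y ∈ S) (hz : z ∈ S) (hyz : y ≠ z)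
    (h1 : S.erase y ∈ ρ) (h2 : S.erase z ∈ ρ) (hZ : Z ∈ ρ) (hc : Z.card = n + 2) : S ⊆ Z := by
  have c1 : (S.erase y).card = n := by rw [card_erase_of_mem hy, hS]; rfl
  have c2 : (S.erase z).card = n := by rw [card_erase_of_mem hz, hS]; rfl
  have s1 := subset_of_symmDiff c1 hc (h.adj h1 hZ)
  have s2 := subset_of_symmDiff c2 hc (h.adj h2 hZ)
  intro u hu
  by_cases huy : u = y
  · exact s2 (mem_erase.2 ⟨huy ▸ hyz, hu⟩)
  · exact s1 (mem_erase.2 ⟨huy, hu⟩)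

theorem IsStageFace.subset_or_eq {k y z : ℕ} {ρ : Finset (Finset ℕ)} {Z : Finset ℕ}
    (h : IsStageFace m n k ρ) (hS : S.card = n + 1) (hy : y ∈ S) (hz : z ∈ S) (hyz : y ≠ z)
    (h1 : S.erase y ∈ ρ) (h2 : S.erase z ∈ ρ) (hZ : Z ∈ ρ) (hc : Z.card = n) :
    Z ⊆ S ∨ ∃ q, q ∉ S ∧ Z = insert q ((S.erase y).erase z) :=
  subset_or_eq_insert hS hc hy hz hyz (h.adj hZ h1) (h.adj hZ h2)

theorem IsStageFace.compat_of_three {k x y z : ℕ} {ρ : Finset (Finset ℕ)} {Z : Finset ℕ}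
    (h : IsStageFace m n k ρ) (hS : S.card = n + 1) (hx : x ∈ S) (hy : y ∈ S) (hz : z ∈ S)
    (hxy : x ≠ y) (hxz : x ≠ z) (hyz : y ≠ z) (h1 : S.erase x ∈ ρ) (h2 : S.erase y ∈ ρ)
    (h3 : S.erase z ∈ ρ) (hZ : Z ∈ ρ) : Compat S Z := by
  rcases h.card Z hZ with hc | hc
  · rcases h.subset_or_eq hS hx hy hxy h1 h2 hZ hc with hs | ⟨q, hq, e⟩
    · exact Or.inl hs
    · rcases h.subset_or_eq hS hx hz hxz h1 h3 hZ hc with hs | ⟨q', hq', e'⟩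
      · exact Or.inl hs
      · have : y ∈ Z := by simp [e', hyz, hxy.symm, hy]
        rw [e] at this
        have hyq : y = q := by simpa using this
        exact absurd (hyq ▸ hy) hq
  · exact Or.inr (h.superset_of_two hS hx hy hxy h1 h2 hZ hc)

theorem eq_or_swap_of_erase_subset {T : Finset ℕ} {x : ℕ} (hS : S.card = n + 1) (hx : x ∈ S)
    (hT : T.card = n + 1) (h : S.erase x ⊆ T) (hw : binWt T < binWt S + 1) :
    T = S ∨ ∃ q ∈ T, q ∉ S ∧ q < x ∧ T = insert q (S.erase x) := by
  have hc : (S.erase x).card = n := by rw [card_erase_of_mem hx, hS]; rfl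
  obtain ⟨q, hq, he⟩ := exists_eq_erase_of_subset h hc hT
  have hT' : T = insert q (S.erase x) := by rw [he, insert_erase hq]
  by_cases hqS : q ∈ S
  · refine Or.inl (eq_of_subset_of_card_le ?_ (by omega))
    rw [hT']
    exact insert_subset hqS (erase_subset _ _)
  · exact Or.inr ⟨q, hq, hqS, le_of_binWt_swap_le hx hqS (hT' ▸ Nat.lt_succ_iff.1 hw), hT'⟩

theorem eq_or_swap_of_subset_insert {T : Finset ℕ} {c : ℕ} (hS : S.card = n + 1) (hc : c ∉ S)
    (hT : T.card = n + 1) (h : T ⊆ insert c S) (hw : binWt T < binWt S + 1) :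
    T = S ∨ ∃ x ∈ S, c < x ∧ T = insert c (S.erase x) := by
  obtain ⟨x, hx, he⟩ := exists_eq_erase_of_subset (n := n + 1) h hT
    (by rw [card_insert_of_notMem hc, hS])
  rcases mem_insert.1 hx with rfl | hxS
  · exact Or.inl (by rw [he, erase_insert hc])
  · have hT' : T = insert c (S.erase x) := by
      rw [he, erase_insert_of_ne]
      rintro rfl
      exact hc hxS
    exact Or.inr ⟨x, hxS, le_of_binWt_swap_le hxS hc (hT' ▸ Nat.lt_succ_iff.1 hw), hT'⟩

namespace StageData

variable {r : Finset (Finset ℕ)}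

theorem card_erase (D : StageData m n S a b) {x : ℕ} (hx : x ∈ S) : (S.erase x).card = n := by
  rw [card_erase_of_mem hx, D.card]; rfl

theorem card_insert (D : StageData m n S a b) {c : ℕ} (hc : c ∉ S) :
    (insert c S).card = n + 2 := by
  rw [card_insert_of_notMem hc, D.card]

theorem insert_ne_erase (D : StageData m n S a b) {c x : ℕ} (hc : c ∉ S) (hx : x ∈ S) :
    insert c S ≠ S.erase x := fun h => by
  have h1 := D.card_insert hc
  have h2 := D.card_erase hx
  rw [h] at h1
  omega

theorem eq_erase (D : StageData m n S a b) {X : Finset ℕ} (h : X ⊆ S) (hX : X.card = n) :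
    ∃ x ∈ S, X = S.erase x := exists_eq_erase_of_subset h hX D.card

theorem eq_insert (D : StageData m n S a b) {X : Finset ℕ} (h : S ⊆ X) (hX : X.card = n + 2) :
    ∃ c, c ∉ S ∧ X = insert c S := exists_eq_insert_of_subset h hX D.card

theorem not_free (hr : r ∈ ((stageCx m n (binWt S + 1)).avoid (freeFaces m n S a)).faces)
    {t : Finset (Finset ℕ)} (ht : t ⊆ r) (hne : t.Nonempty) (hv : S.erase a ∉ t)
    (h : ∀ ρ, IsStageFace m n (binWt S + 1) ρ → t ⊆ ρ → ∀ X ∈ ρ, Compat S X) : False :=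
  hr.2 t ⟨hr.1.subset ht hne, hv, h⟩ ht

theorem insert_inj (D : StageData m n S a b)
    (hr : r ∈ ((stageCx m n (binWt S + 1)).avoid (freeFaces m n S a)).faces) {c d : ℕ}
    (hc : c ∉ S) (hd : d ∉ S) (h1 : insert c S ∈ r) (h2 : insert d S ∈ r) : c = d := by
  by_contra hcd
  have hint : insert c S ∩ insert d S = S := by
    ext u
    simp only [mem_inter, mem_insert]
    constructor
    · rintro ⟨rfl | h, h' | h'⟩ <;> tauto
    · tauto
  have hne : insert c S ≠ insert d S := fun h => by
    have : c ∈ insert d S := h ▸ mem_insert_self c S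
    simp [hcd, hc] at this
  refine not_free hr (t := {insert c S, insert d S}) (by simp [insert_subset_iff, h1, h2])
    (by simp) ?_ fun ρ hρ ht X hX => ?_
  · simp [(D.insert_ne_erase hc D.a_mem).symm, (D.insert_ne_erase hd D.a_mem).symm]
  · simp only [insert_subset_iff, singleton_subset_iff] at ht
    rcases hρ.card X hX with hn | hn
    · left
      rw [← hint]
      exact subset_inter (subset_of_symmDiff hn (D.card_insert hc) (hρ.adj hX ht.1))
        (subset_of_symmDiff hn (D.card_insert hd) (hρ.adj hX ht.2))
    · right
      rw [← hint]
      exact hρ.triple _ ht.1 _ ht.2 _ hX (D.card_insert hc) (D.card_insert hd) hn hne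

theorem not_three (D : StageData m n S a b)
    (hr : r ∈ ((stageCx m n (binWt S + 1)).avoid (freeFaces m n S a)).faces) {x y z : ℕ}
    (hx : x ∈ S) (hy : y ∈ S) (hz : z ∈ S) (hxy : x ≠ y) (hxz : x ≠ z) (hyz : y ≠ z)
    (h1 : S.erase x ∈ r) (h2 : S.erase y ∈ r) (h3 : S.erase z ∈ r) (hxa : x ≠ a) (hya : y ≠ a)
    (hza : z ≠ a) : False := by
  refine not_free hr (t := {S.erase x, S.erase y, S.erase z})
    (by simp [insert_subset_iff, h1, h2, h3]) (by simp) ?_ fun ρ hρ ht X hX => ?_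
  · simp [(erase_ne_erase hx hxa).symm, (erase_ne_erase hy hya).symm, (erase_ne_erase hz hza).symm]
  · simp only [insert_subset_iff, singleton_subset_iff] at ht
    exact hρ.compat_of_three D.card hx hy hz hxy hxz hyz ht.1 ht.2.1 ht.2.2 hX

theorem not_crit (D : StageData m n S a b)
    (hr : r ∈ ((stageCx m n (binWt S + 1)).avoid (freeFaces m n S a)).faces) {y z c : ℕ}
    (hy : y ∈ S) (hz : z ∈ S) (hyz : y ≠ z) (hc : c ∉ S)
    (h1 : S.erase y ∈ r) (h2 : S.erase z ∈ r) (h3 : insert c S ∈ r) (hya : y ≠ a)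
    (hza : z ≠ a) : ¬ IsCritQ m n ((S.erase y).erase z) (insert c S) := by
  intro hcr
  refine not_free hr (t := {S.erase y, S.erase z, insert c S})
    (by simp [insert_subset_iff, h1, h2, h3]) (by simp) ?_ fun ρ hρ ht X hX => ?_
  · simp [(erase_ne_erase hy hya).symm, (erase_ne_erase hz hza).symm,
      (D.insert_ne_erase hc D.a_mem).symm]
  · simp only [insert_subset_iff, singleton_subset_iff] at ht
    rcases hρ.card X hX with hn | hn
    · rcases hρ.subset_or_eq D.card hy hz hyz ht.1 ht.2.1 hX hn with h | ⟨q, hq, rfl⟩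
      · exact Or.inl h
      · have hsub := subset_of_symmDiff hn (D.card_insert hc) (hρ.adj hX ht.2.2)
        have hqc : q = c := (mem_insert.1 (hsub (mem_insert_self _ _))).resolve_right hq
        subst hqc
        refine absurd (fun Y hY => ?_) (hρ.notCrit _ _ hcr)
        rcases (mem_Qcell_erase hy hz hyz hc).1 hY with rfl | rfl | rfl | rfl
        exacts [ht.2.2, ht.1, ht.2.1, hX]
    · exact Or.inr (hρ.superset_of_two D.card hy hz hyz ht.1 ht.2.1 hX hn)

theorem lt_of_erase_mem (D : StageData m n S a b)
    (hr : r ∈ ((stageCx m n (binWt S + 1)).avoid (freeFaces m n S a)).faces) {x : ℕ}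
    (hx : x ∈ S) (h1 : S.erase x ∈ r) : b < x := by
  by_contra hbx
  have hxb : x < b := lt_of_le_of_ne (not_lt.1 hbx) (by rintro rfl; exact D.b_notMem hx)
  refine not_free hr (t := {S.erase x}) (by simp [h1]) (by simp) ?_ fun ρ hρ ht X hX => ?_
  · simp [(erase_ne_erase hx (hxb.trans D.lt).ne).symm]
  · obtain ⟨T, hTI, hT, hw, c1, c2⟩ := hρ.pair _ (singleton_subset_iff.1 ht) X hX
    rcases eq_or_swap_of_erase_subset D.card hx hT (c1.subset hT (D.card_erase hx)) hw with
      rfl | ⟨q, hqT, hq, hqx, -⟩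
    · exact c2
    · have := D.b_min q (hTI hqT) hq
      omega

theorem lt_max_of_insert_mem (D : StageData m n S a b)
    (hr : r ∈ ((stageCx m n (binWt S + 1)).avoid (freeFaces m n S a)).faces) {c : ℕ}
    (hc : c ∉ S) (h1 : insert c S ∈ r) : c < a := by
  by_contra hca
  refine not_free hr (t := {insert c S}) (by simp [h1]) (by simp) ?_ fun ρ hρ ht X hX => ?_
  · simp [(D.insert_ne_erase hc D.a_mem).symm]
  · obtain ⟨T, hTI, hT, hw, c1, c2⟩ := hρ.pair _ (singleton_subset_iff.1 ht) X hX
    rcases eq_or_swap_of_subset_insert D.card hc hT (c1.superset hT (D.card_insert hc)) hw with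
      rfl | ⟨x, hx, hxc, -⟩
    · exact c2
    · have := D.a_max x hx
      omega

theorem insert_lt_erase (D : StageData m n S a b)
    (hr : r ∈ ((stageCx m n (binWt S + 1)).avoid (freeFaces m n S a)).faces) {c x : ℕ}
    (hc : c ∉ S) (hx : x ∈ S) (h1 : insert c S ∈ r) (h2 : S.erase x ∈ r) : c < x := by
  by_cases hxa : x = a
  · exact hxa ▸ D.lt_max_of_insert_mem hr hc h1
  by_contra hcx
  have hxc : x < c := lt_of_le_of_ne (not_lt.1 hcx) (by rintro rfl; exact hc hx)
  refine not_free hr (t := {insert c S, S.erase x}) (by simp [insert_subset_iff, h1, h2]) (by simp)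
    ?_ fun ρ hρ ht X hX => ?_
  · simp [(D.insert_ne_erase hc D.a_mem).symm, (erase_ne_erase hx hxa).symm]
  · simp only [insert_subset_iff, singleton_subset_iff] at ht
    obtain ⟨T, -, hT, hw, c1, c2⟩ := hρ.pair _ ht.1 X hX
    obtain ⟨T', -, hT', hw', c1', c2'⟩ := hρ.pair _ ht.2 X hX
    rcases eq_or_swap_of_subset_insert D.card hc hT (c1.superset hT (D.card_insert hc)) hw with
      rfl | ⟨y, hy, hcy, rfl⟩
    · exact c2
    rcases eq_or_swap_of_erase_subset D.card hx hT' (c1'.subset hT' (D.card_erase hx)) hw' with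
      rfl | ⟨q, -, hq, hqx, rfl⟩
    · exact c2'
    rcases hρ.card X hX with hn | hn
    · left
      intro u hu
      have u1 := c2.subset hT hn hu
      have u2 := c2'.subset hT' hn hu
      simp only [mem_insert, mem_erase] at u1 u2
      rcases u1 with rfl | u1
      · rcases u2 with rfl | u2
        · omega
        · exact u2.2
      · exact u1.2
    · right
      intro u hu
      by_cases hux : u = x
      · exact c2.superset hT hn (by simp [hux, hx]; right; omega)
      · exact c2'.superset hT' hn (by simp [hux, hu])

end StageData
end Step

section Collapse

variable {m n a b : ℕ} {S : Finset ℕ} {r : Finset (Finset ℕ)}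

theorem IsStageFace.mem_powerset_powerset {k : ℕ} (h : IsStageFace m n k r) :
    r ∈ (Icc 1 m).powerset.powerset :=
  Finset.mem_powerset.2 fun X hX => Finset.mem_powerset.2 (h.subset_Icc X hX)

theorem finite_of_forall_isStageFace {k : ℕ} {F : Set (Finset (Finset ℕ))}
    (h : ∀ s ∈ F, IsStageFace m n k s) : F.Finite :=
  (Icc 1 m).powerset.powerset.finite_toSet.subset fun s hs => (h s hs).mem_powerset_powerset

theorem subset_of_subset_insert {V : Type*} [DecidableEq V] {t r : Finset V} {v : V}
    (h : t ⊆ insert v r) (hv : v ∉ t) : t ⊆ r := (subset_insert_iff_of_notMem hv).1 h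

namespace StageData

theorem subset_Icc_erase (D : StageData m n S a b) (x : ℕ) : S.erase x ⊆ Icc 1 m :=
  (erase_subset _ _).trans D.sub

theorem subset_Icc_insert (D : StageData m n S a b) {c : ℕ} (hc : c ∈ Icc 1 m) :
    insert c S ⊆ Icc 1 m := insert_subset hc D.sub

theorem isStageFace (D : StageData m n S a b) (hne : r.Nonempty)
    (hI : ∀ X ∈ r, X ⊆ Icc 1 m) (hcard : ∀ X ∈ r, X.card = n ∨ X.card = n + 2)
    (h : ∀ X ∈ r, Compat S X) : IsStageFace m n (binWt S + 1) r :=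
  isStageFace_of_compat D.sub D.card (Nat.lt_succ_self _) hne hI hcard h

theorem insert_isStageFace (D : StageData m n S a b) (hr : IsStageFace m n (binWt S + 1) r)
    (h : ∀ X ∈ r, Compat S X) {X : Finset ℕ} (hX : X ⊆ Icc 1 m) (hc : X.card = n ∨ X.card = n + 2)
    (hSX : Compat S X) : IsStageFace m n (binWt S + 1) (insert X r) := by
  refine D.isStageFace (insert_nonempty _ _) ?_ ?_ ?_ <;> intro Y hY <;>
    rcases mem_insert.1 hY with rfl | hY
  exacts [hX, hr.subset_Icc Y hY, hc, hr.card Y hY, hSX, h Y hY]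

/-- A facet of a set of size `n - 1` which is not comparable with `S`. -/
theorem not_compat (D : StageData m n S a b) {y z c : ℕ} (hy : y ∈ S) (hz : z ∈ S) (hyz : y ≠ z)
    (hc : c ∉ S) : ¬ Compat S (insert c ((S.erase y).erase z)) := by
  intro h
  have := h.subset D.card (by
    rw [card_insert_of_notMem (by simp [hc]), card_erase_erase D.card hy hz hyz])
  exact hc (this (mem_insert_self _ _))

theorem Qcell_isStageFace (D : StageData m n S a b) {y z c : ℕ} (hy : y ∈ S) (hz : z ∈ S)
    (hyz : y ≠ z) (hc : c ∉ S) (hcI : c ∈ Icc 1 m) (hcy : c < y) (hcz : c < z)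
    (hcr : ¬ IsCritQ m n ((S.erase y).erase z) (insert c S)) :
    IsStageFace m n (binWt S + 1) (Qcell ((S.erase y).erase z) (insert c S)) := by
  have hCS : (S.erase y).erase z ⊆ S := (erase_subset _ _).trans (erase_subset _ _)
  have hcC : c ∉ (S.erase y).erase z := fun h => hc (hCS h)
  have hC := card_erase_erase D.card hy hz hyz
  have hcC' : (insert c ((S.erase y).erase z)).card = n := by rw [card_insert_of_notMem hcC, hC]
  have mem := fun X => mem_Qcell_erase (X := X) hy hz hyz hc
  have hcard : ∀ X ∈ Qcell ((S.erase y).erase z) (insert c S),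
      X = insert c S ∨ X.card = n := fun X hX => by
    rcases (mem X).1 hX with rfl | rfl | rfl | rfl
    exacts [Or.inl rfl, Or.inr (D.card_erase hy), Or.inr (D.card_erase hz), Or.inr hcC']
  have swap : ∀ x ∈ S, c < x → insert c (S.erase x) ⊆ Icc 1 m ∧
      (insert c (S.erase x)).card = n + 1 ∧ binWt (insert c (S.erase x)) < binWt S + 1 :=
    fun x hx hcx => ⟨insert_subset hcI (D.subset_Icc_erase x), by
      rw [card_insert_of_notMem (fun h => hc (mem_of_mem_erase h)), D.card_erase hx],
      (binWt_swap_lt hx hc hcx).trans (Nat.lt_succ_self _)⟩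
  have sub1 : ∀ x, insert c (S.erase x) ⊆ insert c S := fun x =>
    insert_subset_insert _ (erase_subset _ _)
  obtain ⟨y1, y2, y3⟩ := swap y hy hcy
  obtain ⟨z1, z2, z3⟩ := swap z hz hcz
  have Cy : insert c ((S.erase y).erase z) ⊆ insert c (S.erase y) :=
    insert_subset_insert _ (erase_subset _ _)
  have Cz : insert c ((S.erase y).erase z) ⊆ insert c (S.erase z) := by
    rw [erase_right_comm]; exact insert_subset_insert _ (erase_subset _ _)
  refine ⟨insert_nonempty _ _, fun X hX => ?_, fun X hX => ?_, ?_, ?_, ?_⟩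
  · rcases (mem X).1 hX with rfl | rfl | rfl | rfl
    exacts [D.subset_Icc_insert hcI, D.subset_Icc_erase y, D.subset_Icc_erase z, Cy.trans y1]
  · rcases hcard X hX with rfl | h
    exacts [Or.inr (D.card_insert hc), Or.inl h]
  · intro B hB B' hB' _ _ hn hn' _ hne
    refine absurd ?_ hne
    rw [(hcard B hB).resolve_right (by omega), (hcard B' hB').resolve_right (by omega)]
  · intro C' B' hcr' hsub
    obtain ⟨rfl, rfl⟩ := Qcell_subset_inj (hCS.trans (subset_insert _ _)) (D.card_insert hc) hC
      hcr'.subset hcr'.card hcr'.card' hsub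
    exact hcr hcr'
  · have hpair : ∀ T, T ⊆ Icc 1 m ∧ T.card = n + 1 ∧ binWt T < binWt S + 1 → ∀ X Y, Compat T X →
        Compat T Y → ∃ S' ⊆ Icc 1 m, S'.card = n + 1 ∧ binWt S' < binWt S + 1 ∧ Compat S' X ∧
        Compat S' Y := fun T hT X Y hX hY => ⟨T, hT.1, hT.2.1, hT.2.2, hX, hY⟩
    have hS : S ⊆ Icc 1 m ∧ S.card = n + 1 ∧ binWt S < binWt S + 1 :=
      ⟨D.sub, D.card, Nat.lt_succ_self _⟩
    have hy' := hpair _ ⟨y1, y2, y3⟩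
    have hz' := hpair _ ⟨z1, z2, z3⟩
    have hs' := hpair _ hS
    intro X hX Y hY
    have i : ∀ x, Compat (insert c (S.erase x)) (insert c S) := fun x => Or.inr (sub1 x)
    have e : ∀ x, Compat (insert c (S.erase x)) (S.erase x) := fun x => Or.inl (subset_insert _ _)
    rcases (mem X).1 hX with rfl | rfl | rfl | rfl <;> rcases (mem Y).1 hY with rfl | rfl | rfl | rfl
    exacts [hs' _ _ (compat_insert _ _) (compat_insert _ _),
      hs' _ _ (compat_insert _ _) (compat_erase _ _), hs' _ _ (compat_insert _ _) (compat_erase _ _),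
      hy' _ _ (i _) (Or.inl Cy), hs' _ _ (compat_erase _ _) (compat_insert _ _),
      hs' _ _ (compat_erase _ _) (compat_erase _ _), hs' _ _ (compat_erase _ _) (compat_erase _ _),
      hy' _ _ (e _) (Or.inl Cy), hs' _ _ (compat_erase _ _) (compat_insert _ _),
      hs' _ _ (compat_erase _ _) (compat_erase _ _), hs' _ _ (compat_erase _ _) (compat_erase _ _),
      hz' _ _ (e _) (Or.inl Cz), hy' _ _ (Or.inl Cy) (i _), hy' _ _ (Or.inl Cy) (e _),
      hz' _ _ (Or.inl Cz) (e _), hy' _ _ (Or.inl Cy) (Or.inl Cy)]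

theorem contractsTo_free (D : StageData m n S a b) {v : Finset ℕ}
    (h : ((stageCx m n (binWt S + 1)).avoid (freeFaces m n S a)).ContractsTo v) :
    (stageCx m n (binWt S + 1)).ContractsTo v := by
  refine AbsSC.contractsTo_of_avoid' (finite_of_forall_isStageFace fun s hs => hs.1)
    (fun s hs => hs.1.nonempty) (fun s hs => ⟨S.erase a, hs.2.1, fun r hr hsr =>
      ⟨?_, fun t ht hsub => subset_of_subset_insert hsub ht.2.1⟩⟩) h
  exact D.insert_isStageFace hr (hs.2.2 r hr hsr) (D.subset_Icc_erase a)
    (Or.inl (D.card_erase D.a_mem)) (compat_erase _ _)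

theorem not_compat_of_free {t : Finset (Finset ℕ)} (ht : t ∈ freeFaces m n S a) {X : Finset ℕ}
    (hX : ¬ Compat S X) : X ∉ t := fun h => hX (ht.2.2 t ht.1 (Subset.refl _) X h)

theorem triple_compat (D : StageData m n S a b) {t : Finset (Finset ℕ)} (ht : t ∈ facetTriples S a) :
    IsStageFace m n (binWt S + 1) t ∧ ∀ X ∈ t, X ⊆ S ∧ X.card = n := by
  obtain ⟨y, hy, z, hz, -, -, -, rfl⟩ := ht
  have : ∀ X ∈ ({S.erase y, S.erase z, S.erase a} : Finset (Finset ℕ)), X ⊆ S ∧ X.card = n := by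
    intro X hX
    simp only [mem_insert, mem_singleton] at hX
    rcases hX with rfl | rfl | rfl
    exacts [⟨erase_subset _ _, D.card_erase hy⟩, ⟨erase_subset _ _, D.card_erase hz⟩,
      ⟨erase_subset _ _, D.card_erase D.a_mem⟩]
  exact ⟨D.isStageFace (by simp) (fun X hX => (this X hX).1.trans D.sub)
    (fun X hX => Or.inl (this X hX).2) (fun X hX => Or.inl (this X hX).1), this⟩

theorem pair_insert_compat (D : StageData m n S a b) {t : Finset (Finset ℕ)}
    (ht : t ∈ facetPairsInsert m S) :
    IsStageFace m n (binWt S + 1) t ∧ ∀ X ∈ t, Compat S X := by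
  obtain ⟨y, hy, z, hz, c, hcI, -, hc, -, -, rfl⟩ := ht
  have : ∀ X ∈ ({S.erase y, S.erase z, insert c S} : Finset (Finset ℕ)), Compat S X ∧
      X ⊆ Icc 1 m ∧ (X.card = n ∨ X.card = n + 2) := by
    intro X hX
    simp only [mem_insert, mem_singleton] at hX
    rcases hX with rfl | rfl | rfl
    exacts [⟨compat_erase _ _, D.subset_Icc_erase y, Or.inl (D.card_erase hy)⟩,
      ⟨compat_erase _ _, D.subset_Icc_erase z, Or.inl (D.card_erase hz)⟩,
      ⟨compat_insert _ _, D.subset_Icc_insert hcI, Or.inr (D.card_insert hc)⟩]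
  exact ⟨D.isStageFace (by simp) (fun X hX => (this X hX).2.1)
    (fun X hX => (this X hX).2.2) (fun X hX => (this X hX).1), fun X hX => (this X hX).1⟩

theorem pair_compat (D : StageData m n S a b) {t : Finset (Finset ℕ)}
    (ht : t ∈ facetPairs S) : IsStageFace m n (binWt S + 1) t ∧ ∀ X ∈ t, X ⊆ S ∧ X.card = n := by
  obtain ⟨y, hy, z, hz, -, rfl⟩ := ht
  have : ∀ X ∈ ({S.erase y, S.erase z} : Finset (Finset ℕ)), X ⊆ S ∧ X.card = n := by
    intro X hX
    simp only [mem_insert, mem_singleton] at hX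
    rcases hX with rfl | rfl
    exacts [⟨erase_subset _ _, D.card_erase hy⟩, ⟨erase_subset _ _, D.card_erase hz⟩]
  exact ⟨D.isStageFace (by simp) (fun X hX => (this X hX).1.trans D.sub)
    (fun X hX => Or.inl (this X hX).2) (fun X hX => Or.inl (this X hX).1), this⟩

end StageData
end Collapse

section Collapse

variable {m n a b : ℕ} {S : Finset ℕ} {r : Finset (Finset ℕ)}

namespace StageData

theorem contractsTo_triples (D : StageData m n S a b) {v : Finset ℕ}
    (h : (((stageCx m n (binWt S + 1)).avoid (freeFaces m n S a)).avoid
      (facetTriples S a)).ContractsTo v) :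
    ((stageCx m n (binWt S + 1)).avoid (freeFaces m n S a)).ContractsTo v := by
  have hnot : ∀ t ∈ facetTriples S a, insert b S ∉ t := fun t ht hb => by
    have := ((D.triple_compat ht).2 _ hb).2
    have := D.card_insert D.b_notMem
    omega
  refine AbsSC.contractsTo_of_avoid' (finite_of_forall_isStageFace fun s hs => (D.triple_compat hs).1)
    (fun s hs => (D.triple_compat hs).1.nonempty) (fun s hs => ⟨insert b S, hnot s hs, fun r hr hsr =>
      ⟨?_, fun t ht hsub => subset_of_subset_insert hsub (hnot t ht)⟩⟩) h
  obtain ⟨y, hy, z, hz, hyz, hya, hza, rfl⟩ := hs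
  simp only [insert_subset_iff, singleton_subset_iff] at hsr
  obtain ⟨ry, rz, ra⟩ := hsr
  have hby := D.lt_of_erase_mem hr hy ry
  have hbz := D.lt_of_erase_mem hr hz rz
  have hcompat : ∀ X ∈ r, Compat S X := fun X hX =>
    hr.1.compat_of_three D.card hy hz D.a_mem hyz hya hza ry rz ra hX
  have hclass : ∀ X ∈ r, X = S.erase y ∨ X = S.erase z ∨ X = S.erase a ∨ X = insert b S := by
    intro X hX
    rcases hr.1.card X hX with hn | hn
    · obtain ⟨x, hx, rfl⟩ := D.eq_erase ((hcompat X hX).subset D.card hn) hn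
      by_contra! hcon
      exact D.not_three hr hx hy hz (fun e => hcon.1 (e ▸ rfl)) (fun e => hcon.2.1 (e ▸ rfl)) hyz hX
        ry rz (fun e => hcon.2.2.1 (e ▸ rfl)) hya hza
    · obtain ⟨c, hc, rfl⟩ := D.eq_insert ((hcompat X hX).superset D.card hn) hn
      have hcI : c ∈ Icc 1 m := hr.1.subset_Icc _ hX (mem_insert_self _ _)
      have hcy := D.insert_lt_erase hr hc hy hX ry
      have hcz := D.insert_lt_erase hr hc hz hX rz
      by_cases hcb : c = b
      · simp [hcb]
      refine absurd ⟨(erase_subset _ _).trans ((erase_subset _ _).trans (subset_insert _ _)),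
        D.subset_Icc_insert hcI, D.card_insert hc, card_erase_erase D.card hy hz hyz,
        ⟨a, by simp [D.a_mem, hya.symm, hza.symm], ?_⟩, b, D.b_mem, ?_, ?_⟩
        (D.not_crit hr hy hz hyz hc ry rz hX hya hza)
      · intro x hx
        rcases mem_insert.1 hx with rfl | hx
        · exact (D.lt_max_of_insert_mem hr hc hX).le
        · exact D.a_max x hx
      · simp [D.b_notMem, Ne.symm hcb]
      · intro x hx hxC
        rcases mem_insert.1 hx with rfl | hx
        · exact lt_of_le_of_ne (D.b_min x hcI hc) (Ne.symm hcb)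
        · simp only [mem_erase, not_and, hx, not_true, imp_false] at hxC
          by_cases hxz : x = z
          · exact hxz ▸ hbz
          · by_cases hxy : x = y
            · exact hxy ▸ hby
            · exact absurd hxy (hxC hxz)
  refine ⟨D.insert_isStageFace hr.1 hcompat (D.subset_Icc_insert D.b_mem)
    (Or.inr (D.card_insert D.b_notMem)) (compat_insert _ _), fun t ht hsub => ?_⟩
  have hcr : ¬ IsCritQ m n ((S.erase y).erase z) (insert b S) := by
    intro hcr
    obtain ⟨u, hu, huB, hlt⟩ := hcr.gap
    have := D.b_min u hu (fun h => huB (mem_insert_of_mem h))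
    have := hlt b (mem_insert_self _ _) (by simp [D.b_notMem])
    omega
  refine D.not_compat hy hz hyz D.b_notMem (ht.2.2 _ (D.Qcell_isStageFace hy hz hyz D.b_notMem
    D.b_mem hby hbz hcr) (fun X hX => ?_) _
    ((mem_Qcell_erase hy hz hyz D.b_notMem).2 (Or.inr (Or.inr (Or.inr rfl)))))
  rw [mem_Qcell_erase hy hz hyz D.b_notMem]
  have hXa : X ≠ S.erase a := by rintro rfl; exact ht.2.1 hX
  rcases mem_insert.1 (hsub hX) with rfl | hXr
  · simp
  · have := hclass X hXr
    tauto

theorem not_three' (D : StageData m n S a b)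
    (hr : r ∈ (((stageCx m n (binWt S + 1)).avoid (freeFaces m n S a)).avoid
      (facetTriples S a)).faces) {x y z : ℕ}
    (hx : x ∈ S) (hy : y ∈ S) (hz : z ∈ S) (hxy : x ≠ y) (hxz : x ≠ z) (hyz : y ≠ z)
    (h1 : S.erase x ∈ r) (h2 : S.erase y ∈ r) (h3 : S.erase z ∈ r) : False := by
  have key : ∀ y ∈ S, ∀ z ∈ S, y ≠ z → y ≠ a → z ≠ a → S.erase y ∈ r → S.erase z ∈ r →
      S.erase a ∈ r → False := fun y hy z hz hyz hya hza h1 h2 h3 =>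
    hr.2 _ ⟨y, hy, z, hz, hyz, hya, hza, rfl⟩ (by simp [insert_subset_iff, h1, h2, h3])
  by_cases hxa : x = a
  · exact key y hy z hz hyz (hxa ▸ hxy.symm) (hxa ▸ hxz.symm) h2 h3 (hxa ▸ h1)
  by_cases hya : y = a
  · exact key x hx z hz hxz hxa (hya ▸ hyz.symm) h1 h3 (hya ▸ h2)
  by_cases hza : z = a
  · exact key x hx y hy hxy hxa hya h1 h2 (hza ▸ h3)
  exact D.not_three hr.1 hx hy hz hxy hxz hyz h1 h2 h3 hxa hya hza

theorem contractsTo_pairsInsert (D : StageData m n S a b) {v : Finset ℕ}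
    (h : ((((stageCx m n (binWt S + 1)).avoid (freeFaces m n S a)).avoid
      (facetTriples S a)).avoid (facetPairsInsert m S)).ContractsTo v) :
    (((stageCx m n (binWt S + 1)).avoid (freeFaces m n S a)).avoid
      (facetTriples S a)).ContractsTo v := by
  refine AbsSC.contractsTo_of_avoid'
    (finite_of_forall_isStageFace fun s hs => (D.pair_insert_compat hs).1)
    (fun s hs => (D.pair_insert_compat hs).1.nonempty) (fun s hs => ?_) h
  obtain ⟨y, hy, z, hz, c, hcI, hyz, hc, hcy, hcz, rfl⟩ := id hs
  have hnc := D.not_compat hy hz hyz hc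
  have hnot : ∀ t ∈ facetPairsInsert m S, insert c ((S.erase y).erase z) ∉ t := fun t ht hb =>
    hnc ((D.pair_insert_compat ht).2 _ hb)
  refine ⟨_, hnot _ hs, fun r hr hsr => ⟨?_, fun t ht hsub => subset_of_subset_insert hsub (hnot t ht)⟩⟩
  simp only [insert_subset_iff, singleton_subset_iff] at hsr
  obtain ⟨ry, rz, rc⟩ := hsr
  have hsub : insert (insert c ((S.erase y).erase z)) r ⊆
      Qcell ((S.erase y).erase z) (insert c S) := by
    intro X hX
    rw [mem_Qcell_erase hy hz hyz hc]
    rcases mem_insert.1 hX with rfl | hX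
    · simp
    rcases hr.1.1.card X hX with hn | hn
    · rcases hr.1.1.subset_or_eq D.card hy hz hyz ry rz hX hn with h | ⟨q, hq, rfl⟩
      · obtain ⟨x, hx, rfl⟩ := D.eq_erase h hn
        by_contra! hcon
        exact D.not_three' hr hx hy hz (fun e => hcon.2.1 (e ▸ rfl)) (fun e => hcon.2.2.1 (e ▸ rfl))
          hyz hX ry rz
      · have hs := subset_of_symmDiff hn (D.card_insert hc) (hr.1.1.adj hX rc)
        have := (mem_insert.1 (hs (mem_insert_self _ _))).resolve_right hq
        simp [this]
    · obtain ⟨d, hd, rfl⟩ := D.eq_insert (hr.1.1.superset_of_two D.card hy hz hyz ry rz hX hn) hn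
      left
      rw [D.insert_inj hr.1 hc hd rc hX]
  have hcr : ¬ IsCritQ m n ((S.erase y).erase z) (insert c S) := by
    by_cases hya : y = a
    · intro hcr
      obtain ⟨u, hu, hmax⟩ := hcr.max
      have h1 := hmax a (mem_insert_of_mem D.a_mem)
      simp only [mem_erase] at hu
      exact hu.2.1 (hya ▸ le_antisymm (D.a_max u hu.2.2) h1)
    by_cases hza : z = a
    · intro hcr
      obtain ⟨u, hu, hmax⟩ := hcr.max
      have h1 := hmax a (mem_insert_of_mem D.a_mem)
      simp only [mem_erase] at hu
      exact hu.1 (hza ▸ le_antisymm (D.a_max u hu.2.2) h1)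
    exact D.not_crit hr.1 hy hz hyz hc ry rz rc hya hza
  have hQ := D.Qcell_isStageFace hy hz hyz hc hcI hcy hcz hcr
  refine ⟨⟨hQ.subset hsub (insert_nonempty _ _), fun t ht hsub' => ?_⟩, fun t ht hsub' => ?_⟩
  · exact hr.1.2 t ht (subset_of_subset_insert hsub' (not_compat_of_free ht hnc))
  · exact hr.2 t ht (subset_of_subset_insert hsub'
      fun hX => hnc (Or.inl ((D.triple_compat ht).2 _ hX).1))

theorem contractsTo_pairs (D : StageData m n S a b) {v : Finset ℕ}
    (h : (((((stageCx m n (binWt S + 1)).avoid (freeFaces m n S a)).avoid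
      (facetTriples S a)).avoid (facetPairsInsert m S)).avoid (facetPairs S)).ContractsTo v) :
    ((((stageCx m n (binWt S + 1)).avoid (freeFaces m n S a)).avoid
      (facetTriples S a)).avoid (facetPairsInsert m S)).ContractsTo v := by
  refine AbsSC.contractsTo_of_avoid'
    (finite_of_forall_isStageFace fun s hs => (D.pair_compat hs).1)
    (fun s hs => (D.pair_compat hs).1.nonempty) (fun s hs => ?_) h
  obtain ⟨y, hy, z, hz, hyz, rfl⟩ := id hs
  have hnc := D.not_compat hy hz hyz D.b_notMem
  have hnot : ∀ t ∈ facetPairs S, insert b ((S.erase y).erase z) ∉ t := fun t ht hb =>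
    hnc (Or.inl ((D.pair_compat ht).2 _ hb).1)
  refine ⟨_, hnot _ hs, fun r hr hsr => ⟨?_, fun t ht hsub => subset_of_subset_insert hsub (hnot t ht)⟩⟩
  simp only [insert_subset_iff, singleton_subset_iff] at hsr
  obtain ⟨ry, rz⟩ := hsr
  have hF := hr.1.1.1
  have hby := D.lt_of_erase_mem hr.1.1 hy ry
  have hbz := D.lt_of_erase_mem hr.1.1 hz rz
  have hC := card_erase_erase D.card hy hz hyz
  set C := (S.erase y).erase z with hCdef
  have hCS : C ⊆ S := (erase_subset _ _).trans (erase_subset _ _)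
  have hzC : insert z C = S.erase y := insert_erase_erase hz hyz
  have hyC : insert y C = S.erase z := by
    rw [hCdef, erase_right_comm]; exact insert_erase_erase hy hyz.symm
  have hclass : ∀ X ∈ r, ∃ q, q ∉ C ∧ X = insert q C := by
    intro X hX
    rcases hF.card X hX with hn | hn
    · rcases hF.subset_or_eq D.card hy hz hyz ry rz hX hn with h | ⟨q, hq, rfl⟩
      · obtain ⟨x, hx, rfl⟩ := D.eq_erase h hn
        by_cases hxy : x = y
        · exact ⟨z, by simp [hCdef], by rw [hxy, hzC]⟩
        by_cases hxz : x = z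
        · exact ⟨y, by simp [hCdef], by rw [hxz, hyC]⟩
        exact (D.not_three' hr.1 hx hy hz hxy hxz hyz hX ry rz).elim
      · exact ⟨q, fun h => hq (hCS h), rfl⟩
    · obtain ⟨c, hc, rfl⟩ := D.eq_insert (hF.superset_of_two D.card hy hz hyz ry rz hX hn) hn
      exact (hr.2 _ ⟨y, hy, z, hz, c, hF.subset_Icc _ hX (mem_insert_self _ _), hyz, hc,
        D.insert_lt_erase hr.1.1 hc hy hX ry, D.insert_lt_erase hr.1.1 hc hz hX rz, rfl⟩
        (by simp [insert_subset_iff, ry, rz, hX])).elim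
  have hbC : b ∉ C := fun h => D.b_notMem (hCS h)
  have hbcard : (insert b C).card = n := by rw [card_insert_of_notMem hbC, hC]
  have hCI : C ⊆ Icc 1 m := hCS.trans D.sub
  have hall : ∀ X ∈ insert (insert b C) r, X ⊆ Icc 1 m ∧ X.card = n := by
    intro X hX
    rcases mem_insert.1 hX with rfl | hX
    · exact ⟨insert_subset D.b_mem hCI, hbcard⟩
    · obtain ⟨q, hq, rfl⟩ := hclass X hX
      exact ⟨hF.subset_Icc _ hX, by rw [card_insert_of_notMem hq, hC]⟩
  have swap : ∀ x ∈ S, b < x → insert b (S.erase x) ⊆ Icc 1 m ∧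
      (insert b (S.erase x)).card = n + 1 ∧ binWt (insert b (S.erase x)) < binWt S + 1 :=
    fun x hx hcx => ⟨insert_subset D.b_mem (D.subset_Icc_erase x), by
      rw [card_insert_of_notMem (fun h => D.b_notMem (mem_of_mem_erase h)), D.card_erase hx],
      (binWt_swap_lt hx D.b_notMem hcx).trans (Nat.lt_succ_self _)⟩
  have hpair : ∀ X ∈ r, ∃ T ⊆ Icc 1 m, T.card = n + 1 ∧ binWt T < binWt S + 1 ∧
      Compat T (insert b C) ∧ Compat T X := by
    intro X hX
    obtain ⟨q, hq, rfl⟩ := hclass X hX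
    by_cases hqz : q = z
    · obtain ⟨h1, h2, h3⟩ := swap y hy hby
      refine ⟨_, h1, h2, h3, Or.inl (insert_subset_insert _ (erase_subset _ _)), Or.inl ?_⟩
      rw [hqz, hzC]
      exact subset_insert _ _
    by_cases hqb : q = b
    · obtain ⟨h1, h2, h3⟩ := swap y hy hby
      refine ⟨_, h1, h2, h3, Or.inl (insert_subset_insert _ (erase_subset _ _)), Or.inl ?_⟩
      rw [hqb]
      exact insert_subset_insert _ (erase_subset _ _)
    have hzqC : z ∉ insert q C := by simp [Ne.symm hqz, hCdef]
    obtain ⟨T, hTI, hT, hw, c1, c2⟩ := hF.pair _ hX _ ry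
    have hTeq : insert z (insert q C) = T := by
      refine eq_of_subset_of_card_le (insert_subset ?_ (c1.subset hT ?_)) ?_
      · exact c2.subset hT (D.card_erase hy) (mem_erase.2 ⟨hyz.symm, hz⟩)
      · rw [card_insert_of_notMem hq, hC]
      · rw [card_insert_of_notMem hzqC, card_insert_of_notMem hq, hC, hT]
    have hbT : b ∉ T := by
      rw [← hTeq]
      simp [Ne.symm hqb, hbC, hbz.ne]
    have hTz : T.erase z = insert q C := by rw [← hTeq, erase_insert hzqC]
    have hzT : z ∈ T := hTeq ▸ mem_insert_self _ _
    refine ⟨insert b (T.erase z), insert_subset D.b_mem ((erase_subset _ _).trans hTI), ?_,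
      (binWt_swap_lt hzT hbT hbz).trans hw, Or.inl ?_, Or.inl ?_⟩
    · rw [card_insert_of_notMem (fun h => hbT (mem_of_mem_erase h)), card_erase_of_mem hzT, hT]
      rfl
    · rw [hTz]
      exact insert_subset_insert _ (subset_insert _ _)
    · rw [hTz]
      exact subset_insert _ _
  have hface : IsStageFace m n (binWt S + 1) (insert (insert b C) r) := by
    refine ⟨insert_nonempty _ _, fun X hX => (hall X hX).1, fun X hX => Or.inl (hall X hX).2, ?_, ?_, ?_⟩
    · intro B hB _ _ _ _ hn
      have := (hall B hB).2
      omega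
    · intro C' B' hcr hsub
      have := (hall B' (hsub (mem_insert_self _ _))).2
      have := hcr.card
      omega
    · intro X hX Y hY
      rcases mem_insert.1 hX with rfl | hX <;> rcases mem_insert.1 hY with rfl | hY
      · obtain ⟨T, h1, h2, h3, h4, -⟩ := hpair _ ry
        exact ⟨T, h1, h2, h3, h4, h4⟩
      · exact hpair Y hY
      · obtain ⟨T, h1, h2, h3, h4, h5⟩ := hpair X hX
        exact ⟨T, h1, h2, h3, h5, h4⟩
      · exact hF.pair X hX Y hY
  refine ⟨⟨⟨hface, fun t ht hsub' => ?_⟩, fun t ht hsub' => ?_⟩, fun t ht hsub' => ?_⟩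
  · exact hr.1.1.2 t ht (subset_of_subset_insert hsub' (not_compat_of_free ht hnc))
  · exact hr.1.2 t ht (subset_of_subset_insert hsub'
      fun hX => hnc (Or.inl ((D.triple_compat ht).2 _ hX).1))
  · exact hr.2 t ht (subset_of_subset_insert hsub'
      fun hX => hnc ((D.pair_insert_compat ht).2 _ hX))

end StageData
end Collapse

section Collapse

variable {m n a b : ℕ} {S : Finset ℕ} {r : Finset (Finset ℕ)}

namespace StageData

theorem exists_swap_erase (D : StageData m n S a b) {x c : ℕ} (hx : x ∈ S) (hc : c ∉ S)
    (hcI : c ∈ Icc 1 m) (hcx : c < x) : ∃ T ⊆ Icc 1 m, T.card = n + 1 ∧ binWt T < binWt S ∧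
    Compat T (S.erase x) ∧ Compat T (insert c S) :=
  ⟨insert c (S.erase x), insert_subset hcI (D.subset_Icc_erase x), by
    rw [card_insert_of_notMem (fun h => hc (mem_of_mem_erase h)), D.card_erase hx],
    binWt_swap_lt hx hc hcx, Or.inl (subset_insert _ _),
    Or.inr (insert_subset_insert _ (erase_subset _ _))⟩

theorem avoid_faces (D : StageData m n S a b) (hn : 1 ≤ n) :
    ((((stageCx m n (binWt S + 1)).avoid (freeFaces m n S a)).avoid
      (facetTriples S a)).avoid (facetPairsInsert m S)).avoid (facetPairs S) =
    stageCx m n (binWt S) := by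
  refine AbsSC.faces_injective (Set.Subset.antisymm (fun r hr => ?_) fun r hr => ?_)
  · have hF := hr.1.1.1.1
    have hfree := hr.1.1.1
    refine { hF with pair := fun X hX Y hY => ?_ }
    obtain ⟨T, h1, h2, h3, h4, h5⟩ := hF.pair X hX Y hY
    rcases lt_or_eq_of_le (Nat.lt_succ_iff.1 h3) with h | h
    · exact ⟨T, h1, h2, h, h4, h5⟩
    obtain rfl := binWt_injective h
    have hcl : ∀ X ∈ r, Compat T X → (∃ x ∈ T, X = T.erase x) ∨
        ∃ c ∈ Icc 1 m, c ∉ T ∧ X = insert c T := by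
      intro X hX hTX
      rcases hF.card X hX with hn | hn
      · exact Or.inl (D.eq_erase (hTX.subset h2 hn) hn)
      · obtain ⟨c, hc, rfl⟩ := D.eq_insert (hTX.superset h2 hn) hn
        exact Or.inr ⟨c, hF.subset_Icc _ hX (mem_insert_self _ _), hc, rfl⟩
    rcases hcl X hX h4 with ⟨x, hx, rfl⟩ | ⟨c, hcI, hc, rfl⟩ <;>
      rcases hcl Y hY h5 with ⟨y, hy, rfl⟩ | ⟨d, hdI, hd, rfl⟩
    · by_cases hxy : x = y
      · subst hxy
        obtain ⟨T', h1, h2, h3, h4, -⟩ :=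
          D.exists_swap_erase hx D.b_notMem D.b_mem (D.lt_of_erase_mem hfree hx hX)
        exact ⟨T', h1, h2, h3, h4, h4⟩
      · exact (hr.2 _ ⟨x, hx, y, hy, hxy, rfl⟩ (by simp [insert_subset_iff, hX, hY])).elim
    · exact D.exists_swap_erase hx hd hdI (D.insert_lt_erase hfree hd hx hY hX)
    · obtain ⟨T', h1, h2, h3, h4, h5⟩ :=
        D.exists_swap_erase hy hc hcI (D.insert_lt_erase hfree hc hy hX hY)
      exact ⟨T', h1, h2, h3, h5, h4⟩
    · obtain rfl := D.insert_inj hfree hc hd hX hY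
      obtain ⟨T', h1, h2, h3, -, h4⟩ :=
        D.exists_swap_erase D.a_mem hc hcI (D.lt_max_of_insert_mem hfree hc hX)
      exact ⟨T', h1, h2, h3, h4, h4⟩
  · have hr' : IsStageFace m n (binWt S) r := hr
    have huniq : ∀ y ∈ S, ∀ z ∈ S, y ≠ z → S.erase y ∈ r → S.erase z ∈ r → False := by
      intro y hy z hz hyz h1 h2
      obtain ⟨T, -, hT, hw, c1, c2⟩ := hr'.pair _ h1 _ h2
      have e1 := c1.subset hT (D.card_erase hy)
      have e2 := c2.subset hT (D.card_erase hz)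
      have hST : S ⊆ T := by
        intro u hu
        by_cases huy : u = y
        · exact e2 (mem_erase.2 ⟨huy ▸ hyz, hu⟩)
        · exact e1 (mem_erase.2 ⟨huy, hu⟩)
      rw [eq_of_subset_of_card_le hST (by rw [hT, D.card])] at hw
      exact lt_irrefl _ hw
    refine ⟨⟨⟨⟨hr'.mono (Nat.le_succ _), fun t ht hsub => ?_⟩, ?_⟩, ?_⟩, ?_⟩
    · obtain ⟨T, hTI, hT, hw, hTr⟩ := hr'.exists_compat D.card
        (ht.2.2 r (hr'.mono (Nat.le_succ _)) hsub) le_rfl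
      let ρ := r ∪ T.image T.erase
      have hfac : ∀ X ∈ T.image T.erase, X ⊆ Icc 1 m ∧ X.card = n ∧ Compat T X := by
        intro X hX
        obtain ⟨x, hx, rfl⟩ := mem_image.1 hX
        exact ⟨(erase_subset _ _).trans hTI, by rw [card_erase_of_mem hx, hT]; rfl,
          compat_erase _ _⟩
      have hρ : IsStageFace m n (binWt S + 1) ρ := by
        refine isStageFace_of_compat hTI hT (hw.trans (Nat.lt_succ_self _))
          (hr'.nonempty.mono subset_union_left) ?_ ?_ ?_ <;> intro X hX <;>
          rcases mem_union.1 hX with h | h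
        exacts [hr'.subset_Icc X h, (hfac X h).1, hr'.card X h, Or.inl (hfac X h).2.1, hTr X h,
          (hfac X h).2.2]
      have hcomp := ht.2.2 ρ hρ (hsub.trans subset_union_left)
      have hTS : T ⊆ S := by
        intro u hu
        obtain ⟨x, hx, hxu⟩ := exists_mem_ne (by omega : 1 < T.card) u
        have hX := mem_image_of_mem T.erase hx
        exact (hcomp _ (mem_union_right _ hX)).subset D.card (hfac _ hX).2.1
          (mem_erase.2 ⟨hxu.symm, hu⟩)
      rw [eq_of_subset_of_card_le hTS (by rw [hT, D.card])] at hw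
      exact lt_irrefl _ hw
    · rintro t ⟨y, hy, z, hz, hyz, -, -, rfl⟩ hsub
      simp only [insert_subset_iff, singleton_subset_iff] at hsub
      exact huniq y hy z hz hyz hsub.1 hsub.2.1
    · rintro t ⟨y, hy, z, hz, c, -, hyz, -, -, -, rfl⟩ hsub
      simp only [insert_subset_iff, singleton_subset_iff] at hsub
      exact huniq y hy z hz hyz hsub.1 hsub.2.1
    · rintro t ⟨y, hy, z, hz, hyz, rfl⟩ hsub
      simp only [insert_subset_iff, singleton_subset_iff] at hsub
      exact huniq y hy z hz hyz hsub.1 hsub.2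

theorem contractsTo_succ (D : StageData m n S a b) (hn : 1 ≤ n) {v : Finset ℕ}
    (h : (stageCx m n (binWt S)).ContractsTo v) : (stageCx m n (binWt S + 1)).ContractsTo v := by
  rw [← D.avoid_faces hn] at h
  exact D.contractsTo_free (D.contractsTo_triples (D.contractsTo_pairsInsert (D.contractsTo_pairs h)))

end StageData

theorem exists_contractsTo_stageCx (hn : 1 ≤ n) (k : ℕ)
    (hk : ∃ S ⊆ Icc 1 m, S.card = n + 1 ∧ binWt S < k) : ∃ v, (stageCx m n k).ContractsTo v := by
  induction k with
  | zero => obtain ⟨S, -, -, h⟩ := hk; exact absurd h (Nat.not_lt_zero _)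
  | succ k ih =>
    by_cases hS : ∃ S ⊆ Icc 1 m, S.card = n + 1 ∧ binWt S = k
    · obtain ⟨S, hSI, hSc, rfl⟩ := hS
      have hSne : S.Nonempty := card_pos.1 (by omega)
      by_cases hlt : ∃ T ⊆ Icc 1 m, T.card = n + 1 ∧ binWt T < binWt S
      · obtain ⟨v, hv⟩ := ih hlt
        obtain ⟨T, hTI, hTc, hw⟩ := hlt
        have : ∃ c ∈ Icc 1 m, c ∉ S ∧ ∃ x ∈ S, c < x := by
          by_contra! hcon
          refine hw.not_ge (binWt_le_of_initial hTI (by omega) fun c hcI hc x hx => ?_)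
          exact lt_of_le_of_ne (hcon c hcI hc x hx) (by rintro rfl; exact hc hx)
        obtain ⟨c, hcI, hc, x, hx, hcx⟩ := this
        have hne : (Icc 1 m \ S).Nonempty := ⟨c, mem_sdiff.2 ⟨hcI, hc⟩⟩
        have hmin := mem_sdiff.1 (min'_mem _ hne)
        have D : StageData m n S (S.max' hSne) ((Icc 1 m \ S).min' hne) :=
          { sub := hSI, card := hSc, a_mem := max'_mem _ _, a_max := fun x hx => le_max' _ x hx,
            b_mem := hmin.1, b_notMem := hmin.2
            b_min := fun x hxI hxS => min'_le _ _ (mem_sdiff.2 ⟨hxI, hxS⟩)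
            lt := (min'_le _ _ (mem_sdiff.2 ⟨hcI, hc⟩)).trans_lt (hcx.trans_le (le_max' _ x hx)) }
        exact ⟨v, D.contractsTo_succ hn hv⟩
      · push Not at hlt
        have huniq : ∀ T ⊆ Icc 1 m, T.card = n + 1 → binWt T < binWt S + 1 → T = S :=
          fun T hTI hT hw => binWt_injective (le_antisymm (Nat.lt_succ_iff.1 hw) (hlt T hTI hT))
        obtain ⟨a, ha⟩ := hSne
        have hca : (S.erase a).card = n := by rw [card_erase_of_mem ha, hSc]; rfl
        have hcone : ∀ s : Finset (Finset ℕ), (∀ X ∈ s, X ⊆ Icc 1 m ∧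
            (X.card = n ∨ X.card = n + 2) ∧ Compat S X) →
            IsStageFace m n (binWt S + 1) (insert (S.erase a) s) := by
          intro s hs
          have : ∀ X ∈ insert (S.erase a) s, X ⊆ Icc 1 m ∧
              (X.card = n ∨ X.card = n + 2) ∧ Compat S X := by
            intro X hX
            rcases mem_insert.1 hX with rfl | hX
            exacts [⟨(erase_subset _ _).trans hSI, Or.inl hca, compat_erase _ _⟩, hs X hX]
          exact isStageFace_of_compat hSI hSc (Nat.lt_succ_self _) (insert_nonempty _ _)
            (fun X hX => (this X hX).1) (fun X hX => (this X hX).2.1) fun X hX => (this X hX).2.2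
        have hv : IsStageFace m n (binWt S + 1) {S.erase a} := by simpa using hcone ∅ (by simp)
        refine ⟨S.erase a, AbsSC.contractsTo_of_cone hv
          fun s hs => hcone s fun X hX => ?_⟩
        have hs' : IsStageFace m n (binWt S + 1) s := hs
        obtain ⟨T, hTI, hT, hw, h1, -⟩ := hs'.pair X hX X hX
        rw [huniq T hTI hT hw] at h1
        exact ⟨hs'.subset_Icc X hX, hs'.card X hX, h1⟩
    · push Not at hS
      have heq : stageCx m n (k + 1) = stageCx m n k := by
        refine AbsSC.faces_injective (Set.Subset.antisymm (fun r hr => ?_) fun r hr =>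
          IsStageFace.mono hr (Nat.le_succ _))
        have hr' : IsStageFace m n (k + 1) r := hr
        refine { hr' with pair := fun X hX Y hY => ?_ }
        obtain ⟨T, h1, h2, h3, h4, h5⟩ := hr'.pair X hX Y hY
        exact ⟨T, h1, h2, lt_of_le_of_ne (Nat.lt_succ_iff.1 h3) (hS T h1 h2), h4, h5⟩
      rw [heq]
      obtain ⟨S, h1, h2, h3⟩ := hk
      exact ih ⟨S, h1, h2, lt_of_le_of_ne (Nat.lt_succ_iff.1 h3) (hS S h1 h2)⟩

end Collapse

section Start

variable {m n : ℕ} {r : Finset (Finset ℕ)}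

/-- The critical facets. -/
def critCells (m n : ℕ) : Set (Finset (Finset ℕ)) :=
  {s | (∃ C B, IsCritQ m n C B ∧ s = Qcell C B) ∨ ∃ A T, IsCritR m n A T ∧ s = Rcell A T}

/-- The Vietoris–Rips complex at scale two on the sets of size `n` and `n + 2`. -/
abbrev vrTwo (m n : ℕ) : AbsSC (Finset ℕ) := VRc (Fnm m n ∪ Fnm m (n + 2)) 2

theorem mem_vrTwo : r ∈ (vrTwo m n).faces ↔ r.Nonempty ∧
    (∀ X ∈ r, X ⊆ Icc 1 m ∧ (X.card = n ∨ X.card = n + 2)) ∧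
    ∀ X ∈ r, ∀ Y ∈ r, (symmDiff X Y).card ≤ 2 := by
  have : ∀ X, X ∈ Fnm m n ∪ Fnm m (n + 2) ↔ X ⊆ Icc 1 m ∧ (X.card = n ∨ X.card = n + 2) :=
    fun X => by simp only [Fnm, Set.mem_union, Set.mem_ofPred_eq]; tauto
  simp only [vrTwo, VRc, Set.mem_ofPred_eq, this]

theorem exists_compat_of_symmDiff (hm : n + 1 ≤ m) {X Y : Finset ℕ} (hX : X ⊆ Icc 1 m)
    (hY : Y ⊆ Icc 1 m) (hXc : X.card = n ∨ X.card = n + 2) (hYc : Y.card = n ∨ Y.card = n + 2)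
    (h : (symmDiff X Y).card ≤ 2) : ∃ S ⊆ Icc 1 m, S.card = n + 1 ∧ Compat S X ∧ Compat S Y := by
  have hI : (Icc 1 m).card = m := by simp
  rcases hXc with hXc | hXc <;> rcases hYc with hYc | hYc
  · obtain ⟨S, h1, h2, h3⟩ := exists_subsuperset_card_eq (union_subset hX hY)
      (card_union_le_of_symmDiff hXc hYc h) (by omega)
    exact ⟨S, h2, h3, Or.inl (subset_union_left.trans h1), Or.inl (subset_union_right.trans h1)⟩
  · obtain ⟨S, h1, h2, h3⟩ := exists_subsuperset_card_eq (n := n + 1)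
      (subset_of_symmDiff hXc hYc h) (by omega) (by omega)
    exact ⟨S, h2.trans hY, h3, Or.inl h1, Or.inr h2⟩
  · obtain ⟨S, h1, h2, h3⟩ := exists_subsuperset_card_eq (n := n + 1)
      (subset_of_symmDiff hYc hXc (by rwa [symmDiff_comm])) (by omega) (by omega)
    exact ⟨S, h2.trans hX, h3, Or.inr h2, Or.inl h1⟩
  · obtain ⟨S, h1, h2⟩ := exists_subset_card_eq (card_inter_ge_of_symmDiff hXc hYc h)
    exact ⟨S, (h1.trans inter_subset_left).trans hX, h2, Or.inr (h1.trans inter_subset_left),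
      Or.inr (h1.trans inter_subset_right)⟩

theorem symmDiff_erase_erase (T : Finset ℕ) (u v : ℕ) :
    (symmDiff (T.erase u) (T.erase v)).card ≤ 2 := by
  refine (card_le_card (?_ : _ ⊆ ({u, v} : Finset ℕ))).trans card_le_two
  intro w
  simp only [mem_symmDiff, mem_erase, mem_insert, mem_singleton]
  tauto

/-- The cofaces of codimension one of `T`, indexed by `U ⊆ T`. -/
def coTriples (m n : ℕ) (P : Finset ℕ → Finset ℕ → Prop) : Set (Finset (Finset ℕ)) :=
  {σ | ∃ T U, T ⊆ Icc 1 m ∧ T.card = n + 3 ∧ U ⊆ T ∧ U.card = 3 ∧ P T U ∧ σ = U.image T.erase}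

/-- The greatest element of `T` does not lie in `U`. -/
def MaxAvoids (T U : Finset ℕ) : Prop := ∃ c ∈ T, c ∉ U ∧ ∀ x ∈ T, x ≤ c

/-- The greatest element of `T` lies in `U`. -/
def MaxMem (T U : Finset ℕ) : Prop := ∃ c ∈ U, ∀ x ∈ T, x ≤ c

theorem coTriples_finite (P : Finset ℕ → Finset ℕ → Prop) : (coTriples m n P).Finite := by
  refine (Icc 1 m).powerset.powerset.finite_toSet.subset ?_
  rintro _ ⟨T, U, hT, -, -, -, -, rfl⟩
  refine Finset.mem_coe.2 (Finset.mem_powerset.2 fun X hX => Finset.mem_powerset.2 ?_)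
  obtain ⟨x, -, rfl⟩ := mem_image.1 hX
  exact (erase_subset _ _).trans hT

section

variable {T U : Finset ℕ}

theorem card_of_mem_coTriple (hT : T.card = n + 3) (hU : U ⊆ T) {X : Finset ℕ}
    (hX : X ∈ U.image T.erase) : X.card = n + 2 ∧ X ⊆ T := by
  obtain ⟨x, hx, rfl⟩ := mem_image.1 hX
  exact ⟨by rw [card_erase_of_mem (hU hx), hT]; rfl, erase_subset _ _⟩

theorem subset_iUnion_coTriple (hU3 : U.card = 3) {T' : Finset ℕ}
    (h : ∀ X ∈ U.image T.erase, X ⊆ T') : T ⊆ T' := by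
  intro u hu
  obtain ⟨x, hx, hxu⟩ := exists_mem_ne (by omega : 1 < U.card) u
  exact h _ (mem_image_of_mem _ hx) (mem_erase.2 ⟨hxu.symm, hu⟩)

theorem eq_sdiff_or_eq_erase (hr : r ∈ (vrTwo m n).faces) (hT : T.card = n + 3) (hU : U ⊆ T)
    (hU3 : U.card = 3) (hsub : U.image T.erase ⊆ r) {Z : Finset ℕ} (hZ : Z ∈ r) :
    Z = T \ U ∨ ∃ w ∈ T, Z = T.erase w := by
  obtain ⟨-, h1, h2⟩ := mem_vrTwo.1 hr
  have hTu : ∀ u ∈ U, (T.erase u).card = n + 2 := fun u hu => by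
    rw [card_erase_of_mem (hU hu), hT]; rfl
  have hUc : (T \ U).card = n := by rw [card_sdiff_of_subset hU]; omega
  have hmem : ∀ u ∈ U, T.erase u ∈ r := fun u hu => hsub (mem_image_of_mem _ hu)
  obtain ⟨v, hv⟩ : U.Nonempty := card_pos.1 (by omega)
  rcases (h1 Z hZ).2 with hn | hn
  · left
    refine eq_of_subset_of_card_le (fun q hq => ?_) (by omega)
    have := fun u hu => subset_of_symmDiff hn (hTu u hu) (h2 _ hZ _ (hmem u hu)) hq
    exact mem_sdiff.2 ⟨mem_of_mem_erase (this v hv), fun hqU => notMem_erase q T (this q hqU)⟩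
  · right
    refine exists_eq_erase_of_subset ?_ hn hT
    by_contra hZT
    obtain ⟨q, hq, hqT⟩ := not_subset.1 hZT
    have hc : (Z.erase q).card = n + 1 := by rw [card_erase_of_mem hq, hn]; rfl
    have : Z.erase q ⊆ T \ U := by
      intro w hw
      have key : ∀ u ∈ U, w ∈ T.erase u := fun u hu => by
        have h3 := card_inter_ge_of_symmDiff hn (hTu u hu) (h2 _ hZ _ (hmem u hu))
        have h4 : Z ∩ T.erase u ⊆ Z.erase q := fun x hx => by
          rw [mem_inter, mem_erase] at hx
          exact mem_erase.2 ⟨by rintro rfl; exact hqT hx.2.2, hx.1⟩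
        rw [← eq_of_subset_of_card_le h4 (by omega)] at hw
        exact (mem_inter.1 hw).2
      exact mem_sdiff.2 ⟨mem_of_mem_erase (key v hv), fun hwU => notMem_erase w T (key w hwU)⟩
    have := card_le_card this
    omega

theorem contractsTo_coTriples_avoids {v : Finset ℕ}
    (h : (((vrTwo m n).avoid (critCells m n)).avoid (coTriples m n MaxAvoids)).ContractsTo v) :
    ((vrTwo m n).avoid (critCells m n)).ContractsTo v := by
  refine AbsSC.contractsTo_of_avoid' (coTriples_finite _) ?_ ?_ h
  · rintro _ ⟨T, U, -, -, -, hU3, -, rfl⟩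
    exact (card_pos.1 (by omega : 0 < U.card)).image _
  rintro _ ⟨T, U, hTI, hT, hU, hU3, ⟨c, hcT, hcU, hmax⟩, rfl⟩
  have hUc : (T \ U).card = n := by rw [card_sdiff_of_subset hU]; omega
  have hnot : ∀ U' ⊆ T, c ∉ U' → T.erase c ∉ U'.image T.erase := by
    intro U' hU' hc he
    obtain ⟨x, hx, hxe⟩ := mem_image.1 he
    exact erase_ne_erase (hU' hx) (by rintro rfl; exact hc hx) hxe
  refine ⟨T.erase c, hnot U hU hcU, fun r hr hsub => ?_⟩
  obtain ⟨hne, h1, h2⟩ := mem_vrTwo.1 hr.1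
  have hcl : ∀ Z ∈ insert (T.erase c) r, ∃ w ∈ T, Z = T.erase w := by
    intro Z hZ
    rcases mem_insert.1 hZ with rfl | hZ
    · exact ⟨c, hcT, rfl⟩
    refine (eq_sdiff_or_eq_erase hr.1 hT hU hU3 hsub hZ).resolve_left ?_
    rintro rfl
    refine hr.2 (Rcell (T \ U) T) (Or.inr ⟨T \ U, T, ⟨sdiff_subset, hTI, hUc, hT,
      c, mem_sdiff.2 ⟨hcT, hcU⟩, hmax⟩, rfl⟩) ?_
    rw [Rcell, Finset.sdiff_sdiff_eq_self hU]
    exact insert_subset hZ hsub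
  have hcard : ∀ Z ∈ insert (T.erase c) r, Z.card = n + 2 := fun Z hZ => by
    obtain ⟨w, hw, rfl⟩ := hcl Z hZ
    rw [card_erase_of_mem hw, hT]; rfl
  refine ⟨⟨mem_vrTwo.2 ⟨insert_nonempty _ _, fun X hX => ⟨?_, Or.inr (hcard X hX)⟩,
    fun X hX Y hY => ?_⟩, ?_⟩, ?_⟩
  · obtain ⟨w, hw, rfl⟩ := hcl X hX
    exact (erase_subset _ _).trans hTI
  · obtain ⟨w, hw, rfl⟩ := hcl X hX
    obtain ⟨w', hw', rfl⟩ := hcl Y hY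
    exact symmDiff_erase_erase _ _ _
  · rintro s (⟨C, B, hCB, rfl⟩ | ⟨A, T', hAT, rfl⟩) hs
    · have hB := hCB.card
      have hC := hCB.card'
      obtain ⟨x, hx⟩ : (B \ C).Nonempty := card_pos.1 (by
        rw [card_sdiff_of_subset hCB.subset]; omega)
      rw [mem_sdiff] at hx
      have := hcard _ (hs (mem_Qcell.2 (Or.inr ⟨x, hx.1, hx.2, rfl⟩)))
      rw [card_insert_of_notMem hx.2] at this
      omega
    · have := hcard _ (hs (mem_insert_self _ _))
      have := hAT.card
      omega
  · rintro _ ⟨T', U', -, hT', hU', hU3', ⟨c', hcT', hcU', hmax'⟩, rfl⟩ hs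
    have hTT : T' = T := eq_of_subset_of_card_le (subset_iUnion_coTriple hU3' fun X hX => by
      obtain ⟨w, -, rfl⟩ := hcl X (hs hX)
      exact erase_subset _ _) (by omega)
    subst hTT
    obtain rfl : c = c' := le_antisymm (hmax' _ hcT) (hmax _ hcT')
    exact subset_of_subset_insert hs (hnot U' hU' hcU')

theorem contractsTo_coTriples_mem {v : Finset ℕ}
    (h : ((((vrTwo m n).avoid (critCells m n)).avoid (coTriples m n MaxAvoids)).avoid
      (coTriples m n MaxMem)).ContractsTo v) :
    (((vrTwo m n).avoid (critCells m n)).avoid (coTriples m n MaxAvoids)).ContractsTo v := by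
  refine AbsSC.contractsTo_of_avoid' (coTriples_finite _) ?_ ?_ h
  · rintro _ ⟨T, U, -, -, -, hU3, -, rfl⟩
    exact (card_pos.1 (by omega : 0 < U.card)).image _
  rintro _ ⟨T, U, hTI, hT, hU, hU3, ⟨c, hcU, hmax⟩, rfl⟩
  have hUc : (T \ U).card = n := by rw [card_sdiff_of_subset hU]; omega
  have hnot : ∀ T' U' : Finset ℕ, T'.card = n + 3 → U' ⊆ T' → T \ U ∉ U'.image T'.erase := by
    intro T' U' hT' hU' hX
    have := (card_of_mem_coTriple hT' hU' hX).1
    omega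
  refine ⟨T \ U, hnot T U hT hU, fun r hr hsub => ?_⟩
  obtain ⟨hne, h1, h2⟩ := mem_vrTwo.1 hr.1.1
  have hcl : ∀ Z ∈ insert (T \ U) r, Z = T \ U ∨ ∃ w ∈ U, Z = T.erase w := by
    intro Z hZ
    rcases mem_insert.1 hZ with rfl | hZ
    · exact Or.inl rfl
    rcases eq_sdiff_or_eq_erase hr.1.1 hT hU hU3 hsub hZ with rfl | ⟨w, hw, rfl⟩
    · exact Or.inl rfl
    by_cases hwU : w ∈ U
    · exact Or.inr ⟨w, hwU, rfl⟩
    refine (hr.2 _ ⟨T, insert w (U.erase c), hTI, hT,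
      insert_subset hw ((erase_subset _ _).trans hU), ?_, ⟨c, hU hcU, ?_, hmax⟩, rfl⟩ ?_).elim
    · rw [card_insert_of_notMem (fun h => hwU (mem_of_mem_erase h)), card_erase_of_mem hcU, hU3]
    · simp only [mem_insert, mem_erase, not_or]
      exact ⟨by rintro rfl; exact hwU hcU, by simp⟩
    · rw [image_insert]
      exact insert_subset hZ ((image_subset_image (erase_subset _ _)).trans hsub)
  have hcard : ∀ w ∈ U, (T.erase w).card = n + 2 := fun w hw => by
    rw [card_erase_of_mem (hU hw), hT]; rfl
  have hadj : ∀ w ∈ U, (symmDiff (T \ U) (T.erase w)).card ≤ 2 := fun w hw => by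
    have h3 : T \ U ⊆ T.erase w := fun x hx => by
      rw [mem_sdiff] at hx
      exact mem_erase.2 ⟨by rintro rfl; exact hx.2 hw, hx.1⟩
    rw [card_symmDiff, sdiff_eq_empty_iff_subset.2 h3, card_sdiff_of_subset h3, hcard w hw, hUc]
    simp
  refine ⟨⟨⟨mem_vrTwo.2 ⟨insert_nonempty _ _, fun X hX => ?_, fun X hX Y hY => ?_⟩, ?_⟩, ?_⟩, ?_⟩
  · rcases hcl X hX with rfl | ⟨w, hw, rfl⟩
    · exact ⟨sdiff_subset.trans hTI, Or.inl hUc⟩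
    · exact ⟨(erase_subset _ _).trans hTI, Or.inr (hcard w hw)⟩
  · rcases hcl X hX with rfl | ⟨w, hw, rfl⟩ <;> rcases hcl Y hY with rfl | ⟨w', hw', rfl⟩
    · simp
    · exact hadj w' hw'
    · rw [symmDiff_comm]; exact hadj w hw
    · exact symmDiff_erase_erase _ _ _
  · rintro s (⟨C, B, hCB, rfl⟩ | ⟨A, T', hAT, rfl⟩) hs
    · have hB := hCB.card
      have hC := hCB.card'
      obtain ⟨x, hx, y, hy, hxy⟩ := one_lt_card.1 (by
        rw [card_sdiff_of_subset hCB.subset]; omega : 1 < (B \ C).card)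
      rw [mem_sdiff] at hx hy
      have key : ∀ x ∈ B, x ∉ C → insert x C = T \ U := fun x hx hxC => by
        rcases hcl _ (hs (mem_Qcell.2 (Or.inr ⟨x, hx, hxC, rfl⟩))) with h | ⟨w, hw, h⟩
        · exact h
        · have h3 := hcard w hw
          rw [← h, card_insert_of_notMem hxC] at h3
          omega
      have : x ∈ insert y C := by
        rw [key y hy.1 hy.2, ← key x hx.1 hx.2]; exact mem_insert_self _ _
      simp [hxy, hx.2] at this
    · have hA : A = T \ U := by
        rcases hcl _ (hs (mem_insert_self _ _)) with h | ⟨w, hw, h⟩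
        · exact h
        · have h3 := hcard w hw
          rw [← h, hAT.card] at h3
          omega
      have hTT : T' = T := by
        refine eq_of_subset_of_card_le (subset_iUnion_coTriple (U := T' \ A) ?_ fun X hX => ?_)
          (by rw [hT, hAT.card'])
        · rw [card_sdiff_of_subset hAT.subset, hAT.card, hAT.card']; omega
        · rcases hcl X (hs (mem_insert_of_mem hX)) with rfl | ⟨w, -, rfl⟩
          exacts [sdiff_subset, erase_subset _ _]
      obtain ⟨d, hd, hdmax⟩ := hAT.max
      rw [hA, mem_sdiff] at hd
      rw [hTT] at hdmax
      exact hd.2 (le_antisymm (hmax d hd.1) (hdmax c (hU hcU)) ▸ hcU)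
  · rintro _ ⟨T', U', hTI', hT', hU', hU3', hmax', rfl⟩ hs
    exact hr.2 _ ⟨T', U', hTI', hT', hU', hU3', hmax', rfl⟩
      (subset_of_subset_insert hs (hnot T' U' hT' hU'))
  · rintro _ ⟨T', U', -, hT', hU', -, -, rfl⟩ hs
    exact subset_of_subset_insert hs (hnot T' U' hT' hU')

end

theorem binWt_lt {S : Finset ℕ} (h : S ⊆ Icc 1 m) : binWt S < 2 ^ (m + 1) :=
  Nat.geomSum_lt le_rfl fun k hk => by have := mem_Icc.1 (h hk); omega

theorem avoid_coTriples (hm : n + 1 ≤ m) :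
    (((vrTwo m n).avoid (critCells m n)).avoid (coTriples m n MaxAvoids)).avoid
      (coTriples m n MaxMem) = stageCx m n (2 ^ (m + 1)) := by
  refine AbsSC.faces_injective (Set.Subset.antisymm (fun r hr => ?_) fun r hr => ?_)
  · obtain ⟨hne, h1, h2⟩ := mem_vrTwo.1 hr.1.1.1
    refine ⟨hne, fun X hX => (h1 X hX).1, fun X hX => (h1 X hX).2, ?_, ?_, ?_⟩
    · intro B hB B' hB' B'' hB'' hn hn' hn'' hBB
      by_contra hsub
      obtain ⟨i, hi, hi''⟩ := not_subset.1 hsub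
      rw [mem_inter] at hi
      have key : ∀ D ∈ r, D.card = n + 2 → i ∈ D → D.erase i ⊆ B'' := by
        intro D hD hDn hiD
        have h3 : D ∩ B'' ⊆ D.erase i := fun u hu => by
          rw [mem_inter] at hu
          exact mem_erase.2 ⟨by rintro rfl; exact hi'' hu.2, hu.1⟩
        rw [← eq_of_subset_of_card_le h3 (by
          have := card_inter_ge_of_symmDiff hDn hn'' (h2 _ hD _ hB'')
          rw [card_erase_of_mem hiD, hDn]; exact this)]
        exact inter_subset_right
      have hint : (B ∩ B').card = n + 1 := by
        have h3 := card_inter_ge_of_symmDiff hn hn' (h2 _ hB _ hB')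
        have h4 : (B ∩ B').card ≠ n + 2 := fun h => hBB <|
          eq_of_subset_of_card_le (inter_eq_left.1
            (eq_of_subset_of_card_le inter_subset_left (by omega))) (by omega)
        have h5 := card_le_card (inter_subset_left : B ∩ B' ⊆ B)
        omega
      have hTc : (B ∪ B').card = n + 3 := by
        have := card_union_add_card_inter B B'
        omega
      set T := B ∪ B' with hTdef
      have hiT : i ∈ T := mem_union_left _ hi.1
      have hB''T : B'' = T.erase i := by
        refine (eq_of_subset_of_card_le (fun u hu => ?_) ?_).symm
        · rw [mem_erase, hTdef, mem_union] at hu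
          rcases hu.2 with h | h
          · exact key B hB hn hi.1 (mem_erase.2 ⟨hu.1, h⟩)
          · exact key B' hB' hn' hi.2 (mem_erase.2 ⟨hu.1, h⟩)
        · rw [card_erase_of_mem hiT, hTc, hn'']; rfl
      obtain ⟨u, hu, hBu⟩ := exists_eq_erase_of_subset (subset_union_left : B ⊆ T) hn hTc
      obtain ⟨u', hu', hBu'⟩ := exists_eq_erase_of_subset (subset_union_right : B' ⊆ T) hn' hTc
      have huu : u ≠ u' := by rintro rfl; exact hBB (hBu.trans hBu'.symm)
      have hui : u ≠ i := by
        rintro rfl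
        rw [hBu] at hi
        simp at hi
      have hui' : u' ≠ i := by
        rintro rfl
        rw [hBu'] at hi
        simp at hi
      have hTI : T ⊆ Icc 1 m := union_subset (h1 B hB).1 (h1 B' hB').1
      have hU : ({u, u', i} : Finset ℕ) ⊆ T :=
        insert_subset hu (insert_subset hu' (singleton_subset_iff.2 hiT))
      have hU3 : ({u, u', i} : Finset ℕ).card = 3 := card_eq_three.2 ⟨u, u', i, huu, hui, hui', rfl⟩
      have hUr : ({u, u', i} : Finset ℕ).image T.erase ⊆ r := by
        simp only [image_insert, image_singleton, insert_subset_iff, singleton_subset_iff]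
        rw [← hBu, ← hBu', ← hB''T]
        exact ⟨hB, hB', hB''⟩
      have hTne : T.Nonempty := ⟨i, hiT⟩
      by_cases hmem : T.max' hTne ∈ ({u, u', i} : Finset ℕ)
      · exact hr.2 _ ⟨T, _, hTI, hTc, hU, hU3, ⟨_, hmem, fun x hx => le_max' _ x hx⟩, rfl⟩ hUr
      · exact hr.1.2 _ ⟨T, _, hTI, hTc, hU, hU3,
          ⟨_, max'_mem _ hTne, hmem, fun x hx => le_max' _ x hx⟩, rfl⟩ hUr
    · exact fun C B hCB hs => hr.1.1.2 _ (Or.inl ⟨C, B, hCB, rfl⟩) hs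
    · intro X hX Y hY
      obtain ⟨S, h3, h4, h5, h6⟩ := exists_compat_of_symmDiff hm (h1 X hX).1 (h1 Y hY).1
        (h1 X hX).2 (h1 Y hY).2 (h2 X hX Y hY)
      exact ⟨S, h3, h4, binWt_lt h3, h5, h6⟩
  · have hr' : IsStageFace m n (2 ^ (m + 1)) r := hr
    have htri : ∀ T U : Finset ℕ, T.card = n + 3 → U ⊆ T → U.card = 3 → ¬ U.image T.erase ⊆ r := by
      intro T U hT hU hU3 hs
      obtain ⟨x, y, z, hxy, hxz, hyz, rfl⟩ := card_eq_three.1 hU3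
      simp only [insert_subset_iff, singleton_subset_iff] at hU
      simp only [image_insert, image_singleton, insert_subset_iff, singleton_subset_iff] at hs
      have hc : ∀ w ∈ T, (T.erase w).card = n + 2 := fun w hw => by
        rw [card_erase_of_mem hw, hT]; rfl
      have := hr'.triple _ hs.1 _ hs.2.1 _ hs.2.2 (hc x hU.1) (hc y hU.2.1) (hc z hU.2.2)
        (erase_ne_erase hU.1 hxy)
        (mem_inter.2 ⟨mem_erase.2 ⟨hxz.symm, hU.2.2⟩, mem_erase.2 ⟨hyz.symm, hU.2.2⟩⟩)
      exact notMem_erase z T this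
    refine ⟨⟨⟨mem_vrTwo.2 ⟨hr'.nonempty, fun X hX => ⟨hr'.subset_Icc X hX, hr'.card X hX⟩,
      fun X hX Y hY => hr'.adj hX hY⟩, ?_⟩, ?_⟩, ?_⟩
    · rintro s (⟨C, B, hCB, rfl⟩ | ⟨A, T, hAT, rfl⟩) hs
      · exact hr'.notCrit C B hCB hs
      · exact htri T (T \ A) hAT.card' sdiff_subset
          (by rw [card_sdiff_of_subset hAT.subset, hAT.card, hAT.card']; omega)
          ((subset_insert _ _).trans hs)
    · rintro _ ⟨T, U, -, hT, hU, hU3, -, rfl⟩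
      exact htri T U hT hU hU3
    · rintro _ ⟨T, U, -, hT, hU, hU3, -, rfl⟩
      exact htri T U hT hU hU3

theorem exists_contractsTo_avoid_critCells (hn : 1 ≤ n) (hm : n + 1 ≤ m) :
    ∃ v, ((vrTwo m n).avoid (critCells m n)).ContractsTo v := by
  obtain ⟨S, hS, hc⟩ := exists_subset_card_eq (s := Icc 1 m) (n := n + 1) (by simpa using hm)
  obtain ⟨v, hv⟩ := exists_contractsTo_stageCx (m := m) hn (2 ^ (m + 1)) ⟨S, hS, hc, binWt_lt hS⟩
  rw [← avoid_coTriples hm] at hv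
  exact ⟨v, contractsTo_coTriples_avoids (contractsTo_coTriples_mem hv)⟩

end Start

section Facets

variable {m n : ℕ}

theorem IsCritQ.card_sdiff {C B : Finset ℕ} (h : IsCritQ m n C B) : (B \ C).card = 3 := by
  have := h.card
  have := h.card'
  rw [card_sdiff_of_subset h.subset]
  omega

theorem IsCritR.card_sdiff {A T : Finset ℕ} (h : IsCritR m n A T) : (T \ A).card = 3 := by
  have := h.card
  have := h.card'
  rw [card_sdiff_of_subset h.subset]
  omega

theorem IsCritQ.card_cell {C B : Finset ℕ} (h : IsCritQ m n C B) : (Qcell C B).card = 4 := by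
  rw [Qcell, card_insert_of_notMem, card_image_of_injOn, h.card_sdiff]
  · intro x hx y hy hxy
    have hx' := (mem_sdiff.1 hx).2
    have : x ∈ insert y C := (show insert x C = insert y C from hxy) ▸ mem_insert_self x C
    exact (mem_insert.1 this).resolve_right hx'
  · simp only [mem_image, mem_sdiff, not_exists, not_and]
    rintro x ⟨-, hx⟩ rfl
    have := h.card
    have := h.card'
    rw [card_insert_of_notMem hx] at *
    omega

theorem IsCritR.card_cell {A T : Finset ℕ} (h : IsCritR m n A T) : (Rcell A T).card = 4 := by
  rw [Rcell, card_insert_of_notMem, card_image_of_injOn, h.card_sdiff]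
  · intro x hx y hy hxy
    exact (erase_inj T (mem_sdiff.1 hx).1).1 hxy
  · simp only [mem_image, mem_sdiff, not_exists, not_and]
    rintro x ⟨hx, -⟩ rfl
    have := h.card
    have := h.card'
    rw [card_erase_of_mem hx] at *
    omega

theorem symmDiff_insert_insert (C : Finset ℕ) (u v : ℕ) :
    (symmDiff (insert u C) (insert v C)).card ≤ 2 := by
  refine (card_le_card (?_ : _ ⊆ ({u, v} : Finset ℕ))).trans card_le_two
  intro w
  simp only [mem_symmDiff, mem_insert, mem_singleton]
  tauto

theorem card_symmDiff_of_subset {X Y : Finset ℕ} (h : X ⊆ Y) (hX : X.card = n)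
    (hY : Y.card = n + 2) : (symmDiff X Y).card ≤ 2 := by
  rw [card_symmDiff, sdiff_eq_empty_iff_subset.2 h, card_sdiff_of_subset h, card_empty]
  omega

theorem IsCritQ.isFacet {C B : Finset ℕ} (h : IsCritQ m n C B) :
    (vrTwo m n).IsFacet (Qcell C B) := by
  have hCx : ∀ x, x ∉ C → (insert x C).card = n := fun x hx => by
    rw [card_insert_of_notMem hx, h.card']
  have hsub : ∀ x ∈ B, insert x C ⊆ B := fun x hx => insert_subset hx h.subset
  refine ⟨mem_vrTwo.2 ⟨⟨B, mem_insert_self _ _⟩, ?_, ?_⟩, fun τ hτ hs => ?_⟩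
  · intro X hX
    rcases mem_Qcell.1 hX with rfl | ⟨x, hx, hxC, rfl⟩
    · exact ⟨h.subset_Icc, Or.inr h.card⟩
    · exact ⟨(hsub x hx).trans h.subset_Icc, Or.inl (hCx x hxC)⟩
  · intro X hX Y hY
    rcases mem_Qcell.1 hX with rfl | ⟨x, hx, hxC, rfl⟩ <;>
      rcases mem_Qcell.1 hY with rfl | ⟨y, hy, hyC, rfl⟩
    · simp
    · rw [symmDiff_comm]
      exact card_symmDiff_of_subset (hsub y hy) (hCx y hyC) h.card
    · exact card_symmDiff_of_subset (hsub x hx) (hCx x hxC) h.card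
    · exact symmDiff_insert_insert C x y
  · obtain ⟨-, h1, h2⟩ := mem_vrTwo.1 hτ
    refine Subset.antisymm (fun Z hZ => mem_Qcell.2 ?_) hs
    have hB : B ∈ τ := hs (mem_insert_self _ _)
    have hx : ∀ x ∈ B, x ∉ C → insert x C ∈ τ := fun x hx hxC =>
      hs (mem_Qcell.2 (Or.inr ⟨x, hx, hxC, rfl⟩))
    obtain ⟨v, hv⟩ : (B \ C).Nonempty := card_pos.1 (by rw [h.card_sdiff]; omega)
    rw [mem_sdiff] at hv
    rcases (h1 Z hZ).2 with hn | hn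
    · right
      have hZB := subset_of_symmDiff hn h.card (h2 _ hZ _ hB)
      have hCZ : C ⊆ Z := by
        intro c hc
        by_contra hcZ
        have hcard : (insert c Z).card = n + 1 := by rw [card_insert_of_notMem hcZ, hn]
        have key : ∀ x ∈ B, x ∉ C → insert x C ⊆ insert c Z := fun x hxB hxC => by
          have h3 : insert c Z ⊆ Z ∪ insert x C :=
            insert_subset (mem_union_right _ (mem_insert_of_mem hc)) subset_union_left
          rw [eq_of_subset_of_card_le h3 (hcard ▸
            card_union_le_of_symmDiff hn (hCx x hxC) (h2 _ hZ _ (hx x hxB hxC)))]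
          exact subset_union_right
        have : B ⊆ insert c Z := fun b hb => by
          by_cases hbC : b ∈ C
          · exact key v hv.1 hv.2 (mem_insert_of_mem hbC)
          · exact key b hb hbC (mem_insert_self _ _)
        have := card_le_card this
        have := h.card
        omega
      obtain ⟨x, hxC, rfl⟩ : ∃ x, x ∉ C ∧ Z = insert x C := by
        obtain ⟨x, hxZ, rfl⟩ := exists_eq_erase_of_subset hCZ rfl (by rw [hn, h.card'])
        exact ⟨x, notMem_erase x Z, (insert_erase hxZ).symm⟩
      exact ⟨x, hZB (mem_insert_self _ _), hxC, rfl⟩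
    · left
      have key : ∀ x ∈ B, x ∉ C → insert x C ⊆ Z := fun x hxB hxC =>
        subset_of_symmDiff (hCx x hxC) hn (h2 _ (hx x hxB hxC) _ hZ)
      refine (eq_of_subset_of_card_le (fun b hb => ?_) (by rw [hn, h.card])).symm
      by_cases hbC : b ∈ C
      · exact key v hv.1 hv.2 (mem_insert_of_mem hbC)
      · exact key b hb hbC (mem_insert_self _ _)

theorem IsCritR.isFacet {A T : Finset ℕ} (h : IsCritR m n A T) :
    (vrTwo m n).IsFacet (Rcell A T) := by
  have hTx : ∀ x ∈ T, (T.erase x).card = n + 2 := fun x hx => by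
    rw [card_erase_of_mem hx, h.card']; rfl
  have hsub : ∀ x, x ∉ A → A ⊆ T.erase x := fun x hx => subset_erase.2 ⟨h.subset, hx⟩
  refine ⟨mem_vrTwo.2 ⟨⟨A, mem_insert_self _ _⟩, ?_, ?_⟩, fun τ hτ hs => ?_⟩
  · intro X hX
    rcases mem_Rcell.1 hX with rfl | ⟨x, hx, hxC, rfl⟩
    · exact ⟨h.subset.trans h.subset_Icc, Or.inl h.card⟩
    · exact ⟨(erase_subset _ _).trans h.subset_Icc, Or.inr (hTx x hx)⟩
  · intro X hX Y hY
    rcases mem_Rcell.1 hX with rfl | ⟨x, hx, hxA, rfl⟩ <;>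
      rcases mem_Rcell.1 hY with rfl | ⟨y, hy, hyA, rfl⟩
    · simp
    · exact card_symmDiff_of_subset (hsub y hyA) h.card (hTx y hy)
    · rw [symmDiff_comm]
      exact card_symmDiff_of_subset (hsub x hxA) h.card (hTx x hx)
    · exact symmDiff_erase_erase T x y
  · refine Subset.antisymm (fun Z hZ => mem_Rcell.2 ?_) hs
    rcases eq_sdiff_or_eq_erase hτ h.card' sdiff_subset h.card_sdiff
      ((subset_insert _ _).trans hs) hZ with rfl | ⟨w, hw, rfl⟩
    · exact Or.inl (Finset.sdiff_sdiff_eq_self h.subset)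
    · refine Or.inr ⟨w, hw, fun hwA => ?_, rfl⟩
      have := subset_of_symmDiff h.card (hTx w hw)
        ((mem_vrTwo.1 hτ).2.2 _ (hs (mem_insert_self _ _)) _ hZ) hwA
      exact notMem_erase w T this

theorem isFacet_of_mem_critCells {s : Finset (Finset ℕ)} (hs : s ∈ critCells m n) :
    (vrTwo m n).IsFacet s := by
  rcases hs with ⟨C, B, h, rfl⟩ | ⟨A, T, h, rfl⟩
  exacts [h.isFacet, h.isFacet]

theorem card_of_mem_critCells {s : Finset (Finset ℕ)} (hs : s ∈ critCells m n) : s.card = 4 := by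
  rcases hs with ⟨C, B, h, rfl⟩ | ⟨A, T, h, rfl⟩
  exacts [h.card_cell, h.card_cell]

theorem critCells_finite : (critCells m n).Finite := by
  refine (Icc 1 m).powerset.powerset.finite_toSet.subset fun s hs => ?_
  refine Finset.mem_coe.2 (Finset.mem_powerset.2 fun X hX => Finset.mem_powerset.2 ?_)
  exact ((mem_vrTwo.1 (isFacet_of_mem_critCells hs).1).2.1 X hX).1

theorem exists_pointedHEquiv_wedgeSph {N : ℕ} (hn : 1 ≤ n) (hm : n + 1 ≤ m)
    (hN : (critCells m n).ncard = N) :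
    ∃ a : (vrTwo m n).space, PointedHEquiv a (wedgeSphPt 3 N) :=
  have ⟨_, hv⟩ := exists_contractsTo_avoid_critCells hn hm
  AbsSC.pointedHEquiv_wedgeSph hN critCells_finite (fun _ => card_of_mem_critCells)
    (fun _ => isFacet_of_mem_critCells) hv

end Facets

section Counting

variable {m n : ℕ}

/-- The pairs `C ⊆ B` indexing critical facets. -/
def critQ (m n : ℕ) : Set (Finset ℕ × Finset ℕ) := {p | IsCritQ m n p.1 p.2}

/-- The pairs `A ⊆ T` indexing critical facets. -/
def critR (m n : ℕ) : Set (Finset ℕ × Finset ℕ) := {p | IsCritR m n p.1 p.2}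

theorem critQ_finite : (critQ m n).Finite := by
  refine ((Icc 1 m).powerset ×ˢ (Icc 1 m).powerset).finite_toSet.subset ?_
  intro p (hp : IsCritQ m n p.1 p.2)
  exact mem_coe.2 (mem_product.2
    ⟨mem_powerset.2 (hp.subset.trans hp.subset_Icc), mem_powerset.2 hp.subset_Icc⟩)

theorem critR_finite : (critR m n).Finite := by
  refine ((Icc 1 m).powerset ×ˢ (Icc 1 m).powerset).finite_toSet.subset ?_
  intro p (hp : IsCritR m n p.1 p.2)
  exact mem_coe.2 (mem_product.2
    ⟨mem_powerset.2 (hp.subset.trans hp.subset_Icc), mem_powerset.2 hp.subset_Icc⟩)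

theorem Rcell_injOn : Set.InjOn (fun p : Finset ℕ × Finset ℕ => Rcell p.1 p.2) (critR m n) := by
  have key : ∀ {A T A' T' : Finset ℕ}, IsCritR m n A T → IsCritR m n A' T' →
      Rcell A T ⊆ Rcell A' T' → A = A' ∧ T ⊆ T' := by
    intro A T A' T' h h' hs
    constructor
    · rcases mem_Rcell.1 (hs (mem_insert_self _ _)) with hA | ⟨x, hx, -, hA⟩
      · exact hA
      · have h1 := card_erase_of_mem hx
        rw [hA, h.card, h'.card'] at h1
        omega
    · refine subset_iUnion_coTriple h.card_sdiff fun X hX => ?_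
      rcases mem_Rcell.1 (hs (mem_insert_of_mem hX)) with rfl | ⟨x, -, -, rfl⟩
      · exact h'.subset
      · exact erase_subset _ _
  rintro ⟨A, T⟩ h ⟨A', T'⟩ h' (he : Rcell A T = Rcell A' T')
  have h1 := key h h' he.subset
  exact Prod.ext h1.1 (h1.2.antisymm (key h' h he.symm.subset).2)

theorem Qcell_injOn : Set.InjOn (fun p : Finset ℕ × Finset ℕ => Qcell p.1 p.2) (critQ m n) := by
  rintro ⟨C, B⟩ h ⟨C', B'⟩ h' (he : Qcell C B = Qcell C' B')
  have h : IsCritQ m n C B := h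
  have h' : IsCritQ m n C' B' := h'
  have := Qcell_subset_inj h'.subset h'.card h'.card' h.subset h.card h.card' he.subset
  exact Prod.ext this.1 this.2

theorem IsCritR.cell_ne {C B A T : Finset ℕ} (h : IsCritR m n A T) (h' : IsCritQ m n C B) :
    Rcell A T ≠ Qcell C B := by
  intro he
  have key : ∀ x ∈ T \ A, T.erase x = B := fun x hx => by
    have hx' := mem_sdiff.1 hx
    rcases mem_Qcell.1 (he ▸ mem_Rcell.2 (Or.inr ⟨x, hx'.1, hx'.2, rfl⟩)) with hB | ⟨y, -, hy, hB⟩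
    · exact hB
    · have h1 := card_insert_of_notMem hy
      rw [hB, card_erase_of_mem hx'.1, h.card', h'.card'] at h1
      omega
  obtain ⟨x, hx, y, hy, hxy⟩ := one_lt_card.1 (by rw [h.card_sdiff]; omega : 1 < (T \ A).card)
  exact hxy ((erase_inj T (mem_sdiff.1 hx).1).1 ((key x hx).trans (key y hy).symm))

theorem ncard_critCells : (critCells m n).ncard = (critQ m n).ncard + (critR m n).ncard := by
  have : critCells m n = (fun p : Finset ℕ × Finset ℕ => Qcell p.1 p.2) '' critQ m n ∪
      (fun p : Finset ℕ × Finset ℕ => Rcell p.1 p.2) '' critR m n := by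
    ext s
    simp only [critCells, Set.mem_ofPred_eq, Set.mem_union, Set.mem_image, Prod.exists, critQ,
      critR, @eq_comm _ s]
  rw [this, Set.ncard_union_eq _ (critQ_finite.image _) (critR_finite.image _),
    Qcell_injOn.ncard_image, Rcell_injOn.ncard_image]
  rw [Set.disjoint_left]
  rintro _ ⟨⟨C, B⟩, h, rfl⟩ ⟨⟨A, T⟩, h', he⟩
  exact IsCritR.cell_ne h' h he

/-- Shift a set of positive integers up by one and add the element `1`. -/
def shiftOne (S : Finset ℕ) : Finset ℕ := insert 1 (S.image (· + 1))

theorem succ_mem_shiftOne {S : Finset ℕ} {i : ℕ} (hi : i ≠ 0) : i + 1 ∈ shiftOne S ↔ i ∈ S := by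
  simp [shiftOne, hi]

theorem one_mem_shiftOne (S : Finset ℕ) : 1 ∈ shiftOne S := mem_insert_self _ _

theorem shiftOne_subset_Icc {S : Finset ℕ} (hS : S ⊆ Icc 1 m) :
    shiftOne S ⊆ Icc 1 (m + 1) := by
  intro x hx
  simp only [shiftOne, mem_insert, mem_image] at hx
  rcases hx with rfl | ⟨i, hi, rfl⟩
  · simp
  · have := mem_Icc.1 (hS hi)
    exact mem_Icc.2 (by omega)

theorem card_shiftOne {S : Finset ℕ} (hS : S ⊆ Icc 1 m) : (shiftOne S).card = S.card + 1 := by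
  rw [shiftOne, card_insert_of_notMem, card_image_of_injective _ (add_left_injective 1)]
  intro h
  obtain ⟨i, hi, h⟩ := mem_image.1 h
  have := mem_Icc.1 (hS hi)
  omega

theorem shiftOne_subset_shiftOne {S T : Finset ℕ} (hS : S ⊆ Icc 1 m) :
    shiftOne S ⊆ shiftOne T ↔ S ⊆ T := by
  refine ⟨fun h i hi => ?_, fun h => insert_subset_insert _ (image_subset_image h)⟩
  have hi0 : i ≠ 0 := by have := mem_Icc.1 (hS hi); omega
  exact (succ_mem_shiftOne hi0).1 (h ((succ_mem_shiftOne hi0).2 hi))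

theorem exists_eq_shiftOne {S : Finset ℕ} (h1 : 1 ∈ S) (hS : S ⊆ Icc 1 (m + 1)) :
    ∃ R ⊆ Icc 1 m, S = shiftOne R := by
  refine ⟨(Icc 1 m).filter (· + 1 ∈ S), filter_subset _ _, ?_⟩
  ext x
  simp only [shiftOne, mem_insert, mem_image, mem_filter, mem_Icc]
  constructor
  · intro hx
    have := mem_Icc.1 (hS hx)
    by_cases hx1 : x = 1
    · exact Or.inl hx1
    · exact Or.inr ⟨x - 1, ⟨by omega, by rwa [Nat.sub_add_cancel this.1]⟩, by omega⟩
  · rintro (rfl | ⟨i, ⟨-, hi⟩, rfl⟩)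
    exacts [h1, hi]

theorem shiftOne_max {C B : Finset ℕ} (hC : C ⊆ Icc 1 m) (hB : B ⊆ Icc 1 m) (hne : B.Nonempty) :
    (∃ c ∈ shiftOne C, ∀ x ∈ shiftOne B, x ≤ c) ↔ ∃ c ∈ C, ∀ x ∈ B, x ≤ c := by
  have hpos : ∀ x ∈ B, x ≠ 0 := fun x hx => by have := mem_Icc.1 (hB hx); omega
  constructor
  · rintro ⟨c, hc, h⟩
    simp only [shiftOne, mem_insert, mem_image] at hc
    rcases hc with rfl | ⟨i, hi, rfl⟩
    · obtain ⟨b, hb⟩ := hne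
      have h1 := h (b + 1) ((succ_mem_shiftOne (hpos b hb)).2 hb)
      exact absurd (hpos b hb) (by omega)
    · refine ⟨i, hi, fun x hx => ?_⟩
      have := h (x + 1) ((succ_mem_shiftOne (hpos x hx)).2 hx)
      omega
  · rintro ⟨c, hc, h⟩
    have hc0 : c ≠ 0 := by have := mem_Icc.1 (hC hc); omega
    refine ⟨c + 1, (succ_mem_shiftOne hc0).2 hc, fun x hx => ?_⟩
    simp only [shiftOne, mem_insert, mem_image] at hx
    rcases hx with rfl | ⟨i, hi, rfl⟩
    · omega
    · have := h i hi; omega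

theorem shiftOne_gap {C B : Finset ℕ} (hB : B ⊆ Icc 1 m) :
    (∃ y ∈ Icc 1 (m + 1), y ∉ shiftOne B ∧ ∀ x ∈ shiftOne B, x ∉ shiftOne C → y < x) ↔
      ∃ y ∈ Icc 1 m, y ∉ B ∧ ∀ x ∈ B, x ∉ C → y < x := by
  have hpos : ∀ x ∈ B, x ≠ 0 := fun x hx => by have := mem_Icc.1 (hB hx); omega
  constructor
  · rintro ⟨y, hy, hyB, h⟩
    have hy' := mem_Icc.1 hy
    have hy1 : y ≠ 1 := by rintro rfl; exact hyB (one_mem_shiftOne B)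
    obtain ⟨y, rfl⟩ : ∃ z, y = z + 1 := ⟨y - 1, by omega⟩
    refine ⟨y, mem_Icc.2 (by omega), fun h => hyB ((succ_mem_shiftOne (by omega)).2 h),
      fun x hx hxC => ?_⟩
    have := h (x + 1) ((succ_mem_shiftOne (hpos x hx)).2 hx)
      (fun h => hxC ((succ_mem_shiftOne (hpos x hx)).1 h))
    omega
  · rintro ⟨y, hy, hyB, h⟩
    have hy' := mem_Icc.1 hy
    refine ⟨y + 1, mem_Icc.2 (by omega), fun h => hyB ((succ_mem_shiftOne (by omega)).1 h),
      fun x hx hxC => ?_⟩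
    have hx1 : x ≠ 1 := by rintro rfl; exact hxC (one_mem_shiftOne C)
    have := mem_Icc.1 (shiftOne_subset_Icc hB hx)
    obtain ⟨x, rfl⟩ : ∃ z, x = z + 1 := ⟨x - 1, by omega⟩
    have := h x ((succ_mem_shiftOne (by omega)).1 hx)
      (fun h => hxC ((succ_mem_shiftOne (by omega)).2 h))
    omega

theorem isCritQ_shiftOne {C B : Finset ℕ} (hC : C ⊆ Icc 1 m) (hB : B ⊆ Icc 1 m) :
    IsCritQ (m + 1) (n + 1) (shiftOne C) (shiftOne B) ↔ IsCritQ m n C B := by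
  have c1 := card_shiftOne hC
  have c2 := card_shiftOne hB
  constructor
  · intro h
    have hc := h.card
    have hc' := h.card'
    have hne : B.Nonempty := card_pos.1 (by omega)
    exact ⟨(shiftOne_subset_shiftOne hC).1 h.subset, hB, by omega, by omega,
      (shiftOne_max hC hB hne).1 h.max, (shiftOne_gap hB).1 h.gap⟩
  · intro h
    have hc := h.card
    have hc' := h.card'
    have hne : B.Nonempty := card_pos.1 (by omega)
    exact ⟨(shiftOne_subset_shiftOne hC).2 h.subset, shiftOne_subset_Icc hB, by omega, by omega,
      (shiftOne_max hC hB hne).2 h.max, (shiftOne_gap hB).2 h.gap⟩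

theorem isCritR_shiftOne {A T : Finset ℕ} (hA : A ⊆ Icc 1 m) (hT : T ⊆ Icc 1 m) :
    IsCritR (m + 1) (n + 1) (shiftOne A) (shiftOne T) ↔ IsCritR m n A T := by
  have c1 := card_shiftOne hA
  have c2 := card_shiftOne hT
  constructor
  · intro h
    have hc := h.card
    have hc' := h.card'
    have hne : T.Nonempty := card_pos.1 (by omega)
    exact ⟨(shiftOne_subset_shiftOne hA).1 h.subset, hT, by omega, by omega,
      (shiftOne_max hA hT hne).1 h.max⟩
  · intro h
    have hc := h.card
    have hc' := h.card'
    have hne : T.Nonempty := card_pos.1 (by omega)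
    exact ⟨(shiftOne_subset_shiftOne hA).2 h.subset, shiftOne_subset_Icc hT, by omega, by omega,
      (shiftOne_max hA hT hne).2 h.max⟩

theorem shiftOne_injOn :
    Set.InjOn (Prod.map shiftOne shiftOne) {p | p.1 ⊆ Icc 1 m ∧ p.2 ⊆ Icc 1 m} := by
  have key : ∀ {S T}, S ⊆ Icc 1 m → T ⊆ Icc 1 m → shiftOne S = shiftOne T → S = T :=
    fun hS hT h => ((shiftOne_subset_shiftOne hS).1 h.subset).antisymm
      ((shiftOne_subset_shiftOne hT).1 h.symm.subset)
  rintro ⟨A, T⟩ h ⟨A', T'⟩ h' he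
  exact Prod.ext (key h.1 h'.1 (congrArg Prod.fst he)) (key h.2 h'.2 (congrArg Prod.snd he))

theorem ncard_critQ_one_mem :
    (critQ (m + 1) (n + 1) ∩ {p | 1 ∈ p.1}).ncard = (critQ m n).ncard := by
  have hI : critQ m n ⊆ {p | p.1 ⊆ Icc 1 m ∧ p.2 ⊆ Icc 1 m} := fun p hp =>
    ⟨hp.subset.trans hp.subset_Icc, hp.subset_Icc⟩
  rw [← (shiftOne_injOn.mono hI).ncard_image]
  congr 1
  ext ⟨C, B⟩
  constructor
  · rintro ⟨h : IsCritQ _ _ C B, h1 : 1 ∈ C⟩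
    obtain ⟨C, hC, rfl⟩ := exists_eq_shiftOne h1 (h.subset.trans h.subset_Icc)
    obtain ⟨B, hB, rfl⟩ := exists_eq_shiftOne (h.subset h1) h.subset_Icc
    exact ⟨(C, B), (isCritQ_shiftOne hC hB).1 h, rfl⟩
  · rintro ⟨⟨C, B⟩, h, he⟩
    cases he
    exact ⟨(isCritQ_shiftOne (hI h).1 (hI h).2).2 h, one_mem_shiftOne _⟩

theorem ncard_critR_one_mem :
    (critR (m + 1) (n + 1) ∩ {p | 1 ∈ p.1}).ncard = (critR m n).ncard := by
  have hI : critR m n ⊆ {p | p.1 ⊆ Icc 1 m ∧ p.2 ⊆ Icc 1 m} := fun p hp =>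
    ⟨hp.subset.trans hp.subset_Icc, hp.subset_Icc⟩
  rw [← (shiftOne_injOn.mono hI).ncard_image]
  congr 1
  ext ⟨A, T⟩
  constructor
  · rintro ⟨h : IsCritR _ _ A T, h1 : 1 ∈ A⟩
    obtain ⟨A, hA, rfl⟩ := exists_eq_shiftOne h1 (h.subset.trans h.subset_Icc)
    obtain ⟨T, hT, rfl⟩ := exists_eq_shiftOne (h.subset h1) h.subset_Icc
    exact ⟨(A, T), (isCritR_shiftOne hA hT).1 h, rfl⟩
  · rintro ⟨⟨A, T⟩, h, he⟩
    cases he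
    exact ⟨(isCritR_shiftOne (hI h).1 (hI h).2).2 h, one_mem_shiftOne _⟩

theorem sup_id_mem {B : Finset ℕ} (hB : B.Nonempty) : B.sup id ∈ B := by
  obtain ⟨b, hb, h⟩ := exists_mem_eq_sup B hB id
  rw [h]
  exact hb

theorem eq_sup_id {B : Finset ℕ} {c : ℕ} (hc : c ∈ B) (h : ∀ x ∈ B, x ≤ c) : c = B.sup id :=
  le_antisymm (le_sup (f := id) hc) (Finset.sup_le h)

theorem card_erase_sup {B : Finset ℕ} (hB : B.card = n + 2) : (B.erase (B.sup id)).card = n + 1 := by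
  rw [card_erase_of_mem (sup_id_mem (card_pos.1 (by omega))), hB]
  rfl

/-- The sets of size `n + 2` in `{2, …, m}`. -/
def upperSets (m n : ℕ) : Finset (Finset ℕ) :=
  (Icc 1 m).powerset.filter fun A => A.card = n + 2 ∧ ∀ x ∈ A, 2 ≤ x

theorem mem_upperSets {B : Finset ℕ} :
    B ∈ upperSets m n ↔ B ⊆ Icc 1 m ∧ B.card = n + 2 ∧ 1 ∉ B := by
  rw [upperSets, mem_filter, mem_powerset]
  refine and_congr_right fun h => and_congr_right fun _ => ?_
  refine ⟨fun h1 h2 => absurd (h1 1 h2) (by omega), fun h1 x hx => ?_⟩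
  have := mem_Icc.1 (h hx)
  have : x ≠ 1 := by rintro rfl; exact h1 hx
  omega

theorem ncard_critQ_one_notMem :
    (critQ m n \ {p | 1 ∈ p.1}).ncard = ∑ _B ∈ upperSets m n, (n + 1).choose 3 := by
  set D : Finset (Σ _ : Finset ℕ, Finset ℕ) :=
    (upperSets m n).sigma fun B => powersetCard 3 (B.erase (B.sup id)) with hD
  have hDc : D.card = ∑ _B ∈ upperSets m n, (n + 1).choose 3 := by
    rw [hD, card_sigma]
    refine sum_congr rfl fun B hB => ?_
    rw [card_powersetCard, card_erase_sup (mem_upperSets.1 hB).2.1]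
  have hmem : ∀ B X, (⟨B, X⟩ : Σ _ : Finset ℕ, Finset ℕ) ∈ D ↔
      (B ⊆ Icc 1 m ∧ B.card = n + 2 ∧ 1 ∉ B) ∧ (X ⊆ B ∧ B.sup id ∉ X) ∧ X.card = 3 := by
    intro B X
    rw [hD, mem_sigma, mem_upperSets, mem_powersetCard, subset_erase]
  have hinj : Set.InjOn (fun p : Σ _ : Finset ℕ, Finset ℕ => (p.1 \ p.2, p.1)) D := by
    rintro ⟨B, X⟩ h ⟨B', X'⟩ h' he
    obtain ⟨h1, rfl⟩ := Prod.mk.injEq _ _ _ _ ▸ he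
    have e1 := ((hmem _ _).1 h).2.1.1
    have e2 := ((hmem _ _).1 h').2.1.1
    have h1 : B \ X = B \ X' := h1
    have : X = X' := by rw [← Finset.sdiff_sdiff_eq_self e1, h1, Finset.sdiff_sdiff_eq_self e2]
    rw [this]
  rw [← hDc, ← Set.ncard_coe_finset, ← hinj.ncard_image]
  congr 1
  ext ⟨C, B⟩
  constructor
  · rintro ⟨h : IsCritQ m n C B, h1 : 1 ∉ C⟩
    obtain ⟨y, hy, -, hgap⟩ := h.gap
    have hy := mem_Icc.1 hy
    obtain ⟨c, hc, hmax⟩ := h.max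
    refine ⟨⟨B, B \ C⟩, (hmem _ _).2 ⟨⟨h.subset_Icc, h.card, fun h2 => ?_⟩,
      ⟨sdiff_subset, fun h2 => ?_⟩, h.card_sdiff⟩, ?_⟩
    · have := hgap 1 h2 h1
      omega
    · rw [← eq_sup_id (h.subset hc) hmax] at h2
      exact (mem_sdiff.1 h2).2 hc
    · simp only [Finset.sdiff_sdiff_eq_self h.subset]
  · rintro ⟨⟨B, X⟩, h, he⟩
    obtain ⟨⟨h1, h2, h3⟩, ⟨h4, h5⟩, h6⟩ := (hmem _ _).1 h
    cases he
    have hs := sup_id_mem (card_pos.1 (by omega : 0 < B.card))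
    have := mem_Icc.1 (h1 hs)
    have h7 := card_le_card (subset_erase.2 ⟨h4, h5⟩)
    rw [card_erase_sup h2] at h7
    refine ⟨⟨sdiff_subset, h1, h2, by rw [card_sdiff_of_subset h4]; omega,
      ⟨_, mem_sdiff.2 ⟨hs, h5⟩, fun x hx => le_sup (f := id) hx⟩,
      ⟨1, mem_Icc.2 (by omega), h3, fun x hx _ => ?_⟩⟩, fun h => h3 (mem_sdiff.1 h).1⟩
    have := mem_Icc.1 (h1 hx)
    have : x ≠ 1 := by rintro rfl; exact h3 hx
    omega

theorem ncard_critR_one_notMem (hn : 1 ≤ n) :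
    (critR m n \ {p | 1 ∈ p.1}).ncard = ∑ B ∈ upperSets m n,
      ∑ x ∈ Icc 1 m \ B, ((B.erase (B.sup id)).filter (x < ·)).card.choose 2 := by
  set D : Finset (Σ _ : Finset ℕ, Σ _ : ℕ, Finset ℕ) :=
    (upperSets m n).sigma fun B => (Icc 1 m \ B).sigma fun x =>
      powersetCard 2 ((B.erase (B.sup id)).filter (x < ·)) with hD
  have hDc : D.card = ∑ B ∈ upperSets m n,
      ∑ x ∈ Icc 1 m \ B, ((B.erase (B.sup id)).filter (x < ·)).card.choose 2 := by
    simp only [hD, card_sigma, card_powersetCard]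
  have hmem : ∀ B x U, (⟨B, x, U⟩ : Σ _ : Finset ℕ, Σ _ : ℕ, Finset ℕ) ∈ D ↔
      (B ⊆ Icc 1 m ∧ B.card = n + 2 ∧ 1 ∉ B) ∧ (x ∈ Icc 1 m ∧ x ∉ B) ∧
        (U ⊆ B ∧ B.sup id ∉ U ∧ ∀ u ∈ U, x < u) ∧ U.card = 2 := by
    intro B x U
    have : U ⊆ (B.erase (B.sup id)).filter (x < ·) ↔ U ⊆ B ∧ B.sup id ∉ U ∧ ∀ u ∈ U, x < u := by
      rw [← and_assoc, ← subset_erase]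
      simp only [subset_iff, mem_filter, forall_and]
    rw [hD, mem_sigma, mem_upperSets, mem_sigma, mem_sdiff, mem_powersetCard, this]
  have hinj : Set.InjOn (fun p : Σ _ : Finset ℕ, Σ _ : ℕ, Finset ℕ =>
      (p.1 \ p.2.2, insert p.2.1 p.1)) D := by
    have key : ∀ {B : Finset ℕ} {x : ℕ} {U : Finset ℕ}, x ∉ B → U ⊆ B → insert x B \ (B \ U) = insert x U := by
      intro B x U hx hU
      ext z
      simp only [mem_sdiff, mem_insert]
      constructor
      · tauto
      · rintro (rfl | hz)
        · tauto
        · exact ⟨Or.inr (hU hz), fun h => h.2 hz⟩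
    rintro ⟨B, x, U⟩ h ⟨B', x', U'⟩ h' he
    obtain ⟨-, ⟨-, hx⟩, ⟨hU, -, hlt⟩, -⟩ := (hmem _ _ _).1 h
    obtain ⟨-, ⟨-, hx'⟩, ⟨hU', -, hlt'⟩, -⟩ := (hmem _ _ _).1 h'
    have e1 : B \ U = B' \ U' := congrArg Prod.fst he
    have e2 : insert x B = insert x' B' := congrArg Prod.snd he
    have e3 : insert x U = insert x' U' := by rw [← key hx hU, e1, e2, key hx' hU']
    have hxU : x ∉ U := fun h => (hlt x h).ne rfl
    have hxU' : x' ∉ U' := fun h => (hlt' x' h).ne rfl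
    obtain rfl : x = x' := by
      have h1 : x ∈ insert x' U' := e3 ▸ mem_insert_self _ _
      have h2 : x' ∈ insert x U := e3 ▸ mem_insert_self _ _
      rcases mem_insert.1 h1 with h1 | h1
      · exact h1
      rcases mem_insert.1 h2 with h2 | h2
      · exact h2.symm
      exact absurd (hlt' _ h1) (hlt _ h2).not_gt
    obtain rfl : B = B' := by rw [← erase_insert hx, e2, erase_insert hx']
    obtain rfl : U = U' := by rw [← erase_insert hxU, e3, erase_insert hxU']
    rfl
  rw [← hDc, ← Set.ncard_coe_finset, ← hinj.ncard_image]
  congr 1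
  ext ⟨A, T⟩
  constructor
  · rintro ⟨h : IsCritR m n A T, h1 : 1 ∉ A⟩
    obtain ⟨c, hc, hmax⟩ := h.max
    have hne : (T \ A).Nonempty := card_pos.1 (by rw [h.card_sdiff]; omega)
    set x := (T \ A).min' hne with hx
    have hxTA : x ∈ T \ A := min'_mem _ hne
    have hxT := mem_sdiff.1 hxTA
    have hcx : c ≠ x := by rintro rfl; exact hxT.2 hc
    have hcT : c ∈ T.erase x := mem_erase.2 ⟨hcx, h.subset hc⟩
    refine ⟨⟨T.erase x, x, (T \ A).erase x⟩, (hmem _ _ _).2 ⟨⟨(erase_subset _ _).trans h.subset_Icc,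
      ?_, fun h2 => ?_⟩, ⟨h.subset_Icc hxT.1, notMem_erase _ _⟩,
      ⟨erase_subset_erase _ sdiff_subset, fun h2 => ?_, fun u hu => ?_⟩, ?_⟩, ?_⟩
    · rw [card_erase_of_mem hxT.1, h.card']; rfl
    · have h3 := mem_erase.1 h2
      have h4 := min'_le _ _ (mem_sdiff.2 ⟨h3.2, h1⟩)
      have h5 := mem_Icc.1 (h.subset_Icc hxT.1)
      exact h3.1 (le_antisymm h5.1 h4)
    · rw [← eq_sup_id hcT fun y hy => hmax y (mem_of_mem_erase hy)] at h2
      exact (mem_sdiff.1 (mem_of_mem_erase h2)).2 hc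
    · exact min'_lt_of_mem_erase_min' _ hne hu
    · rw [card_erase_of_mem hxTA, h.card_sdiff]
    · refine Prod.ext ?_ (insert_erase hxT.1)
      ext z
      have : z ∈ A → z ∈ T := fun h2 => h.subset h2
      have : z ∈ A → z ≠ x := by rintro h2 rfl; exact hxT.2 h2
      simp only [mem_sdiff, mem_erase]
      tauto
  · rintro ⟨⟨B, x, U⟩, h, he⟩
    obtain ⟨⟨h1, h2, h3⟩, ⟨hxm, hxB⟩, ⟨hU, hsup, hlt⟩, hU2⟩ := (hmem _ _ _).1 h
    cases he
    have hs := sup_id_mem (card_pos.1 (by omega : 0 < B.card))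
    refine ⟨⟨sdiff_subset.trans (subset_insert _ _), insert_subset hxm h1,
      by rw [card_sdiff_of_subset hU]; omega, by rw [card_insert_of_notMem hxB]; omega,
      ⟨_, mem_sdiff.2 ⟨hs, hsup⟩, fun z hz => ?_⟩⟩, fun h => h3 (mem_sdiff.1 h).1⟩
    rcases mem_insert.1 hz with rfl | hz
    · obtain ⟨u, hu⟩ : U.Nonempty := card_pos.1 (by omega)
      exact (hlt u hu).le.trans (le_sup (f := id) (hU hu))
    · exact le_sup (f := id) hz

theorem ncard_critQ_one : (critQ m 1).ncard = 0 := by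
  rw [Set.ncard_eq_zero critQ_finite, Set.eq_empty_iff_forall_notMem]
  rintro ⟨C, B⟩ (h : IsCritQ m 1 C B)
  obtain ⟨c, hc, -⟩ := h.max
  have := card_pos.2 ⟨c, hc⟩
  have := h.card'
  omega

theorem ncard_critR_one : (critR m 1).ncard = m.choose 4 := by
  have hinj : Set.InjOn (fun T : Finset ℕ => (({T.sup id} : Finset ℕ), T))
      (powersetCard 4 (Icc 1 m)) := fun T _ T' _ he => congrArg Prod.snd he
  have : m.choose 4 = (powersetCard 4 (Icc 1 m)).card := by simp
  rw [this, ← Set.ncard_coe_finset, ← hinj.ncard_image]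
  congr 1
  ext ⟨A, T⟩
  constructor
  · intro (h : IsCritR m 1 A T)
    refine ⟨T, mem_coe.2 (mem_powersetCard.2 ⟨h.subset_Icc, h.card'⟩), ?_⟩
    obtain ⟨a, rfl⟩ := card_eq_one.1 h.card
    obtain ⟨c, hc, hmax⟩ := h.max
    rw [mem_singleton] at hc
    subst hc
    simp only [← eq_sup_id (singleton_subset_iff.1 h.subset) hmax]
  · rintro ⟨T, hT, he⟩
    obtain ⟨h1, h2⟩ := mem_powersetCard.1 (mem_coe.1 hT)
    cases he
    exact ⟨singleton_subset_iff.2 (sup_id_mem (card_pos.1 (by omega : 0 < T.card))), h1,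
      card_singleton _, h2,
      ⟨_, mem_singleton_self _, fun x hx => le_sup (f := id) hx⟩⟩

/-- Summing over the gaps of a sorted list a function of the number of larger entries. -/
theorem sum_gaps (g : ℕ → ℕ) (hg : g 0 = 0) (M : ℕ) (l : List ℕ) (p : ℕ)
    (hs : l.Pairwise (· < ·)) (hp : ∀ x ∈ l, p < x) (hM : ∀ x ∈ l, x < M) :
    ∑ x ∈ Ioo p M \ l.toFinset, g (l.toFinset.filter (x < ·)).card =
      ∑ i ∈ range l.length,
        (l.getD i 0 - if i = 0 then p + 1 else l.getD (i - 1) 0 + 1) * g (l.length - i) := by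
  induction l generalizing p with
  | nil => simp [hg]
  | cons a l ih =>
    obtain ⟨hal, hs'⟩ := List.pairwise_cons.1 hs
    have hpa : p < a := hp a List.mem_cons_self
    have haM : a < M := hM a List.mem_cons_self
    have hsplit : Ioo p M \ (a :: l).toFinset = Ioo p a ∪ (Ioo a M \ l.toFinset) := by
      ext x
      simp only [List.toFinset_cons, mem_sdiff, mem_Ioo, mem_insert, List.mem_toFinset, mem_union]
      by_cases hx : x ∈ l
      · have := hal x hx
        simp only [hx, not_true, or_true, and_false, or_false, false_iff]
        omega
      · simp only [hx, or_false, not_false_iff, and_true]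
        omega
    have hdisj : Disjoint (Ioo p a) (Ioo a M \ l.toFinset) := by
      rw [disjoint_left]
      intro x hx hx'
      have h1 := mem_Ioo.1 hx
      have h2 := mem_Ioo.1 (mem_sdiff.1 hx').1
      omega
    have hlow : ∀ x ∈ Ioo p a, ((a :: l).toFinset.filter (x < ·)).card = (a :: l).length := by
      intro x hx
      have hx := mem_Ioo.1 hx
      rw [filter_true_of_mem, List.toFinset_card_of_nodup (hs.imp fun h => h.ne)]
      intro u hu
      rcases List.mem_cons.1 (List.mem_toFinset.1 hu) with rfl | hu
      · exact hx.2
      · exact hx.2.trans (hal u hu)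
    have hhigh : ∀ x ∈ Ioo a M \ l.toFinset,
        (a :: l).toFinset.filter (x < ·) = l.toFinset.filter (x < ·) := by
      intro x hx
      have hx := mem_Ioo.1 (mem_sdiff.1 hx).1
      rw [List.toFinset_cons, filter_insert, if_neg (by omega)]
    rw [hsplit, sum_union hdisj, sum_congr rfl fun x hx => congrArg g (hlow x hx),
      sum_congr rfl fun x hx => congrArg (fun s => g (card s)) (hhigh x hx),
      ih a hs' hal fun x hx => hM x (List.mem_cons_of_mem _ hx), List.length_cons,
      sum_range_succ', sum_const, Nat.card_Ioo, add_comm, smul_eq_mul]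
    congr 1
    · refine sum_congr rfl fun i _ => ?_
      rw [Nat.add_sub_add_right]
      cases i <;> simp

theorem sum_gaps_eq {B : Finset ℕ} (hB : B ⊆ Icc 1 m) (hc : B.card = n + 2) :
    ∑ x ∈ Icc 1 m \ B, ((B.erase (B.sup id)).filter (x < ·)).card.choose 2 =
      ∑ i ∈ Icc 1 n, ((B.sort (· ≤ ·)).getD (i - 1) 0 -
        (if i = 1 then 1 else (B.sort (· ≤ ·)).getD (i - 2) 0 + 1)) * (n + 2 - i).choose 2 := by
  have hmem : ∀ x ∈ B.sort (· ≤ ·), x ∈ Icc 1 m := fun x hx => hB ((mem_sort _).1 hx)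
  have key := sum_gaps (fun k => (k - 1).choose 2) rfl (m + 1) (B.sort (· ≤ ·)) 0
    (B.sortedLT_sort.pairwise) (fun x hx => (mem_Icc.1 (hmem x hx)).1)
    (fun x hx => Nat.lt_succ_of_le (mem_Icc.1 (hmem x hx)).2)
  rw [sort_toFinset, length_sort, hc] at key
  have hI : Ioo 0 (m + 1) = Icc 1 m := by ext; simp only [mem_Ioo, mem_Icc]; omega
  have hfil : ∀ x, (((B.erase (B.sup id)).filter (x < ·)).card.choose 2) =
      ((B.filter (x < ·)).card - 1).choose 2 := by
    intro x
    rw [filter_erase]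
    by_cases hx : x < B.sup id
    · rw [card_erase_of_mem (mem_filter.2 ⟨sup_id_mem (card_pos.1 (by omega)), hx⟩)]
    · rw [filter_false_of_mem fun u hu hxu => hx (hxu.trans_le (le_sup (f := id) hu))]
      rfl
  rw [sum_congr rfl fun x _ => hfil x, ← hI, key, sum_range_succ, sum_range_succ,
    ← Ico_add_one_right_eq_Icc, sum_Ico_eq_sum_range]
  have e1 : n + 2 - (n + 1) - 1 = 0 := by omega
  have e2 : n + 2 - n - 1 = 1 := by omega
  rw [e1, e2, Nat.choose_eq_zero_of_lt one_lt_two, Nat.choose_eq_zero_of_lt zero_lt_two, mul_zero,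
    mul_zero, add_zero, add_zero, Nat.add_sub_cancel]
  refine sum_congr rfl fun i _ => ?_
  rw [show n + 2 - i - 1 = n + 2 - (1 + i) by omega, show 1 + i - 1 = i by omega,
    show 1 + i - 2 = i - 1 by omega]
  simp

theorem sum_sA_eq_omn : ∑ B ∈ upperSets m n, ((n + 1).choose 3 +
    ∑ x ∈ Icc 1 m \ B, ((B.erase (B.sup id)).filter (x < ·)).card.choose 2) = omn m n := by
  refine sum_congr rfl fun B hB => ?_
  obtain ⟨h1, h2, -⟩ := mem_upperSets.1 hB
  rw [sum_gaps_eq h1 h2, sA, h2, Nat.add_sub_cancel, Nat.sum_Icc_choose]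

theorem ncard_critCells_succ : (critCells (m + 1) (n + 1)).ncard =
    (critCells m n).ncard + omn (m + 1) (n + 1) := by
  have h1 := Set.ncard_inter_add_ncard_sdiff_eq_ncard (critQ (m + 1) (n + 1)) {p | 1 ∈ p.1}
    critQ_finite
  have h2 := Set.ncard_inter_add_ncard_sdiff_eq_ncard (critR (m + 1) (n + 1)) {p | 1 ∈ p.1}
    critR_finite
  rw [ncard_critQ_one_mem] at h1
  rw [ncard_critR_one_mem] at h2
  rw [ncard_critCells, ncard_critCells, ← sum_sA_eq_omn, sum_add_distrib,
    ← ncard_critQ_one_notMem, ← ncard_critR_one_notMem (by omega)]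
  omega

theorem ncard_critCells_eq (hn : 1 ≤ n) (hm : n + 1 ≤ m) : (critCells m n).ncard =
    ∑ k ∈ Icc 2 n, omn (m + k - n) k + (m + 1 - n).choose 4 := by
  induction n, hn using Nat.le_induction generalizing m with
  | base => simp [ncard_critCells, ncard_critQ_one, ncard_critR_one]
  | succ n hn ih =>
    obtain ⟨m, rfl⟩ : ∃ k, m = k + 1 := ⟨m - 1, by omega⟩
    rw [ncard_critCells_succ, ih (by omega), sum_Icc_succ_top (by omega), Nat.add_sub_cancel,
      Nat.add_sub_add_right, add_right_comm]
    refine congrArg (· + _ + _) (sum_congr rfl fun k _ => ?_)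
    rw [add_right_comm, Nat.add_sub_add_right]

end Counting

section Assembly

/-- A wedge decomposition of one complex from pointed equivalences with wedges of spheres. -/
theorem nonempty_homotopyEquiv_wedge2 {X Y : Type} [TopologicalSpace X] [TopologicalSpace Y]
    {a b : ℕ} {x : X} {y : Y} (hx : PointedHEquiv x (wedgeSphPt 3 (b + a)))
    (hy : PointedHEquiv y (wedgeSphPt 3 b)) :
    Nonempty (ContinuousMap.HomotopyEquiv X (Wedge2 Y (WedgeSph 3 a) y (wedgeSphPt 3 a))) := by
  obtain ⟨e⟩ := hx.nonempty_homotopyEquiv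
  obtain ⟨f⟩ := nonempty_wedge_add_homeomorph (x := sphBase 3) b a
  obtain ⟨g⟩ := hy.symm.wedge2_left (wedgeSphPt 3 a)
  exact ⟨e.trans (f.toHomotopyEquiv.trans g)⟩

end Assembly

/-- For `2 ≤ n < m - 3`, with `o_{m,n} = Σ{s_A : A ∈ F^m_{n+2}, min A ≥ 2}`,
`VR(F_n^m ∪ F_{n+2}^m, 2) ≃ VR(F^{m-1}_{n-1} ∪ F^{m-1}_{n+1}, 2) ∨ (∨_{o_{m,n}} S³)`;
consequently, for `1 ≤ n < m - 3`, `VR(F_n^m ∪ F_{n+2}^m, 2)` is homotopy equivalent to a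
wedge of `Σ_{k=2}^{n} o_{m+k-n,k} + C(m+1-n, 4)` copies of `S³`. -/
theorem stmt18 (m : ℕ) :
    (∀ n : ℕ, 2 ≤ n → n + 3 < m →
      ∃ y : (VRc (Fnm (m - 1) (n - 1) ∪ Fnm (m - 1) (n + 1)) 2).space,
        Nonempty (ContinuousMap.HomotopyEquiv
          ((VRc (Fnm m n ∪ Fnm m (n + 2)) 2).space)
          (Wedge2 ((VRc (Fnm (m - 1) (n - 1) ∪ Fnm (m - 1) (n + 1)) 2).space)
            (WedgeSph 3 (omn m n)) y (wedgeSphPt 3 (omn m n))))) ∧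
    (∀ n : ℕ, 1 ≤ n → n + 3 < m →
      AbsSC.HEquivTop (VRc (Fnm m n ∪ Fnm m (n + 2)) 2)
        (WedgeSph 3 ((∑ k ∈ Finset.Icc 2 n, omn (m + k - n) k) + (m + 1 - n).choose 4))) := by
  refine ⟨fun n hn hm => ?_, fun n hn hm => ?_⟩
  · obtain ⟨m, rfl⟩ : ∃ k, m = k + 1 := ⟨m - 1, by omega⟩
    obtain ⟨n, rfl⟩ : ∃ k, n = k + 1 := ⟨n - 1, by omega⟩
    obtain ⟨x, hx⟩ := exists_pointedHEquiv_wedgeSph (n := n + 1) (by omega) (by omega)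
      (ncard_critCells_succ (m := m) (n := n))
    obtain ⟨y, hy⟩ := exists_pointedHEquiv_wedgeSph (m := m) (n := n) (by omega) (by omega) rfl
    exact ⟨y, nonempty_homotopyEquiv_wedge2 hx hy⟩
  · obtain ⟨x, hx⟩ := exists_pointedHEquiv_wedgeSph hn (by omega)
      (ncard_critCells_eq (m := m) hn (by omega))
    exact hx.nonempty_homotopyEquiv
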